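/- arXiv:1707.02287 — 9 statements merged into one kernel-verified Lean document; each statement's English description precedes it below -/
import Mathlib

section
/- Let q be a positive integer with prime factorization q = p_1^{a_1} ⋯ p_r^{a_r} (distinct primes p_1, …, p_r), and let n be a positive integer. Then there exists a vector x ∈ (ℤ/qℤ)^n such that ∑_{i=1}^n exp(2πi·x_i/q) = 0 if and only if there exist nonnegative integers w_1, …, w_r such that n = ∑_{i=1}^r w_i·p_i. -/
open Complex Finset

/-- The evaluation of a vector `x ∈ (ℤ/qℤ)^n` as a sum of complex `q`-th roots of unity. -/
noncomputable def rootSumEval (n q : ℕ) (x : Fin n → ZMod q) : ℂ :=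
  ∑ i, Complex.exp (2 * Real.pi * Complex.I * ((x i).val : ℂ) / q)

open Polynomial IntermediateField

section Splitting

variable {m p : ℕ} {ω : ℂ}

theorem injOn_pow_mul_nthRoots (hm : 0 < m) (hω : IsPrimitiveRoot (ω ^ m) p) :
    Set.InjOn (fun t : ℕ × ℂ => ω ^ t.1 * t.2)
      (range p ×ˢ nthRootsFinset m (1 : ℂ) : Finset (ℕ × ℂ)) := by
  rintro ⟨i, z⟩ hi ⟨j, w⟩ hj h
  simp only [coe_product, Set.mem_prod, mem_coe, Finset.mem_range, mem_nthRootsFinset hm] at hi hj h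
  have hij : i = j := by
    refine hω.pow_inj hi.1 hj.1 ?_
    have := congrArg (· ^ m) h
    simpa [mul_pow, hi.2, hj.2, ← pow_mul, mul_comm m] using this
  subst hij
  have h0 : ω ≠ 0 := by
    rintro rfl
    have := hω.pow_eq_one
    rw [zero_pow hm.ne', zero_pow (by grind)] at this
    exact zero_ne_one this
  rw [mul_right_inj' (pow_ne_zero _ h0)] at h
  rw [h]

theorem nthRootsFinset_mul_eq_image (hm : 0 < m) (hp : 0 < p)
    (hω : IsPrimitiveRoot (ω ^ m) p) :
    nthRootsFinset (p * m) (1 : ℂ) =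
      (range p ×ˢ nthRootsFinset m (1 : ℂ)).image (fun t => ω ^ t.1 * t.2) := by
  symm
  apply Finset.eq_of_subset_of_card_le
  · intro u hu
    obtain ⟨⟨i, z⟩, hi, rfl⟩ := Finset.mem_image.1 hu
    simp only [Finset.mem_product, mem_nthRootsFinset hm] at hi
    rw [mem_nthRootsFinset (by positivity), mul_pow, mul_comm p m, pow_mul z, hi.2, one_pow,
      mul_one, ← pow_mul, show i * (m * p) = m * p * i by ring, pow_mul, pow_mul,
      hω.pow_eq_one, one_pow]
  · rw [Finset.card_image_of_injOn (injOn_pow_mul_nthRoots hm hω), Finset.card_product,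
      (Complex.isPrimitiveRoot_exp m hm.ne').card_nthRootsFinset,
      (Complex.isPrimitiveRoot_exp (p * m) (by positivity)).card_nthRootsFinset, Finset.card_range]

theorem sum_nthRootsFinset_mul {M : Type*} [AddCommMonoid M] (hm : 0 < m) (hp : 0 < p)
    (hω : IsPrimitiveRoot (ω ^ m) p) (F : ℂ → M) :
    ∑ u ∈ nthRootsFinset (p * m) (1 : ℂ), F u =
      ∑ i ∈ range p, ∑ z ∈ nthRootsFinset m (1 : ℂ), F (ω ^ i * z) := by
  rw [nthRootsFinset_mul_eq_image hm hp hω, Finset.sum_image (injOn_pow_mul_nthRoots hm hω),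
    Finset.sum_product]

end Splitting

theorem eq_zero_of_sum_mul_pow_eq_zero {K : IntermediateField ℚ ℂ} {ω : ℂ} {d : ℕ}
    (hd : d ≤ (minpoly K ω).natDegree) {c : ℕ → ℂ} (hc : ∀ i, c i ∈ K)
    (h : ∑ i ∈ range d, c i * ω ^ i = 0) : ∀ i < d, c i = 0 := by
  have hli := (linearIndependent_pow (K := K) ω).comp (Fin.castLE hd) (Fin.castLE_injective hd)
  rw [Fintype.linearIndependent_iff] at hli
  intro i hi
  have := hli (fun i => ⟨c i, hc i⟩) (by
    rw [← h, Finset.sum_range]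
    rfl) ⟨i, hi⟩
  exact congrArg Subtype.val this

theorem finrank_adjoin_primitiveRoot {m : ℕ} (hm : 0 < m) {ζ : ℂ} (hζ : IsPrimitiveRoot ζ m) :
    Module.finrank ℚ ℚ⟮ζ⟯ = m.totient := by
  rw [adjoin.finrank (hζ.isIntegral hm).tower_top, ← cyclotomic_eq_minpoly_rat hζ hm,
    natDegree_cyclotomic]

theorem totient_le_mul_natDegree {m n : ℕ} (hm : 0 < m) (hn : 0 < n) {ζ η ω : ℂ}
    (hζ : IsPrimitiveRoot ζ m) (hη : IsPrimitiveRoot η n) (hω : IsIntegral ℤ ω)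
    (hmem : η ∈ ℚ⟮ζ⟯⟮ω⟯) :
    n.totient ≤ m.totient * (minpoly ℚ⟮ζ⟯ ω).natDegree := by
  have hωK : IsIntegral ℚ⟮ζ⟯ ω := hω.tower_top
  have : FiniteDimensional ℚ ℚ⟮ζ⟯ := adjoin.finiteDimensional (hζ.isIntegral hm).tower_top
  have : FiniteDimensional ℚ⟮ζ⟯ ℚ⟮ζ⟯⟮ω⟯ := adjoin.finiteDimensional hωK
  have hfd : FiniteDimensional ℚ ℚ⟮ζ⟯⟮ω⟯ := FiniteDimensional.trans ℚ ℚ⟮ζ⟯ ℚ⟮ζ⟯⟮ω⟯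
  rw [← finrank_adjoin_primitiveRoot hm hζ, ← finrank_adjoin_primitiveRoot hn hη,
    ← adjoin.finrank hωK, Module.finrank_mul_finrank ℚ ℚ⟮ζ⟯ ℚ⟮ζ⟯⟮ω⟯]
  have hle : ℚ⟮η⟯ ≤ ℚ⟮ζ⟯⟮ω⟯.restrictScalars ℚ := by
    rw [adjoin_simple_le_iff]
    exact hmem
  have : FiniteDimensional ℚ (ℚ⟮ζ⟯⟮ω⟯.restrictScalars ℚ) := hfd
  exact finrank_le_of_le_right hle

theorem nthRootsFinset_subset_adjoin {m : ℕ} (hm : 0 < m) {ζ z : ℂ} (hζ : IsPrimitiveRoot ζ m)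
    (hz : z ∈ nthRootsFinset m (1 : ℂ)) : z ∈ ℚ⟮ζ⟯ := by
  have : NeZero m := ⟨hm.ne'⟩
  obtain ⟨i, -, rfl⟩ := hζ.eq_pow_of_pow_eq_one ((mem_nthRootsFinset hm _).1 hz)
  exact pow_mem (mem_adjoin_simple_self ℚ ζ) i

theorem eq_zero_of_sum_mul_pow_of_dvd {m p : ℕ} (hm : 0 < m) (hp : p.Prime) (hpm : p ∣ m)
    {ζ ω : ℂ} (hζ : IsPrimitiveRoot ζ m) (hω : IsPrimitiveRoot ω (p * m))
    {c : ℕ → ℂ} (hc : ∀ i, c i ∈ ℚ⟮ζ⟯) (h : ∑ i ∈ range p, c i * ω ^ i = 0) :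
    ∀ i < p, c i = 0 := by
  refine eq_zero_of_sum_mul_pow_eq_zero ?_ hc h
  have hpos : 0 < p * m := Nat.mul_pos hp.pos hm
  have := totient_le_mul_natDegree hm hpos hζ hω (hω.isIntegral hpos) (mem_adjoin_simple_self _ ω)
  rw [Nat.totient_mul_of_prime_of_dvd hp hpm, mul_comm] at this
  exact Nat.le_of_mul_le_mul_left this (Nat.totient_pos.2 hm)

theorem eq_of_sum_mul_pow_of_not_dvd {m p : ℕ} (hm : 0 < m) (hp : p.Prime) (hpm : ¬ p ∣ m)
    {ζ ω : ℂ} (hζ : IsPrimitiveRoot ζ m) (hω : IsPrimitiveRoot ω p)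
    {c : ℕ → ℂ} (hc : ∀ i, c i ∈ ℚ⟮ζ⟯) (h : ∑ i ∈ range p, c i * ω ^ i = 0) :
    ∀ i < p, c i = c (p - 1) := by
  have hpos : 0 < p * m := Nat.mul_pos hp.pos hm
  have hη : IsPrimitiveRoot (ω * ζ) (p * m) := by
    have := IsPrimitiveRoot.orderOf (ω * ζ)
    rwa [(Commute.all ω ζ).orderOf_mul_eq_mul_orderOf_of_coprime, ← hω.eq_orderOf,
      ← hζ.eq_orderOf] at this
    rw [← hω.eq_orderOf, ← hζ.eq_orderOf]
    exact (Nat.Prime.coprime_iff_not_dvd hp).2 hpm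
  have hdeg := totient_le_mul_natDegree hm hpos hζ hη (hω.isIntegral hp.pos)
    (mul_mem (mem_adjoin_simple_self _ ω)
      (_root_.algebraMap_mem ℚ⟮ζ⟯⟮ω⟯ (⟨ζ, mem_adjoin_simple_self ℚ ζ⟩ : ℚ⟮ζ⟯)))
  rw [Nat.totient_mul_of_prime_of_not_dvd hp hpm, mul_comm] at hdeg
  have hdeg := Nat.le_of_mul_le_mul_left hdeg (Nat.totient_pos.2 hm)
  have hsum : ∑ i ∈ range (p - 1), (c i - c (p - 1)) * ω ^ i = 0 := by
    have : ∑ i ∈ range p, (c i - c (p - 1)) * ω ^ i = 0 := by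
      simp_rw [sub_mul, Finset.sum_sub_distrib, ← Finset.mul_sum,
        hω.geom_sum_eq_zero hp.one_lt, h, mul_zero, sub_zero]
    rw [← Nat.sub_add_cancel hp.one_le, Finset.sum_range_succ] at this
    simpa using this
  have := eq_zero_of_sum_mul_pow_eq_zero hdeg (fun i => sub_mem (hc i) (hc (p - 1))) hsum
  intro i hi
  rcases Nat.lt_or_ge i (p - 1) with h1 | h1
  · exact sub_eq_zero.1 (this i h1)
  · rw [show i = p - 1 by omega]

/-- The value in `ℂ` of a formal combination of `m`-th roots of unity. -/
noncomputable def rootValue (m : ℕ) (x : ℂ → ℕ) : ℂ :=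
  ∑ z ∈ nthRootsFinset m (1 : ℂ), (x z : ℂ) * z

/-- The total number of terms of a formal combination of `m`-th roots of unity. -/
noncomputable def rootWeight (m : ℕ) (x : ℂ → ℕ) : ℕ :=
  ∑ z ∈ nthRootsFinset m (1 : ℂ), x z

theorem rootValue_add (m : ℕ) (x y : ℂ → ℕ) :
    rootValue m (x + y) = rootValue m x + rootValue m y := by
  simp [rootValue, add_mul, Finset.sum_add_distrib]

theorem rootWeight_add (m : ℕ) (x y : ℂ → ℕ) :
    rootWeight m (x + y) = rootWeight m x + rootWeight m y := by
  simp [rootWeight, Finset.sum_add_distrib]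

theorem eq_zero_of_rootWeight_eq_zero {m : ℕ} {x : ℂ → ℕ} (h : rootWeight m x = 0) :
    ∀ z ∈ nthRootsFinset m (1 : ℂ), x z = 0 :=
  Finset.sum_eq_zero_iff.1 h

theorem eq_of_rootValue_one_eq {x y : ℂ → ℕ} (h : rootValue 1 x = rootValue 1 y) :
    ∀ z ∈ nthRootsFinset 1 (1 : ℂ), x z = y z := by
  have h1 : nthRootsFinset 1 (1 : ℂ) = {1} := by
    ext z
    simp [mem_nthRootsFinset]
  simp only [rootValue, h1, Finset.sum_singleton, mul_one, Nat.cast_inj] at h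
  simpa [h1] using h

/-- Splitting `p * m`-th roots of unity into `p` translates of the `m`-th roots of unity. -/
theorem exists_translate_split {m p : ℕ} (hm : 0 < m) (hp : p.Prime) :
    ∃ ω : ℂ,
      (∀ x, rootWeight (p * m) x = ∑ i ∈ range p, rootWeight m fun z => x (ω ^ i * z)) ∧
      (∀ u ∈ nthRootsFinset (p * m) (1 : ℂ),
        ∃ i < p, ∃ z ∈ nthRootsFinset m (1 : ℂ), ω ^ i * z = u) ∧
      ∀ x y, rootValue (p * m) x = rootValue (p * m) y →
        (p ∣ m → ∀ i < p,
          (rootValue m fun z => x (ω ^ i * z)) = rootValue m fun z => y (ω ^ i * z)) ∧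
        (¬ p ∣ m → ∀ i < p, ∀ j < p,
          ((rootValue m fun z => x (ω ^ i * z)) + rootValue m fun z => y (ω ^ j * z)) =
            (rootValue m fun z => x (ω ^ j * z)) + rootValue m fun z => y (ω ^ i * z)) := by
  have hζ := Complex.isPrimitiveRoot_exp m hm.ne'
  set ζ := Complex.exp (2 * Real.pi * Complex.I / m)
  have hpos : 0 < p * m := Nat.mul_pos hp.pos hm
  have hK : ∀ x : ℂ → ℕ, rootValue m x ∈ ℚ⟮ζ⟯ := fun x =>
    sum_mem fun z hz => mul_mem (_root_.natCast_mem _ _) (nthRootsFinset_subset_adjoin hm hζ hz)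
  obtain ⟨ω, hω, hdvd, hndvd⟩ : ∃ ω : ℂ, IsPrimitiveRoot (ω ^ m) p ∧
      (p ∣ m → IsPrimitiveRoot ω (p * m)) ∧ (¬ p ∣ m → IsPrimitiveRoot ω p) := by
    by_cases hpm : p ∣ m
    · have hω := Complex.isPrimitiveRoot_exp (p * m) hpos.ne'
      exact ⟨_, hω.pow hpos (mul_comm p m), fun _ => hω, fun h => absurd hpm h⟩
    · have hω := Complex.isPrimitiveRoot_exp p hp.ne_zero
      exact ⟨_, hω.pow_of_coprime m ((Nat.Prime.coprime_iff_not_dvd hp).2 hpm).symm,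
        fun h => absurd h hpm, fun _ => hω⟩
  refine ⟨ω, fun x => sum_nthRootsFinset_mul hm hp.pos hω x, ?_, ?_⟩
  · intro u hu
    rw [nthRootsFinset_mul_eq_image hm hp.pos hω] at hu
    obtain ⟨⟨i, z⟩, hi, rfl⟩ := Finset.mem_image.1 hu
    rw [Finset.mem_product, Finset.mem_range] at hi
    exact ⟨i, hi.1, z, hi.2, rfl⟩
  · intro x y hxy
    have hsplit : ∀ x, rootValue (p * m) x =
        ∑ i ∈ range p, (rootValue m fun z => x (ω ^ i * z)) * ω ^ i := by
      intro x
      rw [rootValue, sum_nthRootsFinset_mul hm hp.pos hω]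
      refine Finset.sum_congr rfl fun i _ => ?_
      rw [rootValue, Finset.sum_mul]
      exact Finset.sum_congr rfl fun z _ => by ring
    have hsum : ∑ i ∈ range p, ((rootValue m fun z => x (ω ^ i * z)) -
        rootValue m fun z => y (ω ^ i * z)) * ω ^ i = 0 := by
      simp_rw [sub_mul, Finset.sum_sub_distrib, ← hsplit, hxy, sub_self]
    have hc := fun i : ℕ => sub_mem (hK fun z => x (ω ^ i * z)) (hK fun z => y (ω ^ i * z))
    refine ⟨fun hpm i hi => ?_, fun hpm i hi j hj => ?_⟩
    · exact sub_eq_zero.1 (eq_zero_of_sum_mul_pow_of_dvd hm hp hpm hζ (hdvd hpm) hc hsum i hi)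
    · have h := eq_of_sum_mul_pow_of_not_dvd hm hp hpm hζ (hndvd hpm) hc hsum
      linear_combination (h i hi).trans (h j hj).symm

theorem bound_of_slice_bound {a b p t j : ℕ} {X Y : ℕ → ℕ} (hab : a ≤ b) (hbp : b ≤ p)
    (hk : ∑ i ∈ range p, X i < a) (ht : ∀ i < p, X i = 0 → t ≤ Y i) (hj : j < p)
    (hY : (a - (X j + t)) * (b - 1) ≤ Y j) :
    (a - ∑ i ∈ range p, X i) * (b - 1) ≤ ∑ i ∈ range p, Y i := by
  have key : ∀ s ⊆ range p, #s * t ≤ ∑ i ∈ s, Y i + (∑ i ∈ s, X i) * t := by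
    intro s hs
    rw [Finset.sum_mul, ← Finset.sum_add_distrib, ← smul_eq_mul, ← Finset.sum_const]
    refine Finset.sum_le_sum fun i hi => ?_
    rcases Nat.eq_zero_or_pos (X i) with h | h
    · exact (ht i (Finset.mem_range.1 (hs hi)) h).trans (Nat.le_add_right _ _)
    · exact (Nat.le_mul_of_pos_left t h).trans (Nat.le_add_left _ _)
  have h1 := key _ subset_rfl
  have h2 := key _ (Finset.erase_subset j (range p))
  rw [Finset.card_erase_of_mem (Finset.mem_range.2 hj), Finset.card_range] at h2
  rw [Finset.card_range] at h1
  have hX := Finset.add_sum_erase (range p) X (Finset.mem_range.2 hj)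
  have hY' := Finset.add_sum_erase (range p) Y (Finset.mem_range.2 hj)
  rw [← hX] at hk h1 ⊢
  rw [← hY'] at h1 ⊢
  generalize ∑ i ∈ (range p).erase j, X i = A at *
  generalize ∑ i ∈ (range p).erase j, Y i = B at *
  generalize X j = e at *
  generalize Y j = f at *
  obtain ⟨a, rfl⟩ := Nat.exists_eq_add_of_le hk.le
  obtain ⟨p, rfl⟩ : ∃ p', p = p' + 1 := ⟨p - 1, by omega⟩
  obtain ⟨b, rfl⟩ : ∃ b', b = b' + 1 := ⟨b - 1, by omega⟩
  simp only [Nat.add_sub_cancel, Nat.add_sub_cancel_left] at *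
  rcases le_total t b with htb | htb
  · obtain ⟨s, rfl⟩ := Nat.exists_eq_add_of_le htb
    obtain ⟨u, rfl⟩ : ∃ u, p = t + s + u := Nat.exists_eq_add_of_le (by omega)
    rcases le_total (A + a) t with h | h
    · nlinarith [Nat.mul_le_mul_right (t + s) h]
    · obtain ⟨d, hd⟩ := Nat.exists_eq_add_of_le h
      rw [show e + A + a - (e + t) = d by omega] at hY
      nlinarith [congrArg (· * (t + s)) hd]
  · have h3 : (e + A + a) * t ≤ (p + 1) * t := Nat.mul_le_mul_right t (hab.trans hbp)
    nlinarith [Nat.mul_le_mul_left a htb]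

/-- A comparison of two formal combinations of roots of unity with the same value. -/
theorem le_or_bound_of_rootValue_eq {a b : ℕ} (hab : a ≤ b) (m : ℕ) (hm : 0 < m)
    (hl : ∀ l, l.Prime → l ∣ m → l = a ∨ b ≤ l) (x y : ℂ → ℕ)
    (h : rootValue m x = rootValue m y) :
    (∀ z ∈ nthRootsFinset m (1 : ℂ), x z ≤ y z) ∨
      (a - rootWeight m x) * (b - 1) ≤ rootWeight m y := by
  induction m using Nat.strong_induction_on generalizing x y with
  | _ n ih =>
  by_cases hn1 : n = 1
  · subst hn1
    exact Or.inl fun z hz => (eq_of_rootValue_one_eq h z hz).le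
  obtain ⟨p, hp, hpn, hap, hbp⟩ : ∃ p, p.Prime ∧ p ∣ n ∧ a ≤ p ∧
      (b ≤ p ∨ ∀ l, l.Prime → l ∣ n → l = p) := by
    by_cases hex : ∃ p, p.Prime ∧ p ∣ n ∧ b ≤ p
    · obtain ⟨p, hp, hpn, hbp⟩ := hex
      exact ⟨p, hp, hpn, hab.trans hbp, Or.inl hbp⟩
    · push Not at hex
      have hall : ∀ l, l.Prime → l ∣ n → l = a := fun l hl1 hl2 =>
        (hl l hl1 hl2).resolve_right (hex l hl1 hl2).not_ge
      have h0 := hall _ (Nat.minFac_prime hn1) (Nat.minFac_dvd n)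
      exact ⟨n.minFac, Nat.minFac_prime hn1, Nat.minFac_dvd n, h0.ge,
        Or.inr fun l hl1 hl2 => (hall l hl1 hl2).trans h0.symm⟩
  obtain ⟨m, rfl⟩ := hpn
  have hm0 : 0 < m := Nat.pos_of_mul_pos_left hm
  have hlt : m < p * m := lt_mul_of_one_lt_left hm0 hp.one_lt
  have hl' : ∀ l, l.Prime → l ∣ m → l = a ∨ b ≤ l := fun l h1 h2 => hl l h1 (h2.mul_left p)
  obtain ⟨ω, hw, hcov, hval⟩ := exists_translate_split hm0 hp
  obtain ⟨hdvd, hndvd⟩ := hval x y h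
  rw [hw x, hw y]
  rcases le_or_gt a (∑ i ∈ range p, rootWeight m fun z => x (ω ^ i * z)) with hk | hk
  · exact Or.inr (by simp [Nat.sub_eq_zero_of_le hk])
  by_cases hpm : p ∣ m
  · by_cases hall : ∀ i < p, ∀ z ∈ nthRootsFinset m (1 : ℂ), x (ω ^ i * z) ≤ y (ω ^ i * z)
    · refine Or.inl fun u hu => ?_
      obtain ⟨i, hi, z, hz, rfl⟩ := hcov u hu
      exact hall i hi z hz
    · push Not at hall
      obtain ⟨i, hi, z, hz, hlt'⟩ := hall
      refine Or.inr ?_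
      have hi' := (ih m hlt hm0 hl' _ _ (hdvd hpm i hi)).resolve_left
        fun H => (H z hz).not_gt hlt'
      refine le_trans (Nat.mul_le_mul_right _ (Nat.sub_le_sub_left ?_ a)) (hi'.trans ?_)
      · exact Finset.single_le_sum (f := fun i => rootWeight m fun z => x (ω ^ i * z))
          (fun _ _ => Nat.zero_le _) (Finset.mem_range.2 hi)
      · exact Finset.single_le_sum (f := fun i => rootWeight m fun z => y (ω ^ i * z))
          (fun _ _ => Nat.zero_le _) (Finset.mem_range.2 hi)
  · let Z := (range p).filter fun i => (rootWeight m fun z => x (ω ^ i * z)) = 0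
    have hZ : Z.Nonempty := by
      by_contra hne
      rw [Finset.not_nonempty_iff_eq_empty, Finset.filter_eq_empty_iff] at hne
      have := Finset.card_nsmul_le_sum (range p) (fun i => rootWeight m fun z => x (ω ^ i * z)) 1
        fun i hi => Nat.one_le_iff_ne_zero.2 (hne hi)
      simp at this
      omega
    obtain ⟨i₀, hi₀, hmin⟩ := Finset.exists_min_image Z
      (fun i => rootWeight m fun z => y (ω ^ i * z)) hZ
    rw [Finset.mem_filter, Finset.mem_range] at hi₀
    have hx0 := eq_zero_of_rootWeight_eq_zero hi₀.2
    have hvx0 : (rootValue m fun z => x (ω ^ i₀ * z)) = 0 :=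
      Finset.sum_eq_zero fun z hz => by simp [hx0 z hz]
    have heq : ∀ j < p, rootValue m ((fun z => x (ω ^ j * z)) + fun z => y (ω ^ i₀ * z)) =
        rootValue m fun z => y (ω ^ j * z) := by
      intro j hj
      rw [rootValue_add, hndvd hpm j hj i₀ hi₀.1, hvx0, zero_add]
    by_cases hall : ∀ j < p, ∀ z ∈ nthRootsFinset m (1 : ℂ),
        x (ω ^ j * z) + y (ω ^ i₀ * z) ≤ y (ω ^ j * z)
    · refine Or.inl fun u hu => ?_
      obtain ⟨i, hi, z, hz, rfl⟩ := hcov u hu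
      exact (Nat.le_add_right _ _).trans (hall i hi z hz)
    · push Not at hall
      obtain ⟨j, hj, z, hz, hlt'⟩ := hall
      have hbp' : b ≤ p := by
        refine hbp.resolve_right fun hp' => ?_
        have hm1 : m = 1 := by
          by_contra hne
          have := hp' _ (Nat.minFac_prime hne) ((Nat.minFac_dvd m).mul_left p)
          exact hpm (this ▸ Nat.minFac_dvd m)
        subst hm1
        exact hlt'.ne' (eq_of_rootValue_one_eq (heq j hj) z hz)
      have hbound := (ih m hlt hm0 hl' _ _ (heq j hj)).resolve_left
        fun H => (H z hz).not_gt hlt'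
      rw [rootWeight_add] at hbound
      refine Or.inr (bound_of_slice_bound hab hbp' hk (fun i hi hi' => ?_) hj hbound)
      exact hmin i (Finset.mem_filter.2 ⟨Finset.mem_range.2 hi, hi'⟩)

theorem mem_closure_of_pred_mul_pred_le {S : Set ℕ} {a b n : ℕ} (ha : a ∈ S) (hb : b ∈ S)
    (hab : a.Coprime b) (h : (a - 1) * (b - 1) ≤ n) : n ∈ AddSubmonoid.closure S := by
  obtain ⟨u, v, rfl⟩ := Nat.exists_add_mul_eq_of_gcd_dvd_of_mul_pred_le a b n
    (by simp [hab.gcd_eq_one]) h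
  exact add_mem (nsmul_mem (AddSubmonoid.subset_closure ha) u)
    (nsmul_mem (AddSubmonoid.subset_closure hb) v)

/-- The **Lam–Leung theorem**: the weight of a vanishing sum of `q`-th roots of unity is a
nonnegative combination of the prime divisors of `q`. -/
theorem rootWeight_mem_closure_of_rootValue_eq_zero (q : ℕ) (hq : 0 < q) (x : ℂ → ℕ)
    (h : rootValue q x = 0) :
    rootWeight q x ∈ AddSubmonoid.closure {l : ℕ | l.Prime ∧ l ∣ q} := by
  induction q using Nat.strong_induction_on generalizing x with
  | _ q ih =>
  have hzero : ∀ m, rootValue m (fun _ => 0) = 0 := fun m => by simp [rootValue]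
  by_cases hq1 : q = 1
  · subst hq1
    have : rootWeight 1 x = 0 :=
      Finset.sum_eq_zero (eq_of_rootValue_one_eq (h.trans (hzero 1).symm))
    rw [this]
    exact zero_mem _
  obtain ⟨p, hp, hpq, hpa⟩ : ∃ p, p.Prime ∧ p ∣ q ∧
      (p ≠ q.minFac ∨ ∀ l, l.Prime → l ∣ q → l = p) := by
    by_cases hex : ∃ p, p.Prime ∧ p ∣ q ∧ p ≠ q.minFac
    · obtain ⟨p, h1, h2, h3⟩ := hex
      exact ⟨p, h1, h2, Or.inl h3⟩
    · push Not at hex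
      exact ⟨q.minFac, Nat.minFac_prime hq1, Nat.minFac_dvd q, Or.inr hex⟩
  set a := q.minFac with ha
  have hap : a.Prime := Nat.minFac_prime hq1
  have haq : a ∣ q := Nat.minFac_dvd q
  have hale : ∀ l, l.Prime → l ∣ q → a ≤ l := fun l h1 h2 => Nat.minFac_le_of_dvd h1.two_le h2
  clear_value a
  obtain ⟨m, rfl⟩ := hpq
  have hm0 : 0 < m := Nat.pos_of_mul_pos_left hq
  have hlt : m < p * m := lt_mul_of_one_lt_left hm0 hp.one_lt
  obtain ⟨ω, hw, -, hval⟩ := exists_translate_split hm0 hp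
  obtain ⟨hdvd, hndvd⟩ := hval x (fun _ => 0) (h.trans (hzero _).symm)
  have hmono : AddSubmonoid.closure {l : ℕ | l.Prime ∧ l ∣ m} ≤
      AddSubmonoid.closure {l : ℕ | l.Prime ∧ l ∣ p * m} :=
    AddSubmonoid.closure_mono fun l hl => ⟨hl.1, hl.2.mul_left p⟩
  rw [hw x]
  by_cases hpm : p ∣ m
  · exact sum_mem fun i hi => hmono (ih m hlt hm0 _
      ((hdvd hpm i (Finset.mem_range.1 hi)).trans (hzero m)))
  simp only [hzero, add_zero] at hndvd
  obtain ⟨i₀, hi₀, hmin⟩ := Finset.exists_min_image (range p)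
    (fun i => rootWeight m fun z => x (ω ^ i * z)) ⟨0, Finset.mem_range.2 hp.pos⟩
  have heq := fun j hj => hndvd hpm i₀ (Finset.mem_range.1 hi₀) j hj
  by_cases hall : ∀ j < p, ∀ z ∈ nthRootsFinset m (1 : ℂ), x (ω ^ i₀ * z) ≤ x (ω ^ j * z)
  · have hdec : ∀ j < p, ∃ y : ℂ → ℕ, rootValue m y = 0 ∧
        (rootWeight m fun z => x (ω ^ j * z)) =
          (rootWeight m fun z => x (ω ^ i₀ * z)) + rootWeight m y := by
      intro j hj
      have hadd : ∀ z ∈ nthRootsFinset m (1 : ℂ),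
          x (ω ^ j * z) = x (ω ^ i₀ * z) + (x (ω ^ j * z) - x (ω ^ i₀ * z)) :=
        fun z hz => (Nat.add_sub_cancel' (hall j hj z hz)).symm
      refine ⟨fun z => x (ω ^ j * z) - x (ω ^ i₀ * z), ?_, ?_⟩
      · have h1 : (rootValue m fun z => x (ω ^ j * z)) =
            rootValue m ((fun z => x (ω ^ i₀ * z)) +
              fun z => x (ω ^ j * z) - x (ω ^ i₀ * z)) :=
          Finset.sum_congr rfl fun z hz => by rw [Pi.add_apply, ← hadd z hz]
        rw [rootValue_add, ← heq j hj] at h1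
        simpa using h1
      · rw [← rootWeight_add]
        exact Finset.sum_congr rfl fun z hz => by rw [Pi.add_apply, ← hadd z hz]
    choose! y hy0 hyw using hdec
    rw [Finset.sum_congr rfl fun j hj => hyw j (Finset.mem_range.1 hj), Finset.sum_add_distrib,
      Finset.sum_const, Finset.card_range, smul_eq_mul, mul_comm p (rootWeight m _)]
    have hpS : p ∈ {l : ℕ | l.Prime ∧ l ∣ p * m} := ⟨hp, dvd_mul_right p m⟩
    exact add_mem (nsmul_mem (AddSubmonoid.subset_closure hpS) _)
      (sum_mem fun j hj => hmono (ih m hlt hm0 _ (hy0 j (Finset.mem_range.1 hj))))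
  push Not at hall
  obtain ⟨j, hj, z, hz, hlt'⟩ := hall
  have hpa' : p ≠ a := by
    refine hpa.resolve_right fun hp' => ?_
    have hm1 : m = 1 := by
      by_contra hne
      have := hp' _ (Nat.minFac_prime hne) ((Nat.minFac_dvd m).mul_left p)
      exact hpm (this ▸ Nat.minFac_dvd m)
    subst hm1
    exact hlt'.ne' (eq_of_rootValue_one_eq (heq j hj) z hz)
  obtain ⟨b, hb, hbmin⟩ := Finset.exists_min_image ((p * m).primeFactors.erase a) id
    ⟨p, Finset.mem_erase.2 ⟨hpa', Nat.mem_primeFactors.2 ⟨hp, dvd_mul_right p m, hq.ne'⟩⟩⟩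
  rw [Finset.mem_erase, Nat.mem_primeFactors] at hb
  have hble : ∀ l, l.Prime → l ∣ p * m → l = a ∨ b ≤ l := fun l h1 h2 =>
    or_iff_not_imp_left.2 fun h3 =>
      hbmin l (Finset.mem_erase.2 ⟨h3, Nat.mem_primeFactors.2 ⟨h1, h2, hq.ne'⟩⟩)
  have hbp : b ≤ p := (hble p hp (dvd_mul_right p m)).resolve_left hpa'
  have hbound := (le_or_bound_of_rootValue_eq (hale b hb.2.1 hb.2.2.1) m hm0
    (fun l h1 h2 => hble l h1 (h2.mul_left p)) _ _ (heq j hj)).resolve_left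
      fun H => (H z hz).not_gt hlt'
  refine mem_closure_of_pred_mul_pred_le (a := a) (b := b) ⟨hap, haq⟩ ⟨hb.2.1, hb.2.2.1⟩
    ((Nat.coprime_primes hap hb.2.1).2 hb.1.symm) ?_
  have hrest := Finset.card_nsmul_le_sum ((range p).erase j)
    (fun i => rootWeight m fun z => x (ω ^ i * z)) _ fun i hi => hmin i (Finset.mem_of_mem_erase hi)
  rw [Finset.card_erase_of_mem (Finset.mem_range.2 hj), Finset.card_range, smul_eq_mul] at hrest
  rw [← Finset.add_sum_erase _ _ (Finset.mem_range.2 hj)]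
  refine le_trans ?_ (Nat.add_le_add hbound
    (le_trans (Nat.mul_le_mul_right _ (Nat.sub_le_sub_right hbp 1)) hrest))
  rw [mul_comm (b - 1), ← add_mul]
  exact Nat.mul_le_mul_right _ (by omega)

theorem exists_rootSumEval_eq_zero_of_dvd {p q : ℕ} (hp : p.Prime) (hq : 0 < q) (hpq : p ∣ q) :
    ∃ x : Fin p → ZMod q, rootSumEval p q x = 0 := by
  obtain ⟨m, rfl⟩ := hpq
  have hm : 0 < m := Nat.pos_of_mul_pos_left hq
  refine ⟨fun i => ((i * m : ℕ) : ZMod (p * m)), ?_⟩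
  have hω := Complex.isPrimitiveRoot_exp p hp.ne_zero
  rw [← hω.geom_sum_eq_zero hp.one_lt, Finset.sum_range, rootSumEval]
  refine Finset.sum_congr rfl fun i _ => ?_
  rw [ZMod.val_natCast_of_lt (Nat.mul_lt_mul_of_pos_right i.2 hm), ← Complex.exp_nat_mul]
  congr 1
  have : (m : ℂ) ≠ 0 := Nat.cast_ne_zero.2 hm.ne'
  have : (p : ℂ) ≠ 0 := Nat.cast_ne_zero.2 hp.ne_zero
  push_cast
  field_simp

/-- The lengths of vanishing sums of `q`-th roots of unity. -/
def vanishingLengths (q : ℕ) : AddSubmonoid ℕ where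
  carrier := {n | ∃ x : Fin n → ZMod q, rootSumEval n q x = 0}
  zero_mem' := ⟨Fin.elim0, by simp [rootSumEval]⟩
  add_mem' := by
    rintro m n ⟨x, hx⟩ ⟨y, hy⟩
    refine ⟨Fin.append x y, ?_⟩
    rw [rootSumEval] at hx hy ⊢
    simp [Fin.sum_univ_add, hx, hy]

theorem exists_rootValue_eq_rootSumEval {n q : ℕ} (hq : 0 < q) (x : Fin n → ZMod q) :
    ∃ f : ℂ → ℕ, rootWeight q f = n ∧ rootValue q f = rootSumEval n q x := by
  classical
  let e : Fin n → ℂ := fun i => Complex.exp (2 * Real.pi * Complex.I * ((x i).val : ℂ) / q)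
  have he : ∀ i ∈ (Finset.univ : Finset (Fin n)), e i ∈ nthRootsFinset q (1 : ℂ) := by
    intro i _
    rw [mem_nthRootsFinset hq, ← Complex.exp_nat_mul, Complex.exp_eq_one_iff]
    refine ⟨(x i).val, ?_⟩
    have : (q : ℂ) ≠ 0 := Nat.cast_ne_zero.2 hq.ne'
    push_cast
    field_simp
  refine ⟨fun z => #{i | e i = z}, ?_, ?_⟩
  · rw [rootWeight, ← Finset.card_eq_sum_card_fiberwise he, Finset.card_univ, Fintype.card_fin]
  · rw [rootSumEval, ← Finset.sum_fiberwise_of_maps_to he]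
    refine Finset.sum_congr rfl fun z _ => ?_
    rw [← nsmul_eq_mul, ← Finset.sum_const]
    exact Finset.sum_congr rfl fun i hi => (Finset.mem_filter.1 hi).2.symm

theorem vanishing_sum_exists_iff
    (q n r : ℕ) (p a : Fin r → ℕ)
    (hp : ∀ i, (p i).Prime)
    (hdist : ∀ i j, i ≠ j → p i ≠ p j)
    (ha : ∀ i, 0 < a i)
    (hq : q = ∏ i, p i ^ a i)
    (hn : 0 < n) :
    (∃ x : Fin n → ZMod q, rootSumEval n q x = 0) ↔
      (∃ w : Fin r → ℕ, n = ∑ i, w i * p i) := by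
  have hq0 : 0 < q := hq ▸ Finset.prod_pos fun i _ => pow_pos (hp i).pos _
  constructor
  · rintro ⟨x, hx⟩
    obtain ⟨f, hf, hfx⟩ := exists_rootValue_eq_rootSumEval hq0 x
    have hmem := rootWeight_mem_closure_of_rootValue_eq_zero q hq0 f (hfx.trans hx)
    rw [hf] at hmem
    have hsub : {l : ℕ | l.Prime ∧ l ∣ q} ⊆ Set.range p := by
      rintro l ⟨hl, hlq⟩
      rw [hq, hl.prime.dvd_finsetProd_iff] at hlq
      obtain ⟨i, -, hi⟩ := hlq
      exact ⟨i, ((Nat.prime_dvd_prime_iff_eq hl (hp i)).1 (hl.dvd_of_dvd_pow hi)).symm⟩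
    obtain ⟨w, hw⟩ := AddSubmonoid.mem_closure_range_iff_of_fintype.1
      (AddSubmonoid.closure_mono hsub hmem)
    exact ⟨w, by simpa using hw⟩
  · rintro ⟨w, rfl⟩
    change _ ∈ vanishingLengths q
    refine sum_mem fun i _ => nsmul_mem (S := vanishingLengths q) ?_ (w i)
    refine exists_rootSumEval_eq_zero_of_dvd (hp i) hq0 ?_
    rw [hq]
    exact (dvd_pow_self _ (ha i).ne').trans (Finset.dvd_prod_of_mem _ (Finset.mem_univ i))
end

section
/- Let q = p^a be a prime power and n a positive integer. For a vector x ∈ (ℤ/qℤ)^n, one has ∑_{i=1}^n exp(2πi·x_i/q) = 0 if and only if p divides n and the multiset of coordinates of x can be written as a disjoint union (multiset sum) of n/p multisets, each of the form {r, r + q/p, r + 2q/p, …, r + (p−1)q/p} for some r ∈ ℤ/qℤ. -/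
open Complex Finset

/-- The coset `{r, r + q/p, r + 2q/p, …, r + (p-1)q/p}` in `ℤ/qℤ`, as a multiset. -/
def rotatedCoset (q p : ℕ) (r : ZMod q) : Multiset (ZMod q) :=
  (Multiset.range p).map (fun k => r + ((k * (q / p) : ℕ) : ZMod q))

open Polynomial in
lemma minpoly_stdAddChar_one (q : ℕ) [NeZero q] :
    minpoly ℚ (ZMod.stdAddChar (1 : ZMod q)) = cyclotomic q ℚ := by
  have hζ : IsPrimitiveRoot (ZMod.stdAddChar (1 : ZMod q)) q := by
    have h := ZMod.stdAddChar_coe (N := q) 1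
    have h' := Complex.isPrimitiveRoot_exp q (NeZero.ne q)
    simp only [Int.cast_one, mul_one] at h
    rwa [h]
  exact (cyclotomic_eq_minpoly_rat hζ (NeZero.pos q)).symm

lemma stdAddChar_one_pow (q : ℕ) [NeZero q] (k : ℕ) :
    (ZMod.stdAddChar (1 : ZMod q)) ^ k = ZMod.stdAddChar (k : ZMod q) := by
  rw [← AddChar.map_nsmul_eq_pow, nsmul_one]

lemma rootSumEval_eq_sum_stdAddChar (n q : ℕ) [NeZero q] (x : Fin n → ZMod q) :
    rootSumEval n q x = ((Multiset.map x Finset.univ.val).map ZMod.stdAddChar).sum := by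
  rw [Multiset.map_map]
  refine Finset.sum_congr rfl fun i _ => ?_
  simp [ZMod.stdAddChar_apply, ZMod.toCircle_apply]

lemma coeff_sum_map_single {q : ℕ} (M : Multiset (ZMod q)) (r : ZMod q) :
    (M.map fun y => (AddMonoidAlgebra.single y (1 : ℚ))).sum.coeff r = M.count r := by
  induction M using Multiset.induction with
  | empty => simp
  | cons y M ih =>
    rw [Multiset.map_cons, Multiset.sum_cons, AddMonoidAlgebra.coeff_add, Finsupp.add_apply, ih,
      Multiset.count_cons, AddMonoidAlgebra.coeff_single, Finsupp.single_apply]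
    simp only [eq_comm (a := y)]
    push_cast
    ring

open Polynomial in
/-- If the `q`-th roots of unity indexed by `M` sum to zero, where `q` is a power of a prime `p`,
then `M` is invariant under translation by `q / p`. -/
lemma count_add_of_sum_stdAddChar_eq_zero {p k q : ℕ} (hp : p.Prime) [NeZero q]
    (hq : q = p ^ (k + 1)) (M : Multiset (ZMod q)) (hM : (M.map ZMod.stdAddChar).sum = 0)
    (r : ZMod q) : M.count (((p ^ k : ℕ) : ZMod q) + r) = M.count r := by
  have : Fact p.Prime := ⟨hp⟩
  let P : ℚ[X] := (M.map fun y => X ^ y.val).sum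
  have hP : aeval (ZMod.stdAddChar (1 : ZMod q)) P = 0 := by
    rw [← hM, map_multiset_sum, Multiset.map_map]
    simp [stdAddChar_one_pow]
  have hdvd : (X ^ q - 1 : ℚ[X]) ∣ P * (X ^ p ^ k - 1) := by
    rw [hq, ← cyclotomic_prime_pow_mul_X_pow_sub_one ℚ p k]
    refine mul_dvd_mul_right ?_ _
    rw [← hq, ← minpoly_stdAddChar_one q]
    exact minpoly.dvd _ _ hP
  let g : AddMonoidAlgebra ℚ (ZMod q) := AddMonoidAlgebra.single 1 1
  have hg (j : ℕ) : g ^ j = AddMonoidAlgebra.single (j : ZMod q) 1 := by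
    simp [g, AddMonoidAlgebra.single_pow]
  have hgP : aeval g P = (M.map fun y => (AddMonoidAlgebra.single y (1 : ℚ))).sum := by
    rw [map_multiset_sum, Multiset.map_map]
    simp [hg]
  have hmul : aeval g P * (g ^ p ^ k - 1) = 0 := by
    obtain ⟨Q, hQ⟩ := hdvd
    have := congrArg (aeval g) hQ
    have h1 : g ^ q - 1 = 0 := by
      rw [hg, ZMod.natCast_self, sub_eq_zero, AddMonoidAlgebra.one_def]
    simpa [h1] using this
  have hinv : g ^ p ^ k * aeval g P = aeval g P := by
    rw [mul_sub, mul_one, sub_eq_zero] at hmul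
    rw [mul_comm, hmul]
  have hcoeff := congrArg (fun F => F.coeff (((p ^ k : ℕ) : ZMod q) + r)) hinv
  simp only [hg, hgP, coeff_sum_map_single, AddMonoidAlgebra.coeff_single_mul_apply,
    neg_add_cancel_left, one_mul] at hcoeff
  exact_mod_cast hcoeff.symm

lemma prime_pow_succ_div {p k : ℕ} (hp : p.Prime) : p ^ (k + 1) / p = p ^ k := by
  rw [pow_succ, Nat.mul_div_cancel _ hp.pos]

lemma card_rotatedCoset (q p : ℕ) (r : ZMod q) :
    Multiset.card (rotatedCoset q p r) = p := by
  simp [rotatedCoset]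

lemma nodup_rotatedCoset {p k : ℕ} (hp : p.Prime) (r : ZMod (p ^ (k + 1))) :
    (rotatedCoset (p ^ (k + 1)) p r).Nodup := by
  refine (Multiset.nodup_map_iff_inj_on (Multiset.nodup_range p)).2 fun i hi j hj hij => ?_
  rw [Multiset.mem_range] at hi hj
  rw [prime_pow_succ_div hp] at hij
  have hpos := pow_pos hp.pos k
  have hlt {l : ℕ} (hl : l < p) : l * p ^ k < p ^ (k + 1) := by
    rw [pow_succ']
    exact Nat.mul_lt_mul_of_pos_right hl hpos
  have h := (ZMod.natCast_eq_natCast_iff' _ _ _).1 (add_left_cancel hij)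
  rw [Nat.mod_eq_of_lt (hlt hi), Nat.mod_eq_of_lt (hlt hj)] at h
  exact Nat.eq_of_mul_eq_mul_right hpos h

lemma map_add_rotatedCoset {p k : ℕ} (hp : p.Prime) (r : ZMod (p ^ (k + 1))) :
    (rotatedCoset (p ^ (k + 1)) p r).map (((p ^ k : ℕ) : ZMod (p ^ (k + 1))) + ·) =
      rotatedCoset (p ^ (k + 1)) p r := by
  obtain ⟨t, rfl⟩ : ∃ t, p = t + 1 := ⟨p - 1, (Nat.succ_pred_prime hp).symm⟩
  have hzero : (((t + 1) * (t + 1) ^ k : ℕ) : ZMod ((t + 1) ^ (k + 1))) = 0 := by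
    rw [← pow_succ', ZMod.natCast_self]
  rw [rotatedCoset, prime_pow_succ_div hp, Multiset.map_map]
  conv_lhs => rw [Multiset.range_succ]
  have hrange : Multiset.range (t + 1) = 0 ::ₘ (Multiset.range t).map (1 + ·) := by
    rw [add_comm, Multiset.range_add]
    simp [Multiset.range_succ]
  rw [hrange, Multiset.map_cons, Multiset.map_cons, Multiset.map_map]
  congr 1
  · simp only [Function.comp_apply, zero_mul, Nat.cast_zero, add_zero]
    rw [add_mul, one_mul, Nat.cast_add] at hzero
    linear_combination hzero
  · refine Multiset.map_congr rfl fun i _ => ?_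
    simp only [Function.comp_apply]
    push_cast
    ring

lemma count_add_rotatedCoset {p k : ℕ} (hp : p.Prime) (s r : ZMod (p ^ (k + 1))) :
    (rotatedCoset (p ^ (k + 1)) p s).count (((p ^ k : ℕ) : ZMod (p ^ (k + 1))) + r) =
      (rotatedCoset (p ^ (k + 1)) p s).count r := by
  conv_lhs => rw [← map_add_rotatedCoset hp s]
  exact Multiset.count_map_eq_count' _ _ (add_right_injective _) r

/-- A multiset invariant under translation by `q / p` is a sum of cosets of the subgroup of
order `p`. -/
lemma exists_eq_bind_rotatedCoset {p k : ℕ} (hp : p.Prime) (M : Multiset (ZMod (p ^ (k + 1))))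
    (hM : ∀ r, M.count (((p ^ k : ℕ) : ZMod (p ^ (k + 1))) + r) = M.count r) :
    ∃ rs : Multiset (ZMod (p ^ (k + 1))), M = rs.bind (rotatedCoset (p ^ (k + 1)) p) := by
  induction hc : Multiset.card M using Nat.strong_induction_on generalizing M with
  | _ c ih =>
    obtain rfl | ⟨r, hr⟩ := M.empty_or_exists_mem
    · exact ⟨0, by simp⟩
    have hle : rotatedCoset (p ^ (k + 1)) p r ≤ M := by
      refine (Multiset.le_iff_subset (nodup_rotatedCoset hp r)).2 fun y hy => ?_
      obtain ⟨j, -, rfl⟩ := Multiset.mem_map.1 hy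
      rw [prime_pow_succ_div hp]
      clear hy
      induction j with
      | zero => simpa using hr
      | succ j ihj =>
        rw [← Multiset.count_pos, ← hM, Multiset.count_pos] at ihj
        convert ihj using 1
        push_cast
        ring
    obtain ⟨N, rfl⟩ := Multiset.le_iff_exists_add.1 hle
    obtain ⟨rs, hrs⟩ := ih (Multiset.card N)
      (by rw [← hc, Multiset.card_add, card_rotatedCoset]; have := hp.pos; omega) N
      (fun s => by
        have h := hM s
        rw [Multiset.count_add, Multiset.count_add, count_add_rotatedCoset hp] at h
        exact add_left_cancel h) rfl
    exact ⟨r ::ₘ rs, by rw [Multiset.cons_bind, ← hrs]⟩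

open Polynomial in
lemma sum_stdAddChar_rotatedCoset {p k : ℕ} (hp : p.Prime) [NeZero (p ^ (k + 1))]
    (r : ZMod (p ^ (k + 1))) :
    ((rotatedCoset (p ^ (k + 1)) p r).map ZMod.stdAddChar).sum = 0 := by
  have h := minpoly.aeval ℚ (ZMod.stdAddChar (1 : ZMod (p ^ (k + 1))))
  rw [minpoly_stdAddChar_one, cyclotomic_prime_pow_eq_geom_sum hp] at h
  simp only [map_sum, map_pow, aeval_X, ← pow_mul, stdAddChar_one_pow] at h
  rw [rotatedCoset, prime_pow_succ_div hp, Multiset.map_map]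
  simp only [Function.comp_def, AddChar.map_add_eq_mul, Multiset.sum_map_mul_left]
  refine mul_eq_zero_of_right _ ?_
  rw [← h]
  simp only [mul_comm (p ^ k)]
  rfl

theorem vanishing_sum_prime_power
    (p a q n : ℕ) (hp : p.Prime) (ha : 0 < a) (hq : q = p ^ a) (hn : 0 < n)
    (x : Fin n → ZMod q) :
    rootSumEval n q x = 0 ↔
      (p ∣ n ∧ ∃ rs : Multiset (ZMod q), Multiset.card rs = n / p ∧
        Multiset.map x Finset.univ.val = rs.bind (rotatedCoset q p)) := by
  obtain ⟨k, rfl⟩ : ∃ k, a = k + 1 := ⟨a - 1, by omega⟩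
  subst hq
  have : NeZero (p ^ (k + 1)) := ⟨(pow_pos hp.pos _).ne'⟩
  rw [rootSumEval_eq_sum_stdAddChar]
  constructor
  · intro h
    obtain ⟨rs, hrs⟩ := exists_eq_bind_rotatedCoset hp _
      (count_add_of_sum_stdAddChar_eq_zero hp rfl _ h)
    have hcard : n = Multiset.card rs * p := by
      simpa [Multiset.card_bind, Function.comp_def, card_rotatedCoset] using
        congrArg Multiset.card hrs
    exact ⟨⟨_, hcard.trans (mul_comm _ _)⟩, rs,
      (Nat.div_eq_of_eq_mul_left hp.pos hcard).symm, hrs⟩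
  · rintro ⟨-, rs, -, hrs⟩
    rw [hrs, Multiset.map_bind, Multiset.sum_bind]
    simp [sum_stdAddChar_rotatedCoset hp]
end

section
/- Let q = p^a be a prime power and let n be a positive integer divisible by p. Then the number of multisets M over ℤ/qℤ of cardinality n such that 0 ∈ M and ∑_{m ∈ M} exp(2πi·m/q) = 0 is exactly the binomial coefficient C((n+q)/p − 2, n/p − 1). -/
open Complex Finset

/-- The evaluation of a multiset `M` over `ℤ/qℤ` as a sum (with multiplicity) of
complex `q`-th roots of unity. -/
noncomputable def multisetRootSum (q : ℕ) (M : Multiset (ZMod q)) : ℂ :=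
  (M.map (fun m => Complex.exp (2 * Real.pi * Complex.I * ((m : ZMod q).val : ℂ) / q))).sum

/-- The residue `r + Q * i` modulo `q`, from its quotient `i` and remainder `r`. -/
def residueOfDivMod (p Q q : ℕ) (x : Fin p × Fin Q) : ZMod q :=
  ((x.2.val + Q * x.1.val : ℕ) : ZMod q)

/-- The multiset over `ZMod q` consisting of all lifts of the elements of a multiset
of residues modulo `Q`. -/
def multisetLift (p Q q : ℕ) (N : Multiset (Fin Q)) : Multiset (ZMod q) :=
  ((Finset.univ : Finset (Fin p)).val ×ˢ N).map (residueOfDivMod p Q q)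

theorem residueOfDivMod_val {p Q q : ℕ} (h : q = p * Q) (x : Fin p × Fin Q) :
    (residueOfDivMod p Q q x).val = x.2.val + Q * x.1.val := by
  have := (finProdFinEquiv x).isLt
  rw [finProdFinEquiv_apply_val, ← h] at this
  exact ZMod.val_natCast_of_lt this

theorem residueOfDivMod_bijective {p Q q : ℕ} (h : q = p * Q) (hq : q ≠ 0) :
    Function.Bijective (residueOfDivMod p Q q) := by
  have : NeZero q := ⟨hq⟩
  rw [Fintype.bijective_iff_injective_and_card]
  refine ⟨fun x y hxy => finProdFinEquiv.injective (Fin.ext ?_), by simp [ZMod.card, h]⟩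
  have := congrArg ZMod.val hxy
  simpa [residueOfDivMod_val h] using this

theorem count_multisetLift {p Q q : ℕ} (h : q = p * Q) (hq : q ≠ 0) (N : Multiset (Fin Q))
    (x : Fin p × Fin Q) :
    (multisetLift p Q q N).count (residueOfDivMod p Q q x) = N.count x.2 := by
  rw [multisetLift, Multiset.count_map_eq_count' _ _ (residueOfDivMod_bijective h hq).injective]
  obtain ⟨i, r⟩ := x
  induction N using Multiset.induction_on with
  | empty => simp
  | cons s N ih =>
    rw [Multiset.product_cons, Multiset.count_add, ih, Multiset.count_cons, add_comm]
    congr 1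
    split_ifs with hrs
    · subst hrs
      rw [Multiset.count_map_eq_count' (fun j => (j, r)) _ (Prod.mk_left_injective r),
        Multiset.count_univ]
    · rw [Multiset.count_eq_zero]
      simp [Ne.symm hrs]

theorem card_multisetLift (p Q q : ℕ) (N : Multiset (Fin Q)) :
    (multisetLift p Q q N).card = p * N.card := by
  simp [multisetLift]

theorem multisetRootSum_eq_sum {p Q q : ℕ} (h : q = p * Q) (hq : q ≠ 0)
    (M : Multiset (ZMod q)) :
    multisetRootSum q M = ∑ x : Fin p × Fin Q, (M.count (residueOfDivMod p Q q x) : ℂ) *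
      Complex.exp (2 * Real.pi * Complex.I / q) ^ (x.2.val + Q * x.1.val) := by
  have : NeZero q := ⟨hq⟩
  rw [multisetRootSum, Finset.sum_multiset_map_count]
  rw [Finset.sum_subset (Finset.subset_univ _)
    (fun x _ hx => by rw [Multiset.mem_toFinset] at hx; simp [Multiset.count_eq_zero_of_notMem hx])]
  rw [← (residueOfDivMod_bijective h hq).sum_comp]
  refine Finset.sum_congr rfl fun x _ => ?_
  rw [residueOfDivMod_val h, nsmul_eq_mul, ← Complex.exp_nat_mul]
  congr 2
  ring

theorem multisetRootSum_multisetLift {p Q q : ℕ} (h : q = p * Q) (hq : q ≠ 0) (hp : 1 < p)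
    (N : Multiset (Fin Q)) : multisetRootSum q (multisetLift p Q q N) = 0 := by
  have hζ := (Complex.isPrimitiveRoot_exp q hq).pow (Nat.pos_of_ne_zero hq)
    (h.trans (mul_comm _ _))
  rw [multisetRootSum_eq_sum h hq, Fintype.sum_prod_type_right]
  refine Finset.sum_eq_zero fun r _ => ?_
  simp_rw [count_multisetLift h hq, pow_add, pow_mul, ← mul_assoc]
  rw [← Finset.mul_sum, Fin.sum_univ_eq_sum_range (fun i => _ ^ i),
    hζ.geom_sum_eq_zero hp, mul_zero]

theorem coeff_geom_sum_mul {Q : ℕ} (G : Polynomial ℤ) (hG : G.natDegree < Q) {p : ℕ}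
    (i : Fin p) (r : Fin Q) :
    ((∑ j ∈ Finset.range p, (Polynomial.X ^ Q) ^ j) * G).coeff (r.val + Q * i.val) =
      G.coeff r := by
  simp_rw [Finset.sum_mul, Polynomial.finsetSum_coeff, ← pow_mul, Polynomial.coeff_X_pow_mul']
  rw [Finset.sum_eq_single i.val]
  · simp
  · intro j _ hj
    split_ifs with hle
    · have hji : j < i.val := by
        by_contra hcon
        have h1 : i.val + 1 ≤ j := by omega
        have h2 := Nat.mul_le_mul_left Q h1
        rw [mul_add, mul_one] at h2
        have := r.isLt
        omega
      have h2 := Nat.mul_le_mul_left Q (Nat.succ_le_of_lt hji)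
      rw [Nat.succ_eq_add_one, mul_add, mul_one] at h2
      exact Polynomial.coeff_eq_zero_of_natDegree_lt (by omega)
    · rfl
  · simp

/-- In a vanishing sum of `p ^ (k + 1)`-th roots of unity, multiplicities are constant on
residue classes modulo `p ^ k`. -/
theorem exists_count_eq_of_multisetRootSum_eq_zero {p k q : ℕ} (hp : p.Prime)
    (hq : q = p ^ (k + 1)) (M : Multiset (ZMod q)) (hM : multisetRootSum q M = 0) :
    ∃ g : Fin (p ^ k) → ℕ, ∀ x, M.count (residueOfDivMod p (p ^ k) q x) = g x.2 := by
  have h : q = p * p ^ k := by rw [hq, pow_succ']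
  have hq0 : q ≠ 0 := by rw [hq]; exact pow_ne_zero _ hp.ne_zero
  have hζ := Complex.isPrimitiveRoot_exp q hq0
  set F : Polynomial ℤ := ∑ x : Fin p × Fin (p ^ k),
    Polynomial.monomial (x.2.val + p ^ k * x.1.val)
      (M.count (residueOfDivMod p (p ^ k) q x) : ℤ) with hF
  have hcoeff : ∀ x : Fin p × Fin (p ^ k), F.coeff (x.2.val + p ^ k * x.1.val) =
      M.count (residueOfDivMod p (p ^ k) q x) := by
    intro x
    rw [hF, Polynomial.finsetSum_coeff, Finset.sum_eq_single x]
    · simp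
    · intro y _ hy
      rw [Polynomial.coeff_monomial, if_neg]
      intro hxy
      exact hy (finProdFinEquiv.injective (Fin.ext (by simpa using hxy)))
    · simp
  have hdeg : F.degree < q := by
    refine (Polynomial.degree_sum_le _ _).trans_lt ?_
    rw [Finset.sup_lt_iff (WithBot.bot_lt_coe _)]
    intro x _
    refine (Polynomial.degree_monomial_le _ _).trans_lt ?_
    have := (finProdFinEquiv x).isLt
    rw [finProdFinEquiv_apply_val, ← h] at this
    exact_mod_cast this
  have hroot : Polynomial.aeval (Complex.exp (2 * Real.pi * Complex.I / q)) F = 0 := by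
    rw [multisetRootSum_eq_sum h hq0] at hM
    rw [hF, map_sum]
    simpa [Polynomial.aeval_monomial] using hM
  obtain ⟨G, hG⟩ : Polynomial.cyclotomic q ℤ ∣ F := by
    rw [Polynomial.cyclotomic_eq_minpoly hζ (Nat.pos_of_ne_zero hq0)]
    exact minpoly.isIntegrallyClosed_dvd (hζ.isIntegral (Nat.pos_of_ne_zero hq0)) hroot
  have hGdeg : G.natDegree < p ^ k := by
    by_cases hG0 : G = 0
    · simp [hG0, hp.pos]
    have hF0 : F ≠ 0 := by
      rw [hG]; exact mul_ne_zero (Polynomial.cyclotomic_ne_zero _ _) hG0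
    have h1 := (Polynomial.natDegree_lt_iff_degree_lt hF0).2 hdeg
    rw [hG, Polynomial.natDegree_mul (Polynomial.cyclotomic_ne_zero _ _) hG0,
      Polynomial.natDegree_cyclotomic, hq, Nat.totient_prime_pow_succ hp, pow_succ] at h1
    have h2 : p ^ k * p = p ^ k * (p - 1) + p ^ k := by
      rw [← Nat.mul_succ, Nat.succ_eq_add_one, Nat.sub_add_cancel hp.one_le]
    omega
  refine ⟨fun r => (G.coeff r).toNat, fun x => ?_⟩
  have := hcoeff x
  subst hq
  rw [hG, Polynomial.cyclotomic_prime_pow_eq_geom_sum hp, coeff_geom_sum_mul G hGdeg] at this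
  simp [this]

theorem count_vanishing_multisets_prime_power
    (p a q n : ℕ) (hp : p.Prime) (ha : 0 < a) (hq : q = p ^ a)
    (hn : 0 < n) (hpn : p ∣ n) :
    Set.ncard {M : Multiset (ZMod q) |
        Multiset.card M = n ∧ (0 : ZMod q) ∈ M ∧ multisetRootSum q M = 0} =
      Nat.choose ((n + q) / p - 2) (n / p - 1) := by
  obtain ⟨k, rfl⟩ : ∃ k, a = k + 1 := ⟨a - 1, by omega⟩
  obtain ⟨m, rfl⟩ := hpn
  have hm : 0 < m := Nat.pos_of_mul_pos_left hn
  have h : q = p * p ^ k := by rw [hq, pow_succ']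
  have hq0 : q ≠ 0 := by rw [hq]; exact pow_ne_zero _ hp.ne_zero
  have hQ : 0 < p ^ k := pow_pos hp.pos k
  have : NeZero (p ^ k) := ⟨hQ.ne'⟩
  have : NeZero p := ⟨hp.ne_zero⟩
  have hbij := residueOfDivMod_bijective h hq0
  have hzero : residueOfDivMod p (p ^ k) q (0, 0) = 0 := by simp [residueOfDivMod]
  have hinj : Function.Injective (multisetLift p (p ^ k) q) := by
    intro N N' hN
    ext r
    rw [← count_multisetLift h hq0 N (0, r), hN, count_multisetLift h hq0]
  have hset : {M : Multiset (ZMod q) |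
      Multiset.card M = p * m ∧ (0 : ZMod q) ∈ M ∧ multisetRootSum q M = 0} =
      Set.range fun N : Sym (Fin (p ^ k)) (m - 1) =>
        multisetLift p (p ^ k) q (0 ::ₘ (N : Multiset (Fin (p ^ k)))) := by
    ext M
    constructor
    · rintro ⟨hcard, hmem, hsum⟩
      obtain ⟨g, hg⟩ := exists_count_eq_of_multisetRootSum_eq_zero hp hq M hsum
      have hM : multisetLift p (p ^ k) q (∑ r, Multiset.replicate (g r) r) = M := by
        ext y
        obtain ⟨x, rfl⟩ := hbij.surjective y
        rw [count_multisetLift h hq0, hg, Multiset.count_sum']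
        simp [Multiset.count_replicate]
      generalize ∑ r, Multiset.replicate (g r) r = N at hM
      subst hM
      rw [card_multisetLift] at hcard
      have hN := Nat.eq_of_mul_eq_mul_left hp.pos hcard
      rw [← hzero, ← Multiset.count_pos, count_multisetLift h hq0, Multiset.count_pos] at hmem
      refine ⟨⟨N.erase 0, by rw [Multiset.card_erase_of_mem hmem, hN]; rfl⟩, ?_⟩
      exact congrArg _ (Multiset.cons_erase hmem)
    · rintro ⟨N, rfl⟩
      refine ⟨?_, ?_, multisetRootSum_multisetLift h hq0 hp.one_lt _⟩
      · rw [card_multisetLift, Multiset.card_cons, Sym.card_coe, Nat.sub_add_cancel hm]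
      · rw [← hzero, ← Multiset.count_pos, count_multisetLift h hq0, Multiset.count_pos]
        exact Multiset.mem_cons_self _ _
  have hdiv : (p * m + q) / p = m + p ^ k := by
    rw [h, ← mul_add, Nat.mul_div_cancel_left _ hp.pos]
  rw [hset, ← Set.image_univ, Set.ncard_image_of_injective, Set.ncard_univ,
    Nat.card_eq_fintype_card, Sym.card_sym_eq_choose, Fintype.card_fin, hdiv,
    Nat.mul_div_cancel_left _ hp.pos]
  · congr 1
    omega
  · intro N N' hN
    exact Sym.coe_injective ((Multiset.cons_inj_right 0).1 (hinj hN))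
end

section
/- Let p be an odd prime, let q = 2p, and let n ≥ 2 be an integer. Then the number of multisets M over ℤ/qℤ of cardinality n such that 0 ∈ M and ∑_{m ∈ M} exp(2πi·m/q) = 0 equals ((1+(−1)^n)/2)·C(p + ⌊n/2⌋ − 2, ⌊n/2⌋ − 1) + ∑_{2s+pt=n, s≥1, t≥1} C(p+s−1, s) + ∑_{2s+pt=n, s≥1, t≥1} C(p+s−2, s−1) + δ, where δ = 1 if p divides n and δ = 0 otherwise (the sums range over pairs of positive integers (s,t) with 2s + pt = n). -/
open Complex Finset

/-- An integer linear combination of `1, ζ, …, ζ ^ (p - 1)` with `ζ` a primitive `p`-th root of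
unity, `p` prime, vanishes exactly when all its coefficients agree. -/
theorem IsPrimitiveRoot.sum_intCast_mul_pow_eq_zero_iff {p : ℕ} (hp : p.Prime) {ζ : ℂ}
    (hζ : IsPrimitiveRoot ζ p) (d : Fin p → ℤ) :
    ∑ i, (d i : ℂ) * ζ ^ (i : ℕ) = 0 ↔ ∃ t : ℤ, ∀ i, d i = t := by
  have : Fact p.Prime := ⟨hp⟩
  constructor
  · intro h
    set P : Polynomial ℚ := ∑ i : Fin p, Polynomial.C (d i : ℚ) * Polynomial.X ^ (i : ℕ) with hP
    have hcoeff (j : Fin p) : P.coeff j = d j := by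
      simp [hP, Polynomial.coeff_X_pow, Fin.val_inj]
    have hdeg : P.natDegree ≤ p - 1 := by
      refine Polynomial.natDegree_sum_le_of_forall_le _ _ fun i _ => ?_
      exact (Polynomial.natDegree_C_mul_X_pow_le _ _).trans (Nat.le_sub_one_of_lt i.2)
    have hdvd : Polynomial.cyclotomic p ℚ ∣ P := by
      rw [Polynomial.cyclotomic_eq_minpoly_rat hζ hp.pos]
      exact minpoly.dvd _ _ (by simpa [hP] using h)
    obtain ⟨Q, hQ⟩ := hdvd
    have hQ0 : Q.natDegree = 0 := by
      by_cases hQz : Q = 0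
      · simp [hQz]
      have h1 := congrArg Polynomial.natDegree hQ
      rw [Polynomial.natDegree_mul (Polynomial.cyclotomic_ne_zero p ℚ) hQz,
        Polynomial.natDegree_cyclotomic, Nat.totient_prime hp] at h1
      omega
    have hconst (j : Fin p) : (d j : ℚ) = Q.coeff 0 := by
      rw [← hcoeff, hQ, Polynomial.eq_C_of_natDegree_eq_zero hQ0, Polynomial.coeff_mul_C,
        Polynomial.cyclotomic_prime]
      simp [Polynomial.coeff_X_pow]
    refine ⟨d ⟨0, hp.pos⟩, fun i => ?_⟩
    exact_mod_cast (hconst i).trans (hconst ⟨0, hp.pos⟩).symm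
  · rintro ⟨t, ht⟩
    simp only [ht, ← Finset.mul_sum]
    rw [Fin.sum_univ_eq_sum_range (fun i => ζ ^ i), hζ.geom_sum_eq_zero hp.one_lt, mul_zero]

/-- The residue `2 i` modulo `2 p`. -/
def evenResidue (p : ℕ) (i : Fin p) : ZMod (2 * p) := ((2 * (i : ℕ) : ℕ) : ZMod (2 * p))

/-- The residue `2 i + p` modulo `2 p`, antipodal to `evenResidue p i`. -/
def oddResidue (p : ℕ) (i : Fin p) : ZMod (2 * p) := ((2 * (i : ℕ) + p : ℕ) : ZMod (2 * p))

theorem evenResidue_injective (p : ℕ) : Function.Injective (evenResidue p) := by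
  intro i j h
  have h := (ZMod.natCast_eq_natCast_iff _ _ _).1 h
  have := h.eq_of_lt_of_lt (by omega) (by omega)
  exact Fin.ext (by omega)

theorem oddResidue_injective (p : ℕ) : Function.Injective (oddResidue p) := by
  intro i j h
  refine evenResidue_injective p ?_
  simpa [oddResidue, evenResidue] using h

theorem evenResidue_ne_oddResidue {p : ℕ} (hodd : Odd p) (i j : Fin p) :
    evenResidue p i ≠ oddResidue p j := by
  intro h
  have h := ((ZMod.natCast_eq_natCast_iff _ _ _).1 h).of_dvd (dvd_mul_right 2 p)
  obtain ⟨k, hk⟩ := hodd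
  unfold Nat.ModEq at h
  omega

theorem sumElim_residue_bijective {p : ℕ} (hodd : Odd p) :
    Function.Bijective (Sum.elim (evenResidue p) (oddResidue p)) := by
  have : NeZero p := ⟨hodd.pos.ne'⟩
  rw [Fintype.bijective_iff_injective_and_card]
  refine ⟨(evenResidue_injective p).sumElim (oddResidue_injective p)
    (evenResidue_ne_oddResidue hodd), ?_⟩
  simp [ZMod.card, two_mul]

theorem sum_zmod_two_mul {p : ℕ} [NeZero p] (hodd : Odd p) {R : Type*} [AddCommMonoid R]
    (f : ZMod (2 * p) → R) :
    ∑ m, f m = ∑ i, f (evenResidue p i) + ∑ i, f (oddResidue p i) := by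
  rw [← Fintype.sum_bijective _ (sumElim_residue_bijective hodd) _ f fun _ => rfl]
  simp

theorem multisetRootSum_two_mul {p : ℕ} (hodd : Odd p) (M : Multiset (ZMod (2 * p))) :
    multisetRootSum (2 * p) M = ∑ i : Fin p,
      (((M.count (evenResidue p i) : ℤ) - (M.count (oddResidue p i) : ℤ) : ℤ) : ℂ) *
        Complex.exp (2 * Real.pi * Complex.I / p) ^ (i : ℕ) := by
  have : NeZero p := ⟨hodd.pos.ne'⟩
  have hp0 : (p : ℂ) ≠ 0 := NeZero.ne _
  have hχ : ∀ m : ZMod (2 * p),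
      Complex.exp (2 * Real.pi * Complex.I * ((m : ZMod (2 * p)).val : ℂ) / (2 * p : ℕ)) =
        ZMod.stdAddChar m := fun m => by
    rw [ZMod.stdAddChar_apply, ZMod.toCircle_apply]
  have heven (i : Fin p) : ZMod.stdAddChar (evenResidue p i) =
      Complex.exp (2 * Real.pi * Complex.I / p) ^ (i : ℕ) := by
    rw [evenResidue, ← Int.cast_natCast, ZMod.stdAddChar_coe, ← Complex.exp_nat_mul]
    congr 1
    push_cast
    field_simp
  have hoddp (i : Fin p) : ZMod.stdAddChar (oddResidue p i) =
      -Complex.exp (2 * Real.pi * Complex.I / p) ^ (i : ℕ) := by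
    rw [oddResidue, ← Int.cast_natCast, ZMod.stdAddChar_coe, ← Complex.exp_nat_mul,
      ← Complex.exp_add_pi_mul_I]
    congr 1
    push_cast
    field_simp
  have hcount : (M.map fun m => ZMod.stdAddChar m).sum =
      ∑ m, M.count m • (ZMod.stdAddChar m : ℂ) := by
    rw [Finset.sum_multiset_map_count]
    refine Finset.sum_subset (Finset.subset_univ _) fun m _ hm => ?_
    rw [Multiset.mem_toFinset] at hm
    simp [hm]
  simp only [multisetRootSum, hχ]
  rw [hcount, sum_zmod_two_mul hodd, ← Finset.sum_add_distrib]
  refine Finset.sum_congr rfl fun i _ => ?_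
  rw [heven, hoddp]
  simp only [nsmul_eq_mul]
  push_cast
  ring

theorem multisetRootSum_two_mul_eq_zero_iff {p : ℕ} (hp : p.Prime) (hodd : Odd p)
    (M : Multiset (ZMod (2 * p))) :
    multisetRootSum (2 * p) M = 0 ↔ ∃ t : ℤ, ∀ i : Fin p,
      (M.count (evenResidue p i) : ℤ) - (M.count (oddResidue p i) : ℤ) = t := by
  rw [multisetRootSum_two_mul hodd]
  exact (Complex.isPrimitiveRoot_exp p hp.ne_zero).sum_intCast_mul_pow_eq_zero_iff hp _

/-- The multiset over `ℤ/2pℤ` made of the antipodal pairs indexed by `B`, together with `t` copies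
of the even residues if `t ≥ 0`, and `-t` copies of the odd residues otherwise. -/
def pairsAddPolygons (p : ℕ) (x : Multiset (Fin p) × ℤ) : Multiset (ZMod (2 * p)) :=
  (x.1 + x.2.toNat • Finset.univ.val).map (evenResidue p) +
    (x.1 + (-x.2).toNat • Finset.univ.val).map (oddResidue p)

theorem count_evenResidue_pairsAddPolygons {p : ℕ} (hodd : Odd p) (x : Multiset (Fin p) × ℤ)
    (i : Fin p) :
    (pairsAddPolygons p x).count (evenResidue p i) = x.1.count i + x.2.toNat := by
  rw [pairsAddPolygons, Multiset.count_add,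
    Multiset.count_map_eq_count' _ _ (evenResidue_injective p),
    Multiset.count_eq_zero_of_notMem (s := Multiset.map _ _)]
  · simp [Multiset.count_nsmul, Multiset.count_univ]
  · rw [Multiset.mem_map]
    rintro ⟨j, _, hj⟩
    exact evenResidue_ne_oddResidue hodd i j hj.symm

theorem count_oddResidue_pairsAddPolygons {p : ℕ} (hodd : Odd p) (x : Multiset (Fin p) × ℤ)
    (i : Fin p) :
    (pairsAddPolygons p x).count (oddResidue p i) = x.1.count i + (-x.2).toNat := by
  rw [pairsAddPolygons, Multiset.count_add,
    Multiset.count_map_eq_count' _ _ (oddResidue_injective p),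
    Multiset.count_eq_zero_of_notMem (s := Multiset.map (evenResidue p) _)]
  · simp [Multiset.count_nsmul, Multiset.count_univ]
  · rw [Multiset.mem_map]
    rintro ⟨j, _, hj⟩
    exact evenResidue_ne_oddResidue hodd j i hj

theorem card_pairsAddPolygons (p : ℕ) (x : Multiset (Fin p) × ℤ) :
    Multiset.card (pairsAddPolygons p x) = 2 * Multiset.card x.1 + p * x.2.natAbs := by
  have : x.2.natAbs = x.2.toNat + (-x.2).toNat := by omega
  simp only [pairsAddPolygons, Multiset.card_add, Multiset.card_map, Multiset.card_nsmul,
    Finset.card_val, Finset.card_univ, Fintype.card_fin, this]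
  ring

theorem pairsAddPolygons_injective {p : ℕ} (hodd : Odd p) :
    Function.Injective (pairsAddPolygons p) := by
  intro x y h
  have he (i : Fin p) := congrArg (Multiset.count (evenResidue p i)) h
  have ho (i : Fin p) := congrArg (Multiset.count (oddResidue p i)) h
  simp only [count_evenResidue_pairsAddPolygons hodd] at he
  simp only [count_oddResidue_pairsAddPolygons hodd] at ho
  have ht : x.2 = y.2 := by
    have h1 := he ⟨0, hodd.pos⟩
    have h2 := ho ⟨0, hodd.pos⟩
    omega
  refine Prod.ext (Multiset.ext.2 fun i => ?_) ht
  have h1 := he i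
  rw [ht] at h1
  omega

theorem range_pairsAddPolygons {p : ℕ} (hp : p.Prime) (hodd : Odd p) :
    Set.range (pairsAddPolygons p) = {M | multisetRootSum (2 * p) M = 0} := by
  ext M
  rw [Set.mem_ofPred_eq, multisetRootSum_two_mul_eq_zero_iff hp hodd]
  constructor
  · rintro ⟨x, rfl⟩
    refine ⟨x.2, fun i => ?_⟩
    rw [count_evenResidue_pairsAddPolygons hodd, count_oddResidue_pairsAddPolygons hodd]
    omega
  · rintro ⟨t, ht⟩
    set B : Multiset (Fin p) := ∑ i : Fin p,
      Multiset.replicate (min (M.count (evenResidue p i)) (M.count (oddResidue p i))) i with hB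
    have hcB (i : Fin p) :
        B.count i = min (M.count (evenResidue p i)) (M.count (oddResidue p i)) := by
      simp [hB, Multiset.count_sum', Multiset.count_replicate]
    refine ⟨(B, t), Multiset.ext.2 fun m => ?_⟩
    obtain ⟨i | i, rfl⟩ := (sumElim_residue_bijective hodd).surjective m
    · have := ht i
      simp only [Sum.elim_inl, count_evenResidue_pairsAddPolygons hodd, hcB]
      omega
    · have := ht i
      simp only [Sum.elim_inr, count_oddResidue_pairsAddPolygons hodd, hcB]
      omega

theorem zero_mem_pairsAddPolygons_iff {p : ℕ} [NeZero p] (hodd : Odd p)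
    (x : Multiset (Fin p) × ℤ) :
    0 ∈ pairsAddPolygons p x ↔ 0 ∈ x.1 ∨ 0 < x.2 := by
  have h0 : (0 : ZMod (2 * p)) = evenResidue p 0 := by simp [evenResidue]
  rw [h0, ← Multiset.count_pos, count_evenResidue_pairsAddPolygons hodd, ← Multiset.count_pos]
  omega

/-- The multisets of cardinality `s` over a finite type. -/
def multisetsOfCard (α : Type*) [Fintype α] [DecidableEq α] (s : ℕ) : Finset (Multiset α) :=
  (Finset.univ : Finset (Sym α s)).map ⟨Sym.toMultiset, Sym.coe_injective⟩

theorem mem_multisetsOfCard {α : Type*} [Fintype α] [DecidableEq α] {s : ℕ} {B : Multiset α} :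
    B ∈ multisetsOfCard α s ↔ Multiset.card B = s := by
  simp only [multisetsOfCard, Finset.mem_map, Finset.mem_univ, true_and,
    Function.Embedding.coeFn_mk]
  exact ⟨fun ⟨x, hx⟩ => hx ▸ x.2, fun h => ⟨Sym.mk B h, rfl⟩⟩

theorem card_multisetsOfCard (p s : ℕ) :
    (multisetsOfCard (Fin p) s).card = (p + s - 1).choose s := by
  simp [multisetsOfCard, Sym.card_sym_eq_choose]

theorem Multiset.cons_injective {α : Type*} (a : α) : Function.Injective (Multiset.cons a) :=
  fun _ _ => (Multiset.cons_inj_right a).1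

/-- The multisets of cardinality `s ≥ 1` containing `a`. -/
def multisetsOfCardContaining {α : Type*} [Fintype α] [DecidableEq α] (a : α) (s : ℕ) :
    Finset (Multiset α) :=
  (multisetsOfCard α (s - 1)).map ⟨Multiset.cons a, Multiset.cons_injective a⟩

theorem mem_multisetsOfCardContaining {α : Type*} [Fintype α] [DecidableEq α] {a : α} {s : ℕ}
    (hs : 1 ≤ s) {B : Multiset α} :
    B ∈ multisetsOfCardContaining a s ↔ Multiset.card B = s ∧ a ∈ B := by
  simp only [multisetsOfCardContaining, Finset.mem_map, mem_multisetsOfCard,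
    Function.Embedding.coeFn_mk]
  constructor
  · rintro ⟨C, hC, rfl⟩
    rw [Multiset.card_cons]
    exact ⟨by omega, Multiset.mem_cons_self _ _⟩
  · rintro ⟨h, ha⟩
    obtain ⟨C, rfl⟩ := Multiset.exists_cons_of_mem ha
    rw [Multiset.card_cons] at h
    exact ⟨C, by omega, rfl⟩

theorem card_multisetsOfCardContaining {p : ℕ} (a : Fin p) {s : ℕ} (hs : 1 ≤ s) :
    (multisetsOfCardContaining a s).card = (p + s - 2).choose (s - 1) := by
  rw [multisetsOfCardContaining, Finset.card_map, card_multisetsOfCard]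
  congr 1
  omega

/-- The pairs `(B, ε t)` with `B ∈ X s` for some `s, t ≤ n` satisfying `P s t`. -/
def gradedPairs {α : Type*} [DecidableEq α] (n : ℕ) (P : ℕ → ℕ → Prop)
    [∀ s t, Decidable (P s t)] (X : ℕ → Finset (Multiset α)) (ε : ℤ) :
    Finset (Multiset α × ℤ) :=
  ((Finset.range (n + 1) ×ˢ Finset.range (n + 1)).filter fun y => P y.1 y.2).biUnion
    fun y => X y.1 ×ˢ {ε * (y.2 : ℤ)}

theorem mem_gradedPairs {α : Type*} [DecidableEq α] {n : ℕ} {P : ℕ → ℕ → Prop}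
    [∀ s t, Decidable (P s t)] {X : ℕ → Finset (Multiset α)} {ε : ℤ} {x : Multiset α × ℤ} :
    x ∈ gradedPairs n P X ε ↔ ∃ s t : ℕ, s ≤ n ∧ t ≤ n ∧ P s t ∧ x.1 ∈ X s ∧ x.2 = ε * t := by
  simp only [gradedPairs, Finset.mem_biUnion, Finset.mem_filter, Finset.mem_product,
    Finset.mem_range, Finset.mem_singleton, Prod.exists, Nat.lt_succ_iff]
  exact ⟨fun ⟨s, t, ⟨⟨h1, h2⟩, h3⟩, h4, h5⟩ => ⟨s, t, h1, h2, h3, h4, h5⟩,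
    fun ⟨s, t, h1, h2, h3, h4, h5⟩ => ⟨s, t, ⟨⟨h1, h2⟩, h3⟩, h4, h5⟩⟩

theorem card_gradedPairs {α : Type*} [DecidableEq α] (n : ℕ) (P : ℕ → ℕ → Prop)
    [∀ s t, Decidable (P s t)] (X : ℕ → Finset (Multiset α)) {ε : ℤ} (hε : ε ≠ 0)
    (hX : ∀ s t, P s t → ∀ B ∈ X s, Multiset.card B = s) :
    (gradedPairs n P X ε).card =
      ∑ s ∈ Finset.range (n + 1), ∑ t ∈ Finset.range (n + 1), if P s t then (X s).card else 0 := by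
  rw [gradedPairs, Finset.card_biUnion, Finset.sum_filter, Finset.sum_product]
  · simp
  · intro y hy z hz hyz
    rw [Function.onFun, Finset.disjoint_left]
    rintro ⟨B, t⟩ hB hB'
    simp only [Finset.mem_product, Finset.mem_singleton, Finset.mem_coe,
      Finset.mem_filter] at hy hz hB hB'
    refine hyz (Prod.ext ?_ ?_)
    · rw [← hX _ _ hy.2 B hB.1, hX _ _ hz.2 B hB'.1]
    · exact_mod_cast mul_left_cancel₀ hε (hB.2.symm.trans hB'.2)

theorem count_vanishing_multisets_twice_odd_prime
    (p q n : ℕ) (hp : p.Prime) (hodd : Odd p) (hq : q = 2 * p) (hn : 2 ≤ n) :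
    (Set.ncard {M : Multiset (ZMod q) |
        Multiset.card M = n ∧ (0 : ZMod q) ∈ M ∧ multisetRootSum q M = 0} : ℤ) =
      (1 + (-1 : ℤ) ^ n) / 2 * Nat.choose (p + n / 2 - 2) (n / 2 - 1)
      + ∑ s ∈ Finset.range (n + 1), ∑ t ∈ Finset.range (n + 1),
          (if 2 * s + p * t = n ∧ 1 ≤ s ∧ 1 ≤ t then (Nat.choose (p + s - 1) s : ℤ) else 0)
      + ∑ s ∈ Finset.range (n + 1), ∑ t ∈ Finset.range (n + 1),
          (if 2 * s + p * t = n ∧ 1 ≤ s ∧ 1 ≤ t then (Nat.choose (p + s - 2) (s - 1) : ℤ) else 0)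
      + (if p ∣ n then 1 else 0) := by
  subst hq
  have : NeZero p := ⟨hp.ne_zero⟩
  set P : ℕ → ℕ → Prop := fun s t => 2 * s + p * t = n ∧ 1 ≤ s ∧ 1 ≤ t with hP
  set T₁ := gradedPairs n P (multisetsOfCard (Fin p)) 1 with hT₁
  set T₂ := gradedPairs n P (multisetsOfCardContaining (0 : Fin p)) (-1) with hT₂
  set T₃ : Finset (Multiset (Fin p) × ℤ) :=
    if Even n then multisetsOfCardContaining 0 (n / 2) ×ˢ {0} else ∅ with hT₃
  set T₄ : Finset (Multiset (Fin p) × ℤ) :=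
    if p ∣ n then {(0, ((n / p : ℕ) : ℤ))} else ∅ with hT₄
  have hm₁ (x) : x ∈ T₁ ↔ 2 * Multiset.card x.1 + p * x.2.natAbs = n ∧
      1 ≤ Multiset.card x.1 ∧ 0 < x.2 := by
    rw [hT₁, mem_gradedPairs]
    constructor
    · rintro ⟨s, t, -, -, ⟨h1, h2, h3⟩, h4, h5⟩
      rw [mem_multisetsOfCard] at h4
      have : x.2.natAbs = t := by omega
      rw [this, h4]
      exact ⟨h1, h2, by omega⟩
    · rintro ⟨h1, h2, h3⟩
      have := Nat.le_mul_of_pos_left x.2.natAbs hp.pos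
      exact ⟨Multiset.card x.1, x.2.natAbs, by omega, by omega, ⟨h1, h2, by omega⟩,
        mem_multisetsOfCard.2 rfl, by omega⟩
  have hm₂ (x) : x ∈ T₂ ↔ 2 * Multiset.card x.1 + p * x.2.natAbs = n ∧ 0 ∈ x.1 ∧ x.2 < 0 := by
    rw [hT₂, mem_gradedPairs]
    constructor
    · rintro ⟨s, t, -, -, ⟨h1, h2, h3⟩, h4, h5⟩
      rw [mem_multisetsOfCardContaining h2] at h4
      have : x.2.natAbs = t := by omega
      rw [this, h4.1]
      exact ⟨h1, h4.2, by omega⟩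
    · rintro ⟨h1, h2, h3⟩
      have := Nat.le_mul_of_pos_left x.2.natAbs hp.pos
      have hc : 1 ≤ Multiset.card x.1 := Multiset.card_pos_iff_exists_mem.2 ⟨0, h2⟩
      exact ⟨Multiset.card x.1, x.2.natAbs, by omega, by omega, ⟨h1, hc, by omega⟩,
        (mem_multisetsOfCardContaining hc).2 ⟨rfl, h2⟩, by omega⟩
  have hn2 : 1 ≤ n / 2 := by omega
  have hm₃ (x) : x ∈ T₃ ↔ 2 * Multiset.card x.1 + p * x.2.natAbs = n ∧ 0 ∈ x.1 ∧ x.2 = 0 := by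
    rw [hT₃]
    split_ifs with h
    · rw [Finset.mem_product, mem_multisetsOfCardContaining hn2, Finset.mem_singleton]
      obtain ⟨k, hk⟩ := h
      constructor
      · rintro ⟨⟨h1, h2⟩, h3⟩
        exact ⟨by rw [h3, h1]; simp; omega, h2, h3⟩
      · rintro ⟨h1, h2, h3⟩
        rw [h3] at h1
        simp only [Int.natAbs_zero, mul_zero] at h1
        exact ⟨⟨by omega, h2⟩, h3⟩
    · simp only [Finset.notMem_empty, false_iff]
      rintro ⟨h1, -, h3⟩
      rw [h3] at h1
      simp only [Int.natAbs_zero, mul_zero] at h1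
      exact h ⟨Multiset.card x.1, by omega⟩
  have hm₄ (x) : x ∈ T₄ ↔ 2 * Multiset.card x.1 + p * x.2.natAbs = n ∧
      Multiset.card x.1 = 0 ∧ 0 < x.2 := by
    rw [hT₄]
    split_ifs with h
    · obtain ⟨k, rfl⟩ := h
      have hk : k ≠ 0 := by rintro rfl; omega
      rw [Finset.mem_singleton, Nat.mul_div_cancel_left _ hp.pos, Prod.ext_iff,
        Multiset.card_eq_zero]
      constructor
      · rintro ⟨h1, h2⟩
        simp only at h1 h2
        rw [h1, h2]
        simp only [Multiset.card_zero, Int.natAbs_natCast]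
        exact ⟨by omega, trivial, by omega⟩
      · rintro ⟨h1, h2, h3⟩
        rw [h2] at h1
        simp only [Multiset.card_zero, mul_zero, zero_add] at h1
        have := Nat.eq_of_mul_eq_mul_left hp.pos h1
        exact ⟨h2, by simp only; omega⟩
    · simp only [Finset.notMem_empty, false_iff]
      rintro ⟨h1, h2, -⟩
      exact h ⟨x.2.natAbs, by rw [← h1, h2]; omega⟩
  have hset : {M : Multiset (ZMod (2 * p)) |
      Multiset.card M = n ∧ (0 : ZMod (2 * p)) ∈ M ∧ multisetRootSum (2 * p) M = 0} =
      pairsAddPolygons p '' ((T₃ ∪ T₁ ∪ T₂ ∪ T₄ : Finset _) : Set (Multiset (Fin p) × ℤ)) := by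
    ext M
    have hM : multisetRootSum (2 * p) M = 0 ↔ M ∈ Set.range (pairsAddPolygons p) := by
      rw [range_pairsAddPolygons hp hodd, Set.mem_ofPred_eq]
    have hx (x : Multiset (Fin p) × ℤ) : x ∈ T₃ ∪ T₁ ∪ T₂ ∪ T₄ ↔
        2 * Multiset.card x.1 + p * x.2.natAbs = n ∧ (0 ∈ x.1 ∨ 0 < x.2) := by
      simp only [Finset.mem_union, hm₁, hm₂, hm₃, hm₄]
      have := lt_trichotomy x.2 0
      have : Multiset.card x.1 = 0 ∨ 1 ≤ Multiset.card x.1 := by omega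
      tauto
    rw [Set.mem_ofPred_eq, hM, Set.mem_image]
    constructor
    · rintro ⟨h1, h2, x, rfl⟩
      rw [card_pairsAddPolygons] at h1
      rw [zero_mem_pairsAddPolygons_iff hodd] at h2
      exact ⟨x, Finset.mem_coe.2 ((hx x).2 ⟨h1, h2⟩), rfl⟩
    · rintro ⟨x, h, rfl⟩
      rw [card_pairsAddPolygons, zero_mem_pairsAddPolygons_iff hodd]
      have := (hx x).1 (Finset.mem_coe.1 h)
      exact ⟨this.1, this.2, x, rfl⟩
  have hd₁ : Disjoint T₃ T₁ := Finset.disjoint_left.2 fun x h h' => by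
    rw [hm₃] at h; rw [hm₁] at h'; omega
  have hd₂ : Disjoint (T₃ ∪ T₁) T₂ := Finset.disjoint_left.2 fun x h h' => by
    rw [Finset.mem_union, hm₃, hm₁] at h; rw [hm₂] at h'; omega
  have hd₃ : Disjoint (T₃ ∪ T₁ ∪ T₂) T₄ := Finset.disjoint_left.2 fun x h h' => by
    rw [Finset.mem_union, Finset.mem_union, hm₃, hm₁, hm₂] at h; rw [hm₄] at h'; omega
  have hc₁ : (T₁.card : ℤ) = ∑ s ∈ Finset.range (n + 1), ∑ t ∈ Finset.range (n + 1),
      if P s t then (Nat.choose (p + s - 1) s : ℤ) else 0 := by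
    rw [hT₁, card_gradedPairs _ _ _ one_ne_zero fun s t _ B hB => mem_multisetsOfCard.1 hB]
    simp only [card_multisetsOfCard]
    push_cast
    rfl
  have hc₂ : (T₂.card : ℤ) = ∑ s ∈ Finset.range (n + 1), ∑ t ∈ Finset.range (n + 1),
      if P s t then (Nat.choose (p + s - 2) (s - 1) : ℤ) else 0 := by
    rw [hT₂, card_gradedPairs _ _ _ (by norm_num) fun s t h B hB =>
      ((mem_multisetsOfCardContaining h.2.1).1 hB).1]
    push_cast
    refine Finset.sum_congr rfl fun s _ => Finset.sum_congr rfl fun t _ => ?_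
    split_ifs with h
    · rw [card_multisetsOfCardContaining _ h.2.1]
    · rfl
  have hc₃ : (T₃.card : ℤ) =
      (1 + (-1 : ℤ) ^ n) / 2 * Nat.choose (p + n / 2 - 2) (n / 2 - 1) := by
    rw [hT₃]
    split_ifs with h
    · rw [Finset.card_product, card_multisetsOfCardContaining _ hn2, h.neg_one_pow]
      norm_num
    · rw [(Nat.not_even_iff_odd.1 h).neg_one_pow]
      norm_num
  have hc₄ : (T₄.card : ℤ) = if p ∣ n then 1 else 0 := by
    rw [hT₄]
    split_ifs <;> simp
  rw [hset, Set.ncard_image_of_injective _ (pairsAddPolygons_injective hodd),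
    Set.ncard_coe_finset, Finset.card_union_of_disjoint hd₃, Finset.card_union_of_disjoint hd₂,
    Finset.card_union_of_disjoint hd₁]
  push_cast
  rw [hc₁, hc₂, hc₃, hc₄]
end

section
/- Let n ≥ 1 and let A and B be n×n matrices with entries in {−1,0,1} such that A + iB is a BH(n,4) matrix (i denotes the imaginary unit). Then the 2n×2n matrix A ⊗ [[1,1],[1,−1]] + B ⊗ [[−1,1],[1,1]] is a BH(2n,2) matrix, i.e., a real Hadamard matrix of order 2n. -/
open Matrix Kronecker

/-- A Butson-type complex Hadamard matrix of complexity `q`: every entry is a complex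
`q`-th root of unity and `H * Hᴴ = n • I` where `n` is the size of the matrix. -/
def IsButson {m : Type*} [Fintype m] [DecidableEq m] (q : ℕ) (H : Matrix m m ℂ) : Prop :=
  (∀ i j, H i j ^ q = 1) ∧ H * H.conjTranspose = (Fintype.card m : ℂ) • 1

/-- A matrix with entries in `{-1, 0, 1}` has real entries. -/
lemma conjTranspose_eq_transpose_of_mem {m : Type*} {A : Matrix m m ℂ}
    (hA : ∀ i j, A i j ∈ ({-1, 0, 1} : Set ℂ)) : Aᴴ = Aᵀ := by
  ext i j
  have h : A j i = -1 ∨ A j i = 0 ∨ A j i = 1 := by simpa using hA j i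
  rcases h with h | h | h <;> simp [h]

/-- If `A` and `B` are real, the Gram equation for `A + iB` splits into its real and
imaginary parts. -/
lemma gram_split {m : Type*} [Fintype m] [DecidableEq m] {A B : Matrix m m ℂ} {c : ℂ}
    (hA : Aᴴ = Aᵀ) (hB : Bᴴ = Bᵀ)
    (h : (A + Complex.I • B) * (A + Complex.I • B)ᴴ = c • 1) :
    A * Aᵀ + B * Bᵀ = c • 1 ∧ A * Bᵀ = B * Aᵀ := by
  have h₁ : A * Aᵀ + B * Bᵀ + Complex.I • (B * Aᵀ - A * Bᵀ) = c • 1 := by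
    rw [← h, conjTranspose_add, conjTranspose_smul, hA, hB]
    simp only [add_mul, mul_add, smul_mul, Matrix.mul_smul, smul_smul, Complex.star_def,
      Complex.conj_I, neg_smul, mul_neg, Complex.I_mul_I, smul_sub, one_smul]
    abel
  have h₂ : A * Aᵀ + B * Bᵀ - Complex.I • (B * Aᵀ - A * Bᵀ) = c • 1 := by
    have := congrArg transpose h₁
    simp only [transpose_add, transpose_smul, transpose_sub, transpose_mul, transpose_transpose,
      transpose_one] at this
    rw [← this, ← neg_sub (A * Bᵀ), smul_neg, sub_neg_eq_add]
  have h₃ : Complex.I • (B * Aᵀ - A * Bᵀ) = 0 := by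
    have h₄ := h₁.trans h₂.symm
    rwa [sub_eq_add_neg _ (_ • _), add_right_inj, ← sub_eq_zero, sub_neg_eq_add, ← two_smul ℂ,
      smul_eq_zero_iff_right two_ne_zero] at h₄
  refine ⟨by simpa [h₃] using h₁, ?_⟩
  rw [smul_eq_zero_iff_right Complex.I_ne_zero, sub_eq_zero] at h₃
  exact h₃.symm

theorem butson4_to_real_hadamard
    (n : ℕ) (hn : 1 ≤ n) (A B : Matrix (Fin n) (Fin n) ℂ)
    (hA : ∀ i j, A i j ∈ ({-1, 0, 1} : Set ℂ))
    (hB : ∀ i j, B i j ∈ ({-1, 0, 1} : Set ℂ))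
    (hH : IsButson 4 (A + Complex.I • B)) :
    IsButson 2 (A ⊗ₖ (!![1, 1; 1, -1] : Matrix (Fin 2) (Fin 2) ℂ)
      + B ⊗ₖ (!![-1, 1; 1, 1] : Matrix (Fin 2) (Fin 2) ℂ)) := by
  have hentry (i j : Fin n) :
      (A i j = 0 ∧ B i j ^ 2 = 1) ∨ (B i j = 0 ∧ A i j ^ 2 = 1) := by
    have h := hH.1 i j
    have hdiag (a b : ℂ) (ha : a ^ 2 = 1) (hb : b ^ 2 = 1) : (a + Complex.I * b) ^ 4 = -4 := by
      have h₂ : (a + Complex.I * b) ^ 2 = 2 * Complex.I * (a * b) := by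
        linear_combination ha - hb + b ^ 2 * Complex.I_sq
      calc (a + Complex.I * b) ^ 4 = ((a + Complex.I * b) ^ 2) ^ 2 := by ring
        _ = 4 * Complex.I ^ 2 * (a ^ 2 * b ^ 2) := by rw [h₂]; ring
        _ = -4 := by rw [ha, hb, Complex.I_sq]; ring
    simp only [Matrix.add_apply, Matrix.smul_apply, smul_eq_mul] at h
    have hsq {x : ℂ} (hx : x ∈ ({-1, 0, 1} : Set ℂ)) : x = 0 ∨ x ^ 2 = 1 := by
      rcases hx with rfl | rfl | rfl <;> simp
    rcases hsq (hA i j) with ha | ha <;> rcases hsq (hB i j) with hb | hb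
    · simp [ha, hb] at h
    · exact .inl ⟨ha, hb⟩
    · exact .inr ⟨hb, ha⟩
    · rw [hdiag _ _ ha hb] at h
      norm_num at h
  have hA' := conjTranspose_eq_transpose_of_mem hA
  have hB' := conjTranspose_eq_transpose_of_mem hB
  obtain ⟨hre, him⟩ := gram_split hA' hB' hH.2
  constructor
  · rintro ⟨i, k⟩ ⟨j, l⟩
    rcases hentry i j with ⟨h₀, h₁⟩ | ⟨h₀, h₁⟩ <;> fin_cases k <;> fin_cases l <;>
      simp [h₀, h₁]
  · have hP : (!![1, 1; 1, -1] : Matrix (Fin 2) (Fin 2) ℂ)ᴴ = !![1, 1; 1, -1] := by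
      ext i j; fin_cases i <;> fin_cases j <;> simp
    have hQ : (!![-1, 1; 1, 1] : Matrix (Fin 2) (Fin 2) ℂ)ᴴ = !![-1, 1; 1, 1] := by
      ext i j; fin_cases i <;> fin_cases j <;> simp
    have hPP : (!![1, 1; 1, -1] : Matrix (Fin 2) (Fin 2) ℂ) * !![1, 1; 1, -1] = (2 : ℂ) • 1 := by
      ext i j; fin_cases i <;> fin_cases j <;> simp [mul_apply, Fin.sum_univ_two] <;> norm_num
    have hQQ : (!![-1, 1; 1, 1] : Matrix (Fin 2) (Fin 2) ℂ) * !![-1, 1; 1, 1] = (2 : ℂ) • 1 := by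
      ext i j; fin_cases i <;> fin_cases j <;> simp [mul_apply, Fin.sum_univ_two] <;> norm_num
    have hQP : (!![-1, 1; 1, 1] : Matrix (Fin 2) (Fin 2) ℂ) * !![1, 1; 1, -1] =
        -(!![1, 1; 1, -1] * !![-1, 1; 1, 1]) := by
      ext i j; fin_cases i <;> fin_cases j <;> simp [mul_apply, Fin.sum_univ_two]
    rw [conjTranspose_add, conjTranspose_kronecker, conjTranspose_kronecker, hA', hB', hP, hQ,
      add_mul, mul_add, mul_add, ← mul_kronecker_mul, ← mul_kronecker_mul, ← mul_kronecker_mul,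
      ← mul_kronecker_mul, hPP, hQQ, hQP, him]
    rw [← neg_one_smul ℂ (_ * _ : Matrix (Fin 2) (Fin 2) ℂ), kronecker_smul (-1 : ℂ), neg_one_smul]
    rw [add_assoc, add_neg_cancel_left, ← add_kronecker, hre,
      smul_kronecker, kronecker_smul, one_kronecker_one, smul_smul]
    simp
end

section
/- Let n ≥ 1, let ω = exp(2πi/3), and let A and B be n×n matrices with entries in {−1,0,1} such that A_{ij}·B_{ij} = 0 for all i, j ∈ {1,…,n} and H := Aω + Bω² is a BH(n,6) matrix. Then K := A ⊗ [[1,1],[1,−1]] + B ⊗ [[i,−1],[−1,i]] is a BH(2n,4) matrix. -/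
open Matrix Kronecker

lemma conj_eq_sq_of_isPrimitiveRoot_three {ω : ℂ} (hω : IsPrimitiveRoot ω 3) :
    star ω = ω ^ 2 := by
  have hinv : ω⁻¹ = ω ^ 2 :=
    inv_eq_of_mul_eq_one_right (by rw [← pow_succ']; exact hω.pow_eq_one)
  rw [← hinv]
  exact (Complex.inv_eq_conj (hω.norm'_eq_one (by norm_num))).symm

/-- For real matrices, the two cross Gram matrices in `H * Hᴴ` agree, since transposing
`H * Hᴴ = c • 1` swaps their coefficients. -/
lemma gram_of_mul_conjTranspose {m : Type*} [Fintype m] [DecidableEq m]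
    {A B : Matrix m m ℂ} (hA : Aᴴ = Aᵀ) (hB : Bᴴ = Bᵀ) {ω c : ℂ} (hω : IsPrimitiveRoot ω 3)
    (h : (ω • A + ω ^ 2 • B) * (ω • A + ω ^ 2 • B)ᴴ = c • 1) :
    A * Bᵀ = B * Aᵀ ∧ A * Aᵀ + B * Bᵀ - A * Bᵀ = c • 1 := by
  have h3 : ω ^ 3 = 1 := hω.pow_eq_one
  have hsum : ω ^ 2 + ω + 1 = 0 := by
    have := hω.geom_sum_eq_zero (by norm_num)
    simp only [Finset.sum_range_succ, Finset.sum_range_zero] at this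
    linear_combination this
  have hE : A * Aᵀ + B * Bᵀ + ω ^ 2 • (A * Bᵀ) + ω • (B * Aᵀ) = c • 1 := by
    rw [← h, conjTranspose_add, conjTranspose_smul, conjTranspose_smul, star_pow,
      conj_eq_sq_of_isPrimitiveRoot_three hω, hA, hB]
    simp only [add_mul, mul_add, smul_mul_assoc, mul_smul_comm]
    ext i j
    simp only [Matrix.add_apply, Matrix.smul_apply, smul_eq_mul]
    linear_combination (-(A * Aᵀ) i j - (ω ^ 3 + 1) * (B * Bᵀ) i j
      - ω ^ 2 * (A * Bᵀ) i j - ω * (B * Aᵀ) i j) * h3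
  have hT : A * Aᵀ + B * Bᵀ + ω ^ 2 • (B * Aᵀ) + ω • (A * Bᵀ) = c • 1 := by
    simpa using congrArg transpose hE
  have hne : ω ^ 2 - ω ≠ 0 := by
    intro h0
    have : ω * (ω - 1) = 0 := by linear_combination h0
    rcases mul_eq_zero.1 this with h1 | h1
    · exact hω.ne_zero (by norm_num) h1
    · exact hω.ne_one (by norm_num) (sub_eq_zero.1 h1)
  have hR : A * Bᵀ = B * Aᵀ := by
    ext i j
    have e := congrFun₂ hE i j
    have t := congrFun₂ hT i j
    simp only [Matrix.add_apply, Matrix.smul_apply, smul_eq_mul] at e t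
    refine mul_left_cancel₀ hne ?_
    linear_combination e - t
  refine ⟨hR, ?_⟩
  rw [← hE, ← hR]
  ext i j
  simp only [Matrix.add_apply, Matrix.sub_apply, Matrix.smul_apply, smul_eq_mul]
  linear_combination -(A * Bᵀ) i j * hsum

theorem unreal_butson6_to_butson4
    (n : ℕ) (hn : 1 ≤ n) (A B : Matrix (Fin n) (Fin n) ℂ)
    (hA : ∀ i j, A i j ∈ ({-1, 0, 1} : Set ℂ))
    (hB : ∀ i j, B i j ∈ ({-1, 0, 1} : Set ℂ))
    (hAB : ∀ i j, A i j * B i j = 0)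
    (ω : ℂ) (hω : ω = Complex.exp (2 * Real.pi * Complex.I / 3))
    (hH : IsButson 6 (ω • A + ω ^ 2 • B)) :
    IsButson 4 (A ⊗ₖ (!![1, 1; 1, -1] : Matrix (Fin 2) (Fin 2) ℂ)
      + B ⊗ₖ (!![Complex.I, -1; -1, Complex.I] : Matrix (Fin 2) (Fin 2) ℂ)) := by
  have hprim : IsPrimitiveRoot ω 3 := by
    simpa [hω] using Complex.isPrimitiveRoot_exp 3 (by norm_num)
  have hA' := conjTranspose_eq_transpose_of_mem hA
  have hB' := conjTranspose_eq_transpose_of_mem hB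
  obtain ⟨hroot, hmul⟩ := hH
  obtain ⟨hR, hG⟩ := gram_of_mul_conjTranspose hA' hB' hprim hmul
  constructor
  · rintro ⟨i, k⟩ ⟨j, l⟩
    have hr := hroot i j
    have hab := hAB i j
    simp only [Matrix.add_apply, Matrix.smul_apply, smul_eq_mul] at hr
    simp only [Matrix.add_apply, kroneckerMap_apply]
    simp only [Set.mem_insert_iff, Set.mem_singleton_iff] at hA hB
    rcases hA i j with ha | ha | ha <;> rcases hB i j with hb | hb | hb <;>
      rw [ha, hb] at hr hab ⊢ <;>
      first
        | (exfalso; norm_num at hab; done)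
        | (exfalso; norm_num at hr; done)
        | (fin_cases k <;> fin_cases l <;> simp [Even.neg_pow (show Even 4 by decide)])
  · set M : Matrix (Fin 2) (Fin 2) ℂ := !![1, 1; 1, -1] with hM
    set N : Matrix (Fin 2) (Fin 2) ℂ := !![Complex.I, -1; -1, Complex.I] with hN
    have hMM : M * Mᴴ = (2 : ℂ) • 1 := by
      ext i j
      fin_cases i <;> fin_cases j <;> simp [hM, mul_apply, Fin.sum_univ_two] <;> norm_num
    have hNN : N * Nᴴ = (2 : ℂ) • 1 := by
      ext i j
      fin_cases i <;> fin_cases j <;> simp [hN, mul_apply, Fin.sum_univ_two] <;> norm_num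
    have hMN : M * Nᴴ + N * Mᴴ = (-2 : ℂ) • 1 := by
      ext i j
      rw [Matrix.add_apply, mul_apply, mul_apply]
      fin_cases i <;> fin_cases j <;> simp [hM, hN, Fin.sum_univ_two] <;> ring
    calc (A ⊗ₖ M + B ⊗ₖ N) * (A ⊗ₖ M + B ⊗ₖ N)ᴴ
        = (A * Aᵀ) ⊗ₖ (M * Mᴴ) + (B * Bᵀ) ⊗ₖ (N * Nᴴ) +
            (A * Bᵀ) ⊗ₖ (M * Nᴴ + N * Mᴴ) := by
          rw [conjTranspose_add, conjTranspose_kronecker, conjTranspose_kronecker, hA', hB',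
            kronecker_add]
          nth_rewrite 2 [hR]
          simp only [mul_kronecker_mul, add_mul, mul_add]
          abel
      _ = (2 : ℂ) • ((A * Aᵀ + B * Bᵀ - A * Bᵀ) ⊗ₖ (1 : Matrix (Fin 2) (Fin 2) ℂ)) := by
          rw [hMM, hNN, hMN, sub_eq_add_neg, add_kronecker, add_kronecker]
          simp only [kronecker_smul]
          rw [← neg_one_smul ℂ (A * Bᵀ), smul_kronecker]
          module
      _ = (Fintype.card (Fin n × Fin 2) : ℂ) • 1 := by
          rw [hG, smul_kronecker, one_kronecker_one, smul_smul]
          simp [mul_comm]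
end

section
/- Let n ≥ 1 be an integer. If there exists a BH(n,6) matrix none of whose entries equals 1 or −1, then there exists a BH(4n,2) matrix (i.e., a real Hadamard matrix of order 4n). -/
open Matrix

open Kronecker in
/-- If `E` and `F` behave like twice a pair of complementary orthogonal projections, then
`E ⊗ H + F ⊗ H.map star` has orthogonal rows whenever `H` does. -/
lemma kronecker_add_kronecker_conj_mul_conjTranspose {l m : Type*} [Fintype l] [DecidableEq l]
    [Fintype m] [DecidableEq m] {E F : Matrix l l ℂ} {H : Matrix m m ℂ} {r : ℕ}
    (hE : E * Eᴴ = (2 : ℂ) • E) (hF : F * Fᴴ = (2 : ℂ) • F) (hEF : E * Fᴴ = 0)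
    (hFE : F * Eᴴ = 0) (hadd : E + F = (2 : ℂ) • 1) (hH : H * Hᴴ = (r : ℂ) • 1) :
    (E ⊗ₖ H + F ⊗ₖ H.map star) * (E ⊗ₖ H + F ⊗ₖ H.map star)ᴴ = (4 * r : ℂ) • 1 := by
  have hH' : H.map star * (H.map star)ᴴ = (r : ℂ) • 1 := by
    have h := congrArg (fun M : Matrix m m ℂ => M.map (starRingEnd ℂ)) hH
    simp only [Matrix.map_mul] at h
    ext i j
    have hij := congrFun (congrFun h i) j
    simpa [Matrix.mul_apply, Matrix.one_apply, apply_ite (starRingEnd ℂ)] using hij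
  rw [conjTranspose_add, conjTranspose_kronecker, conjTranspose_kronecker, add_mul, mul_add,
    mul_add, ← mul_kronecker_mul, ← mul_kronecker_mul, ← mul_kronecker_mul, ← mul_kronecker_mul,
    hE, hF, hEF, hFE, hH, hH', zero_kronecker, zero_kronecker, add_zero, zero_add,
    ← add_kronecker, ← smul_add, hadd, kronecker_smul, smul_kronecker, smul_kronecker,
    one_kronecker_one, smul_smul, smul_smul]
  congr 1
  ring

/-- The matrix of left multiplication by `i + j + k` on the quaternions. -/
def quaternionImagSum : Matrix (Fin 4) (Fin 4) ℂ :=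
  !![0, -1, -1, -1; 1, 0, -1, 1; 1, 1, 0, -1; 1, -1, 1, 0]

lemma quaternionImagSum_conjTranspose : quaternionImagSumᴴ = -quaternionImagSum := by
  ext a b
  fin_cases a <;> fin_cases b <;> simp [quaternionImagSum]

lemma quaternionImagSum_mul_self :
    quaternionImagSum * quaternionImagSum = (-3 : ℂ) • 1 := by
  ext a b
  fin_cases a <;> fin_cases b <;>
    simp [quaternionImagSum] <;> norm_num

lemma quaternionImagSum_apply_self (a : Fin 4) : quaternionImagSum a a = 0 := by
  fin_cases a <;> simp [quaternionImagSum]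

lemma quaternionImagSum_apply_sq {a b : Fin 4} (hab : a ≠ b) :
    quaternionImagSum a b ^ 2 = 1 := by
  fin_cases a <;> fin_cases b <;> simp_all [quaternionImagSum]

/-- A non-real sixth root of unity `z` satisfies `z + conj z = ±1` and `(z - conj z) ^ 2 = -3`. -/
lemma add_conj_sq_and_sub_conj_sq_of_pow_six_eq_one {z : ℂ} (hz : z ^ 6 = 1) (h1 : z ≠ 1)
    (h2 : z ≠ -1) : (z + star z) ^ 2 = 1 ∧ (z - star z) ^ 2 = -3 := by
  have hconj : z * star z = 1 := by
    have hn : ‖z‖ = 1 := Complex.norm_eq_one_of_pow_eq_one hz (by norm_num)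
    have := Complex.mul_conj' z
    rw [hn] at this
    simpa using this
  have hz0 : z ≠ 0 := left_ne_zero_of_mul_eq_one hconj
  have hquartic : z ^ 4 + z ^ 2 + 1 = 0 := by
    have h : (z - 1) * ((z + 1) * (z ^ 4 + z ^ 2 + 1)) = 0 := by linear_combination hz
    have h' := (mul_eq_zero.mp h).resolve_left (sub_ne_zero.mpr h1)
    exact (mul_eq_zero.mp h').resolve_left fun h0 => h2 (eq_neg_of_add_eq_zero_left h0)
  have hstar : star z = z⁻¹ := eq_inv_of_mul_eq_one_right hconj
  rw [hstar]
  constructor <;> field_simp <;> linear_combination hquartic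

theorem unreal_butson6_gives_real_hadamard
    (n : ℕ) (hn : 1 ≤ n)
    (h : ∃ H : Matrix (Fin n) (Fin n) ℂ, IsButson 6 H ∧ ∀ i j, H i j ≠ 1 ∧ H i j ≠ -1) :
    ∃ K : Matrix (Fin (4 * n)) (Fin (4 * n)) ℂ, IsButson 2 K := by
  obtain ⟨H, ⟨hroot, hH⟩, hne⟩ := h
  rw [Fintype.card_fin] at hH
  obtain ⟨c, hc, hcstar⟩ : ∃ c : ℂ, c ^ 2 = -1 / 3 ∧ star c = -c := by
    refine ⟨Complex.I / (√3 : ℝ), ?_, ?_⟩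
    · rw [div_pow, Complex.I_sq, ← Complex.ofReal_pow, Real.sq_sqrt (by norm_num)]
      norm_num
    · simp [neg_div]
  set J := quaternionImagSum with hJ
  have hJJ : (c • J) * (c • J) = 1 := by
    rw [smul_mul_smul_comm, quaternionImagSum_mul_self, smul_smul, ← sq, hc]
    norm_num
  have hcJ : (c • J)ᴴ = c • J := by
    rw [conjTranspose_smul, quaternionImagSum_conjTranspose, hcstar, neg_smul_neg]
  have hE : (1 + c • J)ᴴ = 1 + c • J := by rw [conjTranspose_add, hcJ, conjTranspose_one]
  have hF : (1 - c • J)ᴴ = 1 - c • J := by rw [conjTranspose_sub, hcJ, conjTranspose_one]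
  have key := kronecker_add_kronecker_conj_mul_conjTranspose (E := 1 + c • J) (F := 1 - c • J)
    (by rw [hE, add_mul, one_mul, mul_add, mul_one, hJJ, two_smul]; abel)
    (by rw [hF, sub_mul, one_mul, mul_sub, mul_one, hJJ, two_smul]; abel)
    (by rw [hF, add_mul, one_mul, mul_sub, mul_one, hJJ]; abel)
    (by rw [hE, sub_mul, one_mul, mul_add, mul_one, hJJ]; abel)
    (by rw [two_smul]; abel) hH
  refine ⟨Matrix.reindex finProdFinEquiv finProdFinEquiv
    (kroneckerMap (· * ·) (1 + c • J) H + kroneckerMap (· * ·) (1 - c • J) (H.map star)), ?_⟩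
  refine and_comm.mp ⟨?_, fun i j => ?_⟩
  · rw [conjTranspose_reindex, reindex_apply, reindex_apply, submatrix_mul_equiv, key,
      submatrix_smul, Pi.smul_apply, Pi.smul_apply, submatrix_one_equiv]
    simp
  · obtain ⟨⟨a, i⟩, rfl⟩ := finProdFinEquiv.surjective i
    obtain ⟨⟨b, j⟩, rfl⟩ := finProdFinEquiv.surjective j
    obtain ⟨hadd, hsub⟩ := add_conj_sq_and_sub_conj_sq_of_pow_six_eq_one (hroot i j)
      (hne i j).1 (hne i j).2
    simp only [reindex_apply, submatrix_apply, Equiv.symm_apply_apply, Matrix.add_apply,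
      Matrix.sub_apply, kroneckerMap_apply, Matrix.smul_apply, map_apply, smul_eq_mul]
    rcases eq_or_ne a b with rfl | hab
    · rw [hJ, quaternionImagSum_apply_self, one_apply_eq]
      linear_combination hadd
    · have hJab := quaternionImagSum_apply_sq hab
      rw [← hJ] at hJab
      rw [one_apply_ne hab]
      linear_combination (c ^ 2 * J a b ^ 2) * hsub - 3 * J a b ^ 2 * hc + hJab
end

section
/- For every q ∈ {10, 12, 14, 15} there does not exist a BH(11,q) matrix; that is, there is no 11×11 complex matrix H all of whose entries are q-th roots of unity satisfying H·H* = 11·I_11. -/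
open Matrix

lemma isPrimitiveRoot_stdAddChar_one (q : ℕ) [NeZero q] :
    IsPrimitiveRoot (ZMod.stdAddChar (1 : ZMod q)) q := by
  have h := Complex.isPrimitiveRoot_exp q (NeZero.ne q)
  have h1 := ZMod.stdAddChar_coe (N := q) 1
  simp only [Int.cast_one, mul_one] at h1
  rwa [h1]

lemma stdAddChar_eq_pow {q : ℕ} [NeZero q] (a : ZMod q) :
    ZMod.stdAddChar a = ZMod.stdAddChar (1 : ZMod q) ^ a.val := by
  rw [← AddChar.map_nsmul_eq_pow, nsmul_one, ZMod.natCast_zmod_val]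

lemma exists_stdAddChar_eq {q : ℕ} [NeZero q] {z : ℂ} (hz : z ^ q = 1) :
    ∃ a : ZMod q, z = ZMod.stdAddChar a := by
  obtain ⟨i, hi, rfl⟩ := (isPrimitiveRoot_stdAddChar_one q).eq_pow_of_pow_eq_one hz
  exact ⟨i, by rw [stdAddChar_eq_pow (i : ZMod q), ZMod.val_cast_of_lt hi]⟩

lemma stdAddChar_mul_star {q : ℕ} [NeZero q] (a b : ZMod q) :
    ZMod.stdAddChar a * star (ZMod.stdAddChar b) = ZMod.stdAddChar (a - b) := by
  rw [sub_eq_add_neg, AddChar.map_add_eq_mul, AddChar.map_neg_eq_conj]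
  rfl

lemma IsButson.sum_mul_star {m : Type*} [Fintype m] [DecidableEq m] {q : ℕ} {H : Matrix m m ℂ}
    (hH : IsButson q H) {i j : m} (hij : i ≠ j) : ∑ k, H i k * star (H j k) = 0 := by
  have h := congrFun (congrFun hH.2 i) j
  simpa [Matrix.mul_apply, hij] using h

/-- The exponents of `X` in `f` collected with multiplicity form a multiple of the cyclotomic
polynomial as soon as the corresponding sum of roots of unity vanishes. -/
lemma cyclotomic_dvd_of_sum_eq_zero {q : ℕ} [NeZero q] {ι : Type*} (s : Finset ι) (c : ι → ℤ)
    (a : ι → ZMod q) (h : ∑ k ∈ s, (c k : ℂ) * ZMod.stdAddChar (a k) = 0) :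
    Polynomial.cyclotomic q ℤ ∣ ∑ k ∈ s, Polynomial.C (c k) * Polynomial.X ^ (a k).val := by
  have hζ := isPrimitiveRoot_stdAddChar_one q
  rw [Polynomial.cyclotomic_eq_minpoly hζ (NeZero.pos q)]
  refine minpoly.isIntegrallyClosed_dvd (hζ.isIntegral (NeZero.pos q)) ?_
  simpa [← stdAddChar_eq_pow] using h

lemma eq_of_sum_stdAddChar_eq_zero {p : ℕ} [Fact p.Prime] {W : ZMod p → ℤ}
    (h : ∑ s, (W s : ℂ) * ZMod.stdAddChar s = 0) : ∃ t, ∀ s, W s = t := by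
  obtain ⟨R, hR⟩ := cyclotomic_dvd_of_sum_eq_zero Finset.univ W id h
  simp only [id] at hR
  have hp : p.Prime := Fact.out
  have hcoeff (s : ZMod p) : (∑ k : ZMod p, Polynomial.C (W k) * Polynomial.X ^ k.val).coeff s.val =
      W s := by
    simp only [Polynomial.finsetSum_coeff, Polynomial.coeff_C_mul_X_pow]
    simp [ZMod.val_injective p |>.eq_iff]
  have hdeg : (∑ k : ZMod p, Polynomial.C (W k) * Polynomial.X ^ k.val).natDegree ≤ p - 1 := by
    refine Polynomial.natDegree_sum_le_of_forall_le _ _ fun k _ => ?_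
    refine (Polynomial.natDegree_C_mul_X_pow_le _ _).trans ?_
    have := ZMod.val_lt k
    omega
  have hR0 : R.natDegree = 0 := by
    rcases eq_or_ne R 0 with rfl | hne
    · simp
    · rw [hR, Polynomial.natDegree_mul (Polynomial.cyclotomic_ne_zero p ℤ) hne,
        Polynomial.natDegree_cyclotomic, Nat.totient_prime hp] at hdeg
      omega
  refine ⟨R.coeff 0, fun s => ?_⟩
  rw [← hcoeff s, hR, Polynomial.eq_C_of_natDegree_eq_zero hR0, Polynomial.coeff_mul_C,
    Polynomial.cyclotomic_prime]
  simp [Polynomial.coeff_X_pow, ZMod.val_lt s]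

/-- The condition on the exponents of a normalised `BH(11, 14)` matrix: the differences of any
two rows take every value once, except for two additional occurrences of each of `-e j i` and
`e i j`. -/
def IsBalanced (e : Fin 11 → Fin 11 → ZMod 7) : Prop :=
  ∀ i j, i ≠ j → ∀ s, Finset.card {k | e i k - e j k = s} =
    1 + (if s = -e j i then 2 else 0) + (if s = e i j then 2 else 0)

/-- The entry of a list at a given index, `0` past the end, by structural recursion so that the
kernel evaluates it quickly. -/
noncomputable def nth (l : List ℕ) : ℕ → ℕ :=
  List.rec (fun _ => 0) (fun a _ ih n => Nat.rec a (fun m _ => ih m) n) l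

/-- Continuation-passing depth-first search for lists of labels, one from each column, whose weights
may be subtracted from a guarded remainder in base `128` without any digit becoming negative. The
guard `∑ i < 28, 64 * 128 ^ i` detects an underflow. The result is `true` if every list found is
accepted by the continuation. -/
noncomputable def guardedSearch (cols : List (List (ℕ × ℕ))) : ℕ → (List ℕ → Bool) → Bool :=
  List.rec (fun _ k => k [])
    (fun col _ ih rem k => List.rec true (fun c _ ih2 =>
      Bool.rec ih2 (Bool.rec false ih2 (ih (Nat.sub rem c.2) (fun l => k (c.1 :: l))))
       (Nat.beq (Nat.land (Nat.sub rem c.2)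
          50612221866424890568250774561926381181801669095521034182720)
          50612221866424890568250774561926381181801669095521034182720)) col) cols

/-- The differences `s - e` in `ZMod 7` for `e` in the list, each recorded as a digit in base `128`,
with seven digits for each `e`. -/
noncomputable def weight (es : List ℕ) (s : ℕ) : ℕ :=
  List.rec 0 (fun e _ r =>
    Nat.add (Nat.pow 128 (Nat.mod (Nat.sub (Nat.add s 7) e) 7)) (Nat.mul 562949953421312 r)) es

/-- The admissible entries in column `k` of row `i` with first entry `u`, given the previous rows in
reverse order. -/
noncomputable def choices (i : ℕ) (prevs : List (List ℕ)) (u k : ℕ) : List ℕ :=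
  bif Nat.beq k i then [0] else
  bif Nat.blt k i then
    [(nth (prevs.getD (i - 1 - k) []) i + u + 7 - nth (prevs.getD (i - 1 - k) []) 0) % 7]
  else [0, 1, 2, 3, 4, 5, 6]

/-- The prescribed numbers of occurrences of the differences of row `i`, with first entry `u`, and
each of the previous rows, in the encoding of `weight`. -/
noncomputable def target (i u : ℕ) (prevs : List (List ℕ)) : ℕ :=
  prevs.foldr (fun e r => (4432676798593 + 2 * 128 ^ ((7 - nth e i) % 7) +
    2 * 128 ^ ((nth e i + u + 7 - nth e 0) % 7)) + 562949953421312 * r) 0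

/-- Search for all possible rows `i` extending the previous rows. -/
noncomputable def rowSearch (i : ℕ) (prevs : List (List ℕ)) (k : List ℕ → Bool) : Bool :=
  [0, 1, 2, 3, 4, 5, 6].all fun u =>
    guardedSearch ((List.range 11).map fun j =>
        (choices i prevs u j).map fun s => (s, weight (prevs.map (nth · j)) s))
      (50612221866424890568250774561926381181801669095521034182720 + target i u prevs) k

/-- A row is weakly increasing along each of the given pairs of columns. -/
noncomputable def isSortedAt (ps : List (ℕ × ℕ)) (r : List ℕ) : Bool :=
  ps.all fun p => Nat.ble (nth r p.1) (nth r p.2)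

/-- Rows `z` and `t` cannot be extended to five rows, if row `2` is sorted at the given pairs. -/
noncomputable def noExtension (ps : List (ℕ × ℕ)) (z t : List ℕ) : Bool :=
  rowSearch 2 [t, z] fun r => !(isSortedAt ps r) ||
    rowSearch 3 [r, t, z] fun r' => rowSearch 4 [r', r, t, z] fun _ => false

/-- `x` is a sum of at most `m` powers `128 ^ i` with `i < n`. -/
def PowSum (n m x : ℕ) : Prop :=
  ∃ l : List ℕ, (∀ i ∈ l, i < n) ∧ l.length ≤ m ∧ x = (l.map (128 ^ ·)).sum

lemma PowSum.add {n m m' x y : ℕ} (hx : PowSum n m x) (hy : PowSum n m' y) :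
    PowSum n (m + m') (x + y) := by
  obtain ⟨l, hl, hm, rfl⟩ := hx
  obtain ⟨l', hl', hm', rfl⟩ := hy
  refine ⟨l ++ l', fun i hi => ?_, by simp; omega, by simp⟩
  rcases List.mem_append.1 hi with h | h
  exacts [hl i h, hl' i h]

lemma PowSum.mono {n n' m m' x : ℕ} (hx : PowSum n m x) (hn : n ≤ n') (hm : m ≤ m') :
    PowSum n' m' x := by
  obtain ⟨l, hl, h, rfl⟩ := hx
  exact ⟨l, fun i hi => (hl i hi).trans_le hn, h.trans hm, rfl⟩

lemma powSum_list_sum {n m : ℕ} {l : List ℕ} (h : ∀ x ∈ l, PowSum n m x) :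
    PowSum n (l.length * m) l.sum := by
  induction l with
  | nil => exact ⟨[], by simp, by simp, by simp⟩
  | cons a l ih =>
    have := (h a (by simp)).add (ih fun x hx => h x (by simp [hx]))
    simpa [Nat.succ_mul, add_comm] using this

lemma land_guard_digit (a x y : ℕ) (ha : a < 64) :
    Nat.land (64 + a + 128 * x) (64 + 128 * y) = 64 + 128 * Nat.land x y := by
  change (64 + a + 128 * x) &&& (64 + 128 * y) = 64 + 128 * (x &&& y)
  have h1 := Nat.and_div_two_pow (a := 64 + a + 128 * x) (b := 64 + 128 * y) (n := 7)
  have h2 := Nat.and_mod_two_pow (a := 64 + a + 128 * x) (b := 64 + 128 * y) (n := 7)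
  have e1 : (64 + a + 128 * x) / 2 ^ 7 = x := by omega
  have e2 : (64 + 128 * y) / 2 ^ 7 = y := by omega
  have e3 : (64 + a + 128 * x) % 2 ^ 7 = 64 + a := by omega
  have e4 : (64 + 128 * y) % 2 ^ 7 = 64 := by omega
  rw [e1, e2] at h1
  rw [e3, e4] at h2
  have h3 : (64 + a) &&& 64 = 64 := by interval_cases a <;> rfl
  rw [h3] at h2
  omega

lemma land_guard (n : ℕ) (f : ℕ → ℕ) (hf : ∀ i, f i < 64) :
    Nat.land (∑ i ∈ Finset.range n, (64 + f i) * 128 ^ i) (∑ i ∈ Finset.range n, 64 * 128 ^ i) =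
      ∑ i ∈ Finset.range n, 64 * 128 ^ i := by
  induction n generalizing f with
  | zero => simp only [Finset.range_zero, Finset.sum_empty]; rfl
  | succ n ih =>
    have h (g : ℕ → ℕ) : ∑ i ∈ Finset.range (n + 1), g i * 128 ^ i =
        g 0 + 128 * ∑ i ∈ Finset.range n, g (i + 1) * 128 ^ i := by
      rw [Finset.sum_range_succ', Finset.mul_sum, add_comm, pow_zero, mul_one]
      congr 1
      exact Finset.sum_congr rfl fun i _ => by ring
    rw [h (fun i => 64 + f i), h (fun _ => 64), land_guard_digit _ _ _ (hf 0),
      ih (fun i => f (i + 1)) fun i => hf _]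

lemma PowSum.land_guard {m x : ℕ} (hx : PowSum 28 m x) (hm : m < 64) :
    Nat.land (50612221866424890568250774561926381181801669095521034182720 + x)
      50612221866424890568250774561926381181801669095521034182720 =
      50612221866424890568250774561926381181801669095521034182720 := by
  obtain ⟨l, hl, hlm, rfl⟩ := hx
  have key := _root_.land_guard 28 (fun i => l.count i)
    fun i => (l.count_le_length).trans_lt (by omega)
  have hsum : (l.map (128 ^ ·)).sum = ∑ i ∈ Finset.range 28, l.count i * 128 ^ i := by
    rw [Finset.sum_list_map_count]
    simp only [smul_eq_mul]
    refine Finset.sum_subset (fun i hi => by simpa using hl i (by simpa using hi)) fun i _ hi => ?_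
    rw [List.count_eq_zero_of_not_mem (by simpa using hi), zero_mul]
  have hg : ∑ i ∈ Finset.range 28, 64 * 128 ^ i =
      50612221866424890568250774561926381181801669095521034182720 := by decide +kernel
  simp only [add_mul, Finset.sum_add_distrib, hg] at key
  rwa [hsum]

lemma guardedSearch_sound {m : ℕ} {w : List (ℕ × ℕ)} {cols : List (List (ℕ × ℕ))}
    (hw : List.Forall₂ (· ∈ ·) w cols) (hp : ∀ c ∈ w, PowSum 28 m c.2)
    (hm : w.length * m < 64) {k : List ℕ → Bool}
    (h : guardedSearch cols
      (50612221866424890568250774561926381181801669095521034182720 + (w.map Prod.snd).sum) k) :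
    k (w.map Prod.fst) := by
  induction hw generalizing k with
  | nil => exact h
  | @cons c col w cols hc hw ih =>
    have hrem : Nat.sub (50612221866424890568250774561926381181801669095521034182720 +
        ((c :: w).map Prod.snd).sum) c.2 =
        50612221866424890568250774561926381181801669095521034182720 + (w.map Prod.snd).sum := by
      rw [Nat.sub_eq]
      simp only [List.map_cons, List.sum_cons]
      omega
    have hland := PowSum.land_guard (powSum_list_sum (l := w.map Prod.snd) (m := m) (n := 28)
      (by simpa using fun x y hy => hp (y, x) (by simp [hy]))) (by simp at hm ⊢; nlinarith)
    refine ih (k := fun l => k (c.1 :: l)) (fun c hc => hp c (by simp [hc]))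
      (by simp at hm; nlinarith) ?_
    rw [← hrem] at hland ⊢
    generalize 50612221866424890568250774561926381181801669095521034182720 +
        ((c :: w).map Prod.snd).sum = rem at h hland ⊢
    unfold guardedSearch at h
    dsimp only at h
    clear ih hrem hp hm hw
    induction col with
    | nil => simp at hc
    | cons d col ih =>
      dsimp only at h
      rcases List.mem_cons.1 hc with rfl | hc
      · rw [hland] at h
        unfold guardedSearch
        revert h
        rw [show Nat.beq 50612221866424890568250774561926381181801669095521034182720
          50612221866424890568250774561926381181801669095521034182720 = true from rfl]
        dsimp only
        cases List.rec (motive := fun _ => ℕ → (List ℕ → Bool) → Bool) _ _ cols (rem.sub c.2) _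
        · simp
        · simp
      · refine ih hc ?_
        revert h
        cases Nat.beq
          ((rem.sub d.2).land 50612221866424890568250774561926381181801669095521034182720)
          50612221866424890568250774561926381181801669095521034182720
        · exact id
        · dsimp only
          cases List.rec (motive := fun _ => ℕ → (List ℕ → Bool) → Bool) _ _ cols (rem.sub d.2) _
          · simp
          · exact id

lemma IsBalanced.sum_comp {M : Type*} [AddCommMonoid M] {e : Fin 11 → Fin 11 → ZMod 7}
    (he : IsBalanced e) {i j : Fin 11} (hij : i ≠ j) (f : ZMod 7 → M) :
    ∑ k, f (e i k - e j k) = ∑ s, f s + 2 • f (-e j i) + 2 • f (e i j) := by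
  rw [← Finset.sum_fiberwise_of_maps_to (s := Finset.univ) (t := Finset.univ)
    (g := fun k => e i k - e j k) fun _ _ => Finset.mem_univ _]
  have (s : ZMod 7) : ∑ k with e i k - e j k = s, f (e i k - e j k) =
      f s + (if s = -e j i then 2 • f s else 0) + (if s = e i j then 2 • f s else 0) := by
    rw [Finset.sum_congr rfl (g := fun _ => f s) fun k hk => by rw [(Finset.mem_filter.1 hk).2],
      Finset.sum_const, he i j hij s]
    split_ifs <;> simp only [add_smul, one_smul, zero_smul]
  simp [this, Finset.sum_add_distrib]

lemma IsBalanced.sub_eq {e : Fin 11 → Fin 11 → ZMod 7} (he : IsBalanced e)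
    (h0 : ∀ j, e 0 j = 0) (i j : Fin 11) :
    e i j - e j i = e i 0 - e j 0 := by
  have hR (i j : Fin 11) : ∑ k, e i k - ∑ k, e j k = 2 * (e i j - e j i) := by
    rcases eq_or_ne i j with rfl | hij
    · simp
    · have := he.sum_comp hij id
      have hz : ∑ s : ZMod 7, id s = 0 := by decide
      rw [hz] at this
      simp only [id, Finset.sum_sub_distrib] at this
      rw [this]
      simp only [nsmul_eq_mul, Nat.cast_ofNat]
      ring
  have h1 := hR i j
  have h2 := hR i 0
  have h3 := hR j 0
  have h4 : ∑ k, e 0 k = 0 := by simp [h0]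
  rw [h4, h0] at h2 h3
  have h : (2 : ZMod 7) * (e i j - e j i) = 2 * (e i 0 - e j 0) := by
    linear_combination -h1 + h2 - h3
  have h' : ∀ x y : ZMod 7, 2 * x = 2 * y → x = y := by decide
  exact h' _ _ h

lemma nth_eq_getD (l : List ℕ) (n : ℕ) : nth l n = l.getD n 0 := by
  induction l generalizing n with
  | nil => rfl
  | cons a l ih =>
    cases n with
    | zero => rfl
    | succ n => exact ih n

/-- A row of an exponent matrix as a list of natural numbers. -/
def rowList (e : Fin 11 → ZMod 7) : List ℕ := (List.finRange 11).map fun k => (e k).val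

lemma nth_rowList (e : Fin 11 → ZMod 7) (k : Fin 11) : nth (rowList e) k = (e k).val := by
  simp [nth_eq_getD, rowList]

lemma weight_cons (a : ℕ) (es : List ℕ) (s : ℕ) :
    weight (a :: es) s = 128 ^ ((s + 7 - a) % 7) + 562949953421312 * weight es s := rfl

lemma powSum_weight (es : List ℕ) (s : ℕ) : PowSum (7 * es.length) es.length (weight es s) := by
  induction es with
  | nil => exact ⟨[], by simp, by simp, rfl⟩
  | cons a es ih =>
    obtain ⟨l, hl, hlen, hw⟩ := ih
    refine ⟨(s + 7 - a) % 7 :: l.map (7 + ·), ?_, by simpa using hlen, ?_⟩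
    · simp only [List.mem_cons, List.mem_map, List.length_cons]
      rintro i (rfl | ⟨k, hk, rfl⟩)
      · omega
      · have := hl k hk
        omega
    · rw [weight_cons, hw]
      simp only [List.map_cons, List.sum_cons, List.map_map, Function.comp_def, pow_add]
      rw [List.sum_map_mul_left]
      norm_num

lemma val_sub_eq (x y : ZMod 7) : (x.val + 7 - y.val) % 7 = (x - y).val := by
  revert x y; decide

lemma IsBalanced.sum_weight {e : Fin 11 → Fin 11 → ZMod 7} (he : IsBalanced e)
    (h0 : ∀ j, e 0 j = 0) (i : Fin 11) (js : List (Fin 11)) (hjs : ∀ j ∈ js, i ≠ j) :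
    ∑ k : Fin 11, weight ((js.map fun j => rowList (e j)).map (nth · k)) (e i k).val =
      target i (e i 0).val (js.map fun j => rowList (e j)) := by
  induction js with
  | nil => simp [weight, target]
  | cons j js ih =>
    simp only [List.map_cons, weight_cons, target, List.foldr_cons, Finset.sum_add_distrib,
      ← Finset.mul_sum, nth_rowList]
    rw [ih fun j hj => hjs j (by simp [hj])]
    have h := he.sum_comp (hjs j (by simp)) fun s => 128 ^ s.val
    simp only [val_sub_eq] at h ⊢
    rw [h]
    have h1 : ∑ s : ZMod 7, 128 ^ s.val = 4432676798593 := by decide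
    have h2 : (7 - (e j i).val) % 7 = (-e j i).val := by
      rw [← zero_sub, ← val_sub_eq]; simp
    have h3 : ((e j i).val + (e i 0).val + 7 - nth (rowList (e j)) 0) % 7 =
        (e i j).val := by
      have := nth_rowList (e j) 0
      simp only [Fin.val_zero] at this
      rw [this, show e i j = e j i + e i 0 - e j 0 by
        linear_combination he.sub_eq h0 i j]
      generalize e j i = a, e i 0 = b, e j 0 = c
      revert a b c
      decide
    rw [h1, h2, h3]
    rfl

lemma rowSearch_sound {e : Fin 11 → Fin 11 → ZMod 7} (he : IsBalanced e)
    (hd : ∀ i, e i i = 0) (h0 : ∀ j, e 0 j = 0) (i : Fin 11) (js : List (Fin 11))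
    (hjs : ∀ j ∈ js, i ≠ j) (hlen : js.length ≤ 4)
    (hget : ∀ k < i, (js.map fun j => rowList (e j)).getD (i - 1 - k) [] = rowList (e k))
    {f : List ℕ → Bool} (h : rowSearch i (js.map fun j => rowList (e j)) f) :
    f (rowList (e i)) := by
  set prevs := js.map fun j => rowList (e j) with hprevs
  have hmem (x : ZMod 7) : x.val ∈ [0, 1, 2, 3, 4, 5, 6] := by revert x; decide
  have h1 := List.all_eq_true.1 h _ (hmem (e i 0))
  have hrange : List.range 11 = (List.finRange 11).map Fin.val := by decide
  rw [← he.sum_weight h0 i js hjs, ← hprevs] at h1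
  set w := (List.finRange 11).map fun k : Fin 11 =>
    ((e i k).val, weight (prevs.map (nth · k)) (e i k).val) with hw
  have hsum : ∑ k : Fin 11, weight (prevs.map (nth · k)) (e i k).val = (w.map Prod.snd).sum := by
    rw [hw, List.map_map, Fin.sum_univ_def]; rfl
  have hfst : w.map Prod.fst = rowList (e i) := by
    rw [hw, List.map_map]; rfl
  rw [hsum] at h1
  rw [← hfst]
  refine guardedSearch_sound (m := 4) ?_ ?_ ?_ h1
  · rw [hrange, List.map_map, hw, List.forall₂_map_left_iff, List.forall₂_map_right_iff,
      List.forall₂_same]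
    intro k _
    refine List.mem_map.2 ⟨_, ?_, rfl⟩
    unfold choices
    rcases lt_trichotomy k i with hk | rfl | hk
    · rw [show Nat.beq k i = false from
          Bool.eq_false_iff.2 fun h => hk.ne (Fin.ext (Nat.eq_of_beq_eq_true h)),
        show Nat.blt k i = true by simpa using hk,
        hget k hk, nth_rowList]
      have := nth_rowList (e k) 0
      simp only [Fin.val_zero] at this
      rw [this, cond_false, cond_true, List.mem_singleton, show e i k = e k i + e i 0 - e k 0 by
        linear_combination he.sub_eq h0 i k]
      generalize e k i = a, e i 0 = b, e k 0 = c
      revert a b c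
      decide
    · simp [hd]
    · rw [show Nat.beq k i = false from
          Bool.eq_false_iff.2 fun h => hk.ne' (Fin.ext (Nat.eq_of_beq_eq_true h)),
        show Nat.blt k i = false from
          Bool.eq_false_iff.2 fun h => hk.not_gt (Nat.le_of_ble_eq_true h)]
      exact hmem _
  · intro c hc
    obtain ⟨k, -, rfl⟩ := List.mem_map.1 hc
    refine (powSum_weight _ _).mono ?_ ?_ <;> simp [hprevs] <;> omega
  · simp [hw]

lemma noExtension_sound {e : Fin 11 → Fin 11 → ZMod 7} (he : IsBalanced e)
    (hd : ∀ i, e i i = 0) (h0 : ∀ j, e 0 j = 0) {ps : List (ℕ × ℕ)}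
    (hps : isSortedAt ps (rowList (e 2)) = true)
    (h : noExtension ps (rowList (e 0)) (rowList (e 1)) = true) : False := by
  have h2 := rowSearch_sound he hd h0 2 [1, 0] (by decide) (by decide)
    (by intro k hk; fin_cases k <;> first | rfl | exact absurd hk (by decide)) h
  rw [hps, Bool.not_true, Bool.false_or] at h2
  have h3 := rowSearch_sound he hd h0 3 [2, 1, 0] (by decide) (by decide)
    (by intro k hk; fin_cases k <;> first | rfl | exact absurd hk (by decide)) h2
  have h4 := rowSearch_sound he hd h0 4 [3, 2, 1, 0] (by decide) (by decide)
    (by intro k hk; fin_cases k <;> first | rfl | exact absurd hk (by decide)) h3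
  exact absurd h4 (by simp)

lemma IsBalanced.relabel {e : Fin 11 → Fin 11 → ZMod 7} (he : IsBalanced e)
    (σ : Equiv.Perm (Fin 11)) : IsBalanced fun i j => e (σ i) (σ j) := by
  intro i j hij s
  rw [← he (σ i) (σ j) (σ.injective.ne hij) s]
  exact Finset.card_equiv σ (by simp)

lemma IsBalanced.mul_left {e : Fin 11 → Fin 11 → ZMod 7} (he : IsBalanced e) {u v : ZMod 7}
    (huv : u * v = 1) : IsBalanced fun i j => u * e i j := by
  intro i j hij s
  have h (x y : ZMod 7) : y = u * x ↔ v * y = x := by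
    constructor <;> rintro rfl
    · linear_combination x * huv
    · linear_combination -y * huv
  have h' (x y : ZMod 7) : u * x = y ↔ x = v * y := by
    rw [eq_comm, h, eq_comm]
  simp only [← mul_sub, ← mul_neg, h, h']
  exact he i j hij (v * s)

lemma exists_perm_comp_eq {α β : Type*} [Fintype α] [DecidableEq α] [DecidableEq β] {f g : α → β}
    (h : ∀ s, Finset.card {k | f k = s} = Finset.card {k | g k = s}) {a b : α} (hab : a ≠ b)
    (ha : f a = g a) (hb : f b = g b) :
    ∃ σ : Equiv.Perm α, σ a = a ∧ σ b = b ∧ ∀ k, f (σ k) = g k := by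
  obtain ⟨σ, hσ⟩ : ∃ σ : Equiv.Perm α, ∀ k, f (σ k) = g k := by
    have (s : β) : {k // g k = s} ≃ {k // f k = s} :=
      Fintype.equivOfCardEq (by rw [Fintype.card_subtype, Fintype.card_subtype, h])
    refine ⟨Equiv.ofFiberEquiv this, fun k => Equiv.ofFiberEquiv_map _ _⟩
  have hswap {x y : α} (hxy : f x = f y) (k : α) : f (Equiv.swap x y k) = f k := by
    rw [Equiv.swap_apply_def]
    split_ifs with h1 h2
    · rw [h1, hxy]
    · rw [h2, hxy]
    · rfl
  set τ := σ.trans (Equiv.swap (σ a) a) with hτ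
  have hτf (k) : f (τ k) = g k := by rw [← hσ k]; exact hswap (by rw [hσ, ha]) _
  have hτa : τ a = a := by simp [hτ]
  refine ⟨τ.trans (Equiv.swap (τ b) b), ?_, by simp, fun k => ?_⟩
  · rw [Equiv.trans_apply, hτa, Equiv.swap_apply_of_ne_of_ne _ hab]
    rw [← hτa]
    exact τ.injective.ne hab
  · rw [Equiv.trans_apply, hswap (by rw [hτf, hb]), hτf]

lemma IsBalanced.false_of_template {e : Fin 11 → Fin 11 → ZMod 7} (he : IsBalanced e)
    (hd : ∀ i, e i i = 0) (h0 : ∀ j, e 0 j = 0) (T : Fin 11 → ZMod 7) (hT0 : T 0 = e 1 0)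
    (hT1 : T 1 = 0) (hT : ∀ s, Finset.card {k | T k = s} =
      1 + (if s = 0 then 2 else 0) + (if s = e 1 0 then 2 else 0))
    (P : Fin 11 → ℕ) (hP : Monotone P) (hPT : ∀ k l, P k = P l → T k = T l)
    (hP3 : ∀ k ≤ 2, ∀ l, P l = P k → l = k) (ps : List (Fin 11 × Fin 11))
    (hps : ∀ p ∈ ps, p.1 ≤ p.2 ∧ P p.1 = P p.2)
    (h : noExtension (ps.map fun p => (p.1.val, p.2.val)) (rowList 0) (rowList T) = true) :
    False := by
  obtain ⟨σ, hσ0, hσ1, hσ⟩ := exists_perm_comp_eq (f := e 1) (g := T) (a := 0) (b := 1)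
    (fun s => by
      have := he 1 0 (by decide) s
      simp only [h0, sub_zero, neg_zero] at this
      rw [this, hT]) (by decide) hT0.symm (by rw [hd, hT1])
  set e' : Fin 11 → Fin 11 → ZMod 7 := fun i j => e (σ i) (σ j) with he'
  set κ : Fin 11 → ℕ := fun k => 7 * P k + (e' 2 k).val with hκ
  set τ := Tuple.sort κ with hτ
  have hκτ : Monotone (κ ∘ τ) := Tuple.monotone_sort κ
  have hPκ (k) : P k = κ k / 7 := by
    have := ZMod.val_lt (e' 2 k)
    simp only [hκ]
    omega
  have hPτ : P ∘ τ = P := by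
    have h1 : Monotone (P ∘ τ) := fun a b hab => by
      simp only [Function.comp_apply, hPκ]
      exact Nat.div_le_div_right (hκτ hab)
    have h2 := Tuple.comp_sort_eq_comp_iff_monotone.2 h1
    rwa [Tuple.sort_eq_refl_iff_monotone.2 hP] at h2
  have hfix (k : Fin 11) (hk : k ≤ 2) : τ k = k := hP3 k hk _ (congrFun hPτ k)
  have h0' : (fun j => e' (τ 0) (τ j)) = 0 := by
    funext j
    simp [hfix 0 (by decide), he', hσ0, h0]
  have h1' : (fun j => e' (τ 1) (τ j)) = T := by
    funext j
    simp only [hfix 1 (by decide), he', hσ1, hσ]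
    exact hPT _ _ (congrFun hPτ j)
  refine noExtension_sound ((he.relabel σ).relabel τ) (fun i => hd _)
    (fun j => congrFun h0' j) (ps := ps.map fun p => (p.1.val, p.2.val)) ?_
    (by rw [h0', h1']; exact h)
  unfold isSortedAt
  rw [List.all_eq_true]
  intro p hp
  obtain ⟨⟨a, b⟩, hab, rfl⟩ := List.mem_map.1 hp
  obtain ⟨h1, h2⟩ := hps _ hab
  have h3 := hκτ h1
  have ha := congrFun hPτ a
  have hb := congrFun hPτ b
  simp only [Function.comp_apply, hκ] at h3 ha hb
  dsimp only at h2
  rw [ha, hb, h2] at h3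
  dsimp only
  rw [nth_rowList, nth_rowList, hfix 2 le_rfl]
  have h4 : (e' 2 (τ a)).val ≤ (e' 2 (τ b)).val := by omega
  exact Nat.ble_eq_true_of_le h4

set_option maxRecDepth 100000 in
lemma noExtension_zero :
    noExtension [(5, 6), (6, 7)] (rowList 0) (rowList ![0, 0, 3, 2, 4, 0, 0, 0, 1, 5, 6]) =
      true := by
  have h1 : rowList 0 = [0, 0, 0, 0, 0, 0, 0, 0, 0, 0, 0] := by decide
  have h2 : rowList ![0, 0, 3, 2, 4, 0, 0, 0, 1, 5, 6] = [0, 0, 3, 2, 4, 0, 0, 0, 1, 5, 6] := by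
    decide
  rw [h1, h2]
  decide +kernel

set_option maxRecDepth 100000 in
lemma noExtension_one :
    noExtension [(5, 6), (7, 8)] (rowList 0) (rowList ![1, 0, 3, 6, 5, 0, 0, 1, 1, 2, 4]) =
      true := by
  have h1 : rowList 0 = [0, 0, 0, 0, 0, 0, 0, 0, 0, 0, 0] := by decide
  have h2 : rowList ![1, 0, 3, 6, 5, 0, 0, 1, 1, 2, 4] = [1, 0, 3, 6, 5, 0, 0, 1, 1, 2, 4] := by
    decide
  rw [h1, h2]
  decide +kernel

lemma not_isBalanced {e : Fin 11 → Fin 11 → ZMod 7} (hd : ∀ i, e i i = 0) (h0 : ∀ j, e 0 j = 0) :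
    ¬ IsBalanced e := by
  intro he
  obtain ⟨u, v, huv, hu⟩ : ∃ u v : ZMod 7, u * v = 1 ∧ (u * e 1 0 = 0 ∨ u * e 1 0 = 1) := by
    generalize e 1 0 = c
    revert c
    decide
  have he' := he.mul_left huv
  have hd' (i : Fin 11) : u * e i i = 0 := by rw [hd, mul_zero]
  have h0' (j : Fin 11) : u * e 0 j = 0 := by rw [h0, mul_zero]
  rcases hu with hu | hu
  · refine he'.false_of_template hd' h0' ![0, 0, 3, 2, 4, 0, 0, 0, 1, 5, 6] (by rw [hu]; rfl) rfl
      (by rw [hu]; decide +kernel) ![0, 1, 2, 3, 4, 5, 5, 5, 6, 7, 8] (by decide)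
      (by decide) (by decide)
      [(5, 6), (6, 7)] (by decide +kernel) noExtension_zero
  · refine he'.false_of_template hd' h0' ![1, 0, 3, 6, 5, 0, 0, 1, 1, 2, 4] (by rw [hu]; rfl) rfl
      (by rw [hu]; decide +kernel) ![0, 1, 2, 3, 4, 5, 5, 6, 6, 7, 8] (by decide)
      (by decide) (by decide)
      [(5, 6), (7, 8)] (by decide +kernel) noExtension_one

lemma exists_sign_mul_stdAddChar {p : ℕ} [NeZero p] (hp : Odd p) {z : ℂ} (hz : z ^ (2 * p) = 1) :
    ∃ (σ : ℤ) (a : ZMod p), (σ = 1 ∨ σ = -1) ∧ z = σ * ZMod.stdAddChar a := by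
  rw [mul_comm, pow_mul, sq_eq_one_iff] at hz
  rcases hz with h | h
  · obtain ⟨a, ha⟩ := exists_stdAddChar_eq h
    exact ⟨1, a, by simp, by simp [ha]⟩
  · obtain ⟨a, ha⟩ := exists_stdAddChar_eq (z := -z) (q := p) (by rw [hp.neg_pow, h, neg_neg])
    exact ⟨-1, a, by simp, by simp [← ha]⟩

lemma sq_eq_one_of_sign {x : ℤ} (h : x = 1 ∨ x = -1) : x * x = 1 := by
  rcases h with rfl | rfl <;> rfl

/-- For an odd prime `p ≥ 5`, a `BH(11, 2p)` matrix splits into a sign matrix and a matrix of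
exponents modulo `p`. -/
lemma IsButson.exists_sign_exponent {p : ℕ} [Fact p.Prime] (hp : 5 ≤ p)
    {H : Matrix (Fin 11) (Fin 11) ℂ} (hH : IsButson (2 * p) H) :
    ∃ (S : Fin 11 → Fin 11 → ℤ) (E : Fin 11 → Fin 11 → ZMod p) (t : Fin 11 → Fin 11 → ℤ),
      (∀ i j, S i j = 1 ∨ S i j = -1) ∧ (∀ i j, i ≠ j → t i j = 1 ∨ t i j = -1) ∧
      (∀ i j, i ≠ j → ∀ s, ∑ k, (if E i k - E j k = s then S i k * S j k else 0) = t i j) ∧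
      ∀ i j, i ≠ j → ∑ k, S i k * S j k = p * t i j := by
  have hodd : Odd p := (Fact.out : p.Prime).odd_of_ne_two (by omega)
  have hex (i j) := exists_sign_mul_stdAddChar hodd (hH.1 i j)
  choose S E hS hE using hex
  have key (i j : Fin 11) : ∃ t : ℤ, i ≠ j →
      ∀ s, ∑ k, (if E i k - E j k = s then S i k * S j k else 0) = t := by
    by_cases hij : i = j
    · exact ⟨0, fun h => absurd hij h⟩
    · obtain ⟨t, ht⟩ := eq_of_sum_stdAddChar_eq_zero
        (W := fun s => ∑ k, (if E i k - E j k = s then S i k * S j k else 0)) (by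
          have h := hH.sum_mul_star hij
          refine Eq.trans ?_ h
          push_cast
          simp only [Finset.sum_mul]
          rw [Finset.sum_comm]
          refine Finset.sum_congr rfl fun k _ => ?_
          simp only [ite_mul, Finset.sum_ite_eq, Finset.mem_univ, if_true,
            zero_mul]
          rw [← stdAddChar_mul_star, hE i k, hE j k, star_mul']
          simp only [star_intCast]
          ring)
      exact ⟨t, fun _ => ht⟩
  choose t ht using key
  have hsum (i j : Fin 11) (hij : i ≠ j) : ∑ k, S i k * S j k = p * t i j := by
    have h : ∑ s : ZMod p, ∑ k, (if E i k - E j k = s then S i k * S j k else 0) =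
        ∑ k, S i k * S j k := by
      rw [Finset.sum_comm]
      simp
    rw [← h, Finset.sum_congr rfl fun s _ => ht i j hij s]
    simp [ZMod.card]
  refine ⟨S, E, t, hS, fun i j hij => ?_, ht, hsum⟩
  have hterm (k : Fin 11) : ∃ b : ℤ, S i k * S j k = 1 - 2 * b ∧ 0 ≤ b ∧ b ≤ 1 := by
    rcases hS i k with h | h <;> rcases hS j k with h' | h' <;> rw [h, h']
    exacts [⟨0, by simp⟩, ⟨1, by simp⟩, ⟨1, by simp⟩, ⟨0, by simp⟩]
  choose b hb hb0 hb1 using hterm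
  have h1 := hsum i j hij
  simp only [hb, Finset.sum_sub_distrib, ← Finset.mul_sum] at h1
  have h2 : 0 ≤ ∑ k, b k := Finset.sum_nonneg fun k _ => hb0 k
  have h3 : ∑ k, b k ≤ 11 := (Finset.sum_le_sum fun k _ => hb1 k).trans (by simp)
  simp only [Finset.sum_const, Finset.card_univ, Fintype.card_fin, nsmul_eq_mul] at h1
  push_cast at h1
  have hlt : t i j < 3 := by nlinarith
  have hgt : -3 < t i j := by nlinarith
  have hpar : ¬ 2 ∣ t i j := by
    rintro ⟨c, hc⟩
    rw [hc, mul_left_comm] at h1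
    omega
  omega

lemma triple_mod_four {S : Fin 11 → Fin 11 → ℤ} (hS : ∀ i j, S i j = 1 ∨ S i j = -1)
    (i j l : Fin 11) :
    ∃ c : ℤ, ∑ k, S i k * S j k + ∑ k, S j k * S l k + ∑ k, S i k * S l k = 4 * c + 1 := by
  have hterm (k : Fin 11) : ∃ b : ℤ, S i k * S j k + S j k * S l k + S i k * S l k = 4 * b + 3 := by
    rcases hS i k with h | h <;> rcases hS j k with h' | h' <;> rcases hS l k with h'' | h'' <;>
      rw [h, h', h''] <;> first | exact ⟨0, rfl⟩ | exact ⟨-1, rfl⟩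
  choose b hb using hterm
  refine ⟨∑ k, b k + 8, ?_⟩
  simp only [← Finset.sum_add_distrib, hb]
  simp only [Finset.sum_add_distrib, ← Finset.mul_sum, Finset.sum_const, Finset.card_univ,
    Fintype.card_fin, nsmul_eq_mul]
  push_cast
  ring

lemma not_isButson_ten (H : Matrix (Fin 11) (Fin 11) ℂ) : ¬ IsButson 10 H := by
  intro hH
  have : Fact (Nat.Prime 5) := ⟨by norm_num⟩
  obtain ⟨S, E, t, hS, ht, -, hg⟩ := IsButson.exists_sign_exponent (p := 5) le_rfl hH
  push_cast at hg
  have htri (i j l : Fin 11) (hij : i ≠ j) (hjl : j ≠ l) (hil : i ≠ l) :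
      t i j * t i l * t j l = -1 := by
    obtain ⟨c, hc⟩ := triple_mod_four hS i j l
    rw [hg i j hij, hg j l hjl, hg i l hil] at hc
    rcases ht i j hij with h | h <;> rcases ht j l hjl with h' | h' <;>
      rcases ht i l hil with h'' | h'' <;> rw [h, h', h''] at hc ⊢ <;> first | rfl | omega
  have h0 : 0 ≤ ∑ k, (S 0 k - t 0 1 * S 1 k - t 0 2 * S 2 k - t 0 3 * S 3 k) ^ 2 :=
    Finset.sum_nonneg fun k _ => sq_nonneg _
  have hself (i : Fin 11) : ∑ k, S i k * S i k = 11 := by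
    simp [sq_eq_one_of_sign (hS i _)]
  have hexp : ∑ k, (S 0 k - t 0 1 * S 1 k - t 0 2 * S 2 k - t 0 3 * S 3 k) ^ 2 =
      ∑ k, S 0 k * S 0 k + t 0 1 * t 0 1 * ∑ k, S 1 k * S 1 k +
      t 0 2 * t 0 2 * ∑ k, S 2 k * S 2 k + t 0 3 * t 0 3 * ∑ k, S 3 k * S 3 k -
      2 * t 0 1 * ∑ k, S 0 k * S 1 k - 2 * t 0 2 * ∑ k, S 0 k * S 2 k -
      2 * t 0 3 * ∑ k, S 0 k * S 3 k + 2 * (t 0 1 * t 0 2) * ∑ k, S 1 k * S 2 k +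
      2 * (t 0 1 * t 0 3) * ∑ k, S 1 k * S 3 k + 2 * (t 0 2 * t 0 3) * ∑ k, S 2 k * S 3 k := by
    simp only [Finset.mul_sum, ← Finset.sum_add_distrib, ← Finset.sum_sub_distrib]
    exact Finset.sum_congr rfl fun k _ => by ring
  rw [hexp, hself, hself, hself, hself, hg 0 1 (by decide), hg 0 2 (by decide), hg 0 3 (by decide),
    hg 1 2 (by decide), hg 1 3 (by decide), hg 2 3 (by decide)] at h0
  have e1 := sq_eq_one_of_sign (ht 0 1 (by decide))
  have e2 := sq_eq_one_of_sign (ht 0 2 (by decide))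
  have e3 := sq_eq_one_of_sign (ht 0 3 (by decide))
  have e4 := htri 0 1 2 (by decide) (by decide) (by decide)
  have e5 := htri 0 1 3 (by decide) (by decide) (by decide)
  have e6 := htri 0 2 3 (by decide) (by decide) (by decide)
  linarith

/-- A unimodular matrix of order 11 whose rows have a common nonzero inner product has column sums
of constant modulus. -/
lemma colSum_mul_star {M : Matrix (Fin 11) (Fin 11) ℂ} {α β : ℂ} (hα : α ≠ 0) (hβ : β ≠ 0)
    (hαβ : α + β = 11) (hδ : α + 11 * β ≠ 0)
    (hM : ∀ i j, ∑ k, M i k * star (M j k) = if i = j then 11 else β)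
    (hu : ∀ i j, M i j * star (M i j) = 1) (k : Fin 11) :
    (∑ i, M i k) * star (∑ i, M i k) = α + 11 * β := by
  have hG : M * Mᴴ = α • (1 : Matrix (Fin 11) (Fin 11) ℂ) + β • Matrix.of fun _ _ => 1 := by
    ext i j
    simp only [Matrix.mul_apply, Matrix.conjTranspose_apply, hM, Matrix.add_apply,
      Matrix.smul_apply, Matrix.one_apply, Matrix.of_apply, smul_eq_mul]
    split_ifs
    · rw [← hαβ]; ring
    · ring
  set J : Matrix (Fin 11) (Fin 11) ℂ := Matrix.of fun _ _ => 1 with hJ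
  have hJJ : J * J = (11 : ℂ) • J := by
    ext i j
    simp [Matrix.mul_apply, hJ]
  obtain ⟨δ, hδ'⟩ : ∃ δ, δ = α + 11 * β := ⟨_, rfl⟩
  rw [← hδ'] at hδ ⊢
  set c := β / (α * δ) with hc
  set N : Matrix (Fin 11) (Fin 11) ℂ := α⁻¹ • (1 : Matrix (Fin 11) (Fin 11) ℂ) - c • J with hN
  have h1 : M * (Mᴴ * N) = 1 := by
    rw [← Matrix.mul_assoc, hG, hN]
    simp only [add_mul, mul_sub, Matrix.smul_mul, Matrix.mul_smul, hJJ, one_mul, mul_one, smul_smul]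
    have h : α⁻¹ * β - (c * α + c * (β * 11)) = 0 := by
      rw [show c * α + c * (β * 11) = c * δ by rw [hδ']; ring, hc]
      field_simp
      ring
    rw [inv_mul_cancel₀ hα, one_smul, add_sub_assoc, ← add_smul, ← sub_smul, h, zero_smul, add_zero]
  have h2 := congrFun (congrFun (show Mᴴ * N * M = 1 from mul_eq_one_comm.1 h1) k) k
  have h3 : (Mᴴ * N * M) k k = α⁻¹ * ∑ i, M i k * star (M i k) -
      c * ((∑ i, M i k) * star (∑ i, M i k)) := by
    rw [hN]
    simp only [mul_sub, sub_mul, Matrix.mul_smul, Matrix.smul_mul, mul_one, Matrix.sub_apply,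
      Matrix.smul_apply, smul_eq_mul]
    congr 2
    · simp [Matrix.mul_apply, mul_comm]
    · simp [Matrix.mul_apply, hJ, ← Finset.sum_mul, mul_comm]
  rw [h3] at h2
  simp only [hu, Matrix.one_apply_eq] at h2
  simp only [Finset.sum_const, Finset.card_univ, Fintype.card_fin, nsmul_eq_mul, mul_one] at h2
  push_cast at h2
  rw [hc] at h2
  field_simp at h2
  have h4 : β * ((∑ i, M i k) * star (∑ i, M i k)) = β * δ := by
    linear_combination -h2 - δ * hαβ
  exact mul_left_cancel₀ hβ h4

lemma exists_eq_of_sum_eq_nine {x : Fin 11 → ℤ} (hx : ∀ i, x i = 1 ∨ x i = -1)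
    (h : ∑ i, x i = 9) : ∃ a, ∀ i, x i = 1 - 2 * (if a = i then 1 else 0) := by
  obtain ⟨a, ha⟩ : ∃ a, x a = -1 := by
    by_contra! hne
    have h1 (i) : x i = 1 := (hx i).resolve_right (hne i)
    simp [h1] at h
  refine ⟨a, fun i => ?_⟩
  split_ifs with hai
  · rw [← hai, ha]; rfl
  · rw [mul_zero, sub_zero]
    refine (hx i).resolve_right fun hi => ?_
    have h1 := Finset.sum_le_sum (s := Finset.univ) (f := x)
      (g := fun k => 1 - (if k = a then 2 else 0) - (if k = i then 2 else 0)) fun k _ => by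
        by_cases hka : k = a
        · rw [hka, ha, if_pos rfl, if_neg hai]; norm_num
        · by_cases hki : k = i
          · rw [hki, hi, if_neg (Ne.symm hai), if_pos rfl]; norm_num
          · simp only [hka, hki, if_false]
            rcases hx k with h | h <;> rw [h] <;> norm_num
    rw [h] at h1
    simp at h1

lemma isBalanced_of_sign {E : Fin 11 → Fin 11 → ZMod 7} {S : Fin 11 → Fin 11 → ℤ}
    (hS : ∀ i k, S i k = 1 - 2 * (if k = i then 1 else 0))
    (hE : ∀ i j, i ≠ j → ∀ s, ∑ k, (if E i k - E j k = s then S i k * S j k else 0) = 1) :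
    IsBalanced fun i j => E i j - E 0 j - (E i i - E 0 i) := by
  intro i j hij s
  have h := hE i j hij (s + (E i i - E 0 i) - (E j j - E 0 j))
  set s' := s + (E i i - E 0 i) - (E j j - E 0 j) with hs'
  have hprod (k : Fin 11) : (if E i k - E j k = s' then S i k * S j k else 0) =
      (if E i k - E j k = s' then 1 else 0) -
      (if k = i then if E i i - E j i = s' then 2 else 0 else 0) -
      (if k = j then if E i j - E j j = s' then 2 else 0 else 0) := by
    rw [hS, hS]
    by_cases hki : k = i
    · subst hki
      simp only [if_true, if_neg hij]
      split_ifs <;> norm_num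
    · by_cases hkj : k = j
      · subst hkj
        simp only [if_true, if_neg hki]
        split_ifs <;> norm_num
      · simp only [if_neg hki, if_neg hkj]
        split_ifs <;> norm_num
  simp only [hprod, Finset.sum_sub_distrib, Finset.sum_ite_eq', Finset.mem_univ, if_true,
    Finset.sum_boole] at h
  have e1 (k : Fin 11) : (E i k - E 0 k - (E i i - E 0 i) - (E j k - E 0 k - (E j j - E 0 j)) = s) =
      (E i k - E j k = s') := by
    rw [hs']
    refine propext ⟨fun h => ?_, fun h => ?_⟩ <;> linear_combination h
  have e2 : (s = -(E j i - E 0 i - (E j j - E 0 j))) = (E i i - E j i = s') := by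
    rw [hs']
    refine propext ⟨fun h => ?_, fun h => ?_⟩ <;> linear_combination -h
  have e3 : (s = E i j - E 0 j - (E i i - E 0 i)) = (E i j - E j j = s') := by
    rw [hs']
    refine propext ⟨fun h => ?_, fun h => ?_⟩ <;> linear_combination -h
  simp only [e1, e2, e3]
  have : ((Finset.card {k | E i k - E j k = s'} : ℕ) : ℤ) =
      ((1 + (if E i i - E j i = s' then 2 else 0) +
        (if E i j - E j j = s' then 2 else 0) : ℕ) : ℤ) := by
    push_cast
    linear_combination h
  exact_mod_cast this

lemma false_of_colSum_eq_nine {E : Fin 11 → Fin 11 → ZMod 7} {S : Fin 11 → Fin 11 → ℤ}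
    (hS : ∀ i j, S i j = 1 ∨ S i j = -1)
    (hE : ∀ i j, i ≠ j → ∀ s, ∑ k, (if E i k - E j k = s then S i k * S j k else 0) = 1)
    (hg : ∀ i j, i ≠ j → ∑ k, S i k * S j k = 7) (hcol : ∀ k, ∑ i, S i k = 9) : False := by
  choose π hπ using fun k => exists_eq_of_sum_eq_nine (fun i => hS i k) (hcol k)
  set P : Fin 11 → ℤ := fun i => ∑ k, (if π k = i then 1 else 0) with hP
  have hPP (i j : Fin 11) (hij : i ≠ j) : P i + P j = 2 := by
    have h := hg i j hij
    have hprod (k : Fin 11) : S i k * S j k =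
        1 - 2 * (if π k = i then 1 else 0) - 2 * (if π k = j then 1 else 0) := by
      rw [hπ, hπ]
      by_cases h1 : π k = i
      · rw [if_pos h1, if_neg (fun h2 => hij (h1.symm.trans h2))]; norm_num
      · rw [if_neg h1]; ring
    simp only [hprod, Finset.sum_sub_distrib, ← Finset.mul_sum] at h
    rw [Finset.sum_const, Finset.card_univ, Fintype.card_fin, nsmul_eq_mul] at h
    push_cast at h
    simp only [hP]
    linarith
  have hP1 (i : Fin 11) : P i = 1 := by
    obtain ⟨j, l, hij, hil, hjl⟩ : ∃ j l : Fin 11, i ≠ j ∧ i ≠ l ∧ j ≠ l := by revert i; decide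
    have h1 := hPP i j hij
    have h2 := hPP i l hil
    have h3 := hPP j l hjl
    omega
  have hsurj : Function.Surjective π := fun i => by
    by_contra! hne
    have := hP1 i
    simp [hP, hne] at this
  set σ := Equiv.ofBijective π (Finite.surjective_iff_bijective.1 hsurj) with hσ
  have hπσ (k : Fin 11) : π (σ.symm k) = k := σ.apply_symm_apply k
  refine not_isBalanced (by simp) (by simp) (isBalanced_of_sign (E := fun i k => E i (σ.symm k))
    (S := fun i k => S i (σ.symm k)) (fun i k => by simp only [hπ, hπσ]) fun i j hij s => ?_)
  rw [← hE i j hij s]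
  exact Equiv.sum_comp σ.symm fun k => if E i k - E j k = s then S i k * S j k else 0

lemma not_isButson_fourteen (H : Matrix (Fin 11) (Fin 11) ℂ) : ¬ IsButson 14 H := by
  intro hH
  have : Fact (Nat.Prime 7) := ⟨by norm_num⟩
  obtain ⟨S, E, t, hS, ht, hE, hg⟩ := IsButson.exists_sign_exponent (p := 7) (by norm_num) hH
  push_cast at hg
  have htri (i j l : Fin 11) (hij : i ≠ j) (hjl : j ≠ l) (hil : i ≠ l) :
      t i j * t i l * t j l = 1 := by
    obtain ⟨c, hc⟩ := triple_mod_four hS i j l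
    rw [hg i j hij, hg j l hjl, hg i l hil] at hc
    rcases ht i j hij with h | h <;> rcases ht j l hjl with h' | h' <;>
      rcases ht i l hil with h'' | h'' <;> rw [h, h', h''] at hc ⊢ <;> first | rfl | omega
  have hsymm (i j : Fin 11) (hij : i ≠ j) : t i j = t j i := by
    have h1 := hg i j hij
    have h2 := hg j i hij.symm
    simp only [mul_comm (S j _)] at h2
    omega
  obtain ⟨ε, hε, hεt⟩ : ∃ ε : Fin 11 → ℤ, (∀ i, ε i = 1 ∨ ε i = -1) ∧
      ∀ i j, i ≠ j → ε i * ε j * t i j = 1 := by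
    refine ⟨fun i => if i = 0 then 1 else t 0 i, fun i => ?_, fun i j hij => ?_⟩
    · dsimp only
      split_ifs with h
      · exact Or.inl rfl
      · exact ht 0 i (Ne.symm h)
    · by_cases hi : i = 0
      · subst hi
        simp only [if_true, if_neg hij.symm, one_mul]
        exact sq_eq_one_of_sign (ht 0 j hij)
      · by_cases hj : j = 0
        · subst hj
          simp only [if_true, if_neg hi, mul_one]
          rw [hsymm i 0 hij]
          exact sq_eq_one_of_sign (ht 0 i hij.symm)
        · simp only [if_neg hi, if_neg hj]
          exact htri 0 i j (Ne.symm hi) hij (Ne.symm hj)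
  have hsign {x y : ℤ} (hx : x = 1 ∨ x = -1) (hy : y = 1 ∨ y = -1) : x * y = 1 ∨ x * y = -1 := by
    rcases hx with rfl | rfl <;> rcases hy with rfl | rfl <;> simp
  have hsq (k : Fin 11) : (∑ i, ε i * S i k) * (∑ i, ε i * S i k) = 81 := by
    have := colSum_mul_star (M := fun i k => ((ε i * S i k : ℤ) : ℂ)) (α := 4) (β := 7)
      (by norm_num) (by norm_num) (by norm_num) (by norm_num) (fun i j => ?_) (fun i j => ?_) k
    · simp only [← Int.cast_sum, star_intCast] at this
      norm_num at this
      exact_mod_cast this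
    · simp only [star_intCast]
      split_ifs with hij
      · subst hij
        norm_cast
        simp [sq_eq_one_of_sign (hsign (hε i) (hS i _))]
      · have h : ∑ k, ε i * S i k * (ε j * S j k) = 7 := by
          have h1 (k : Fin 11) : ε i * S i k * (ε j * S j k) = ε i * ε j * (S i k * S j k) := by
            ring
          simp only [h1, ← Finset.mul_sum, hg i j hij]
          linear_combination 7 * hεt i j hij
        exact_mod_cast h
    · simp only [star_intCast]
      exact_mod_cast sq_eq_one_of_sign (hsign (hε i) (hS i j))
  have hδ (k : Fin 11) : ∃ δ : ℤ, (δ = 1 ∨ δ = -1) ∧ δ * ∑ i, ε i * S i k = 9 := by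
    have h : (∑ i, ε i * S i k) ^ 2 = 9 ^ 2 := by rw [sq, hsq]; norm_num
    rcases sq_eq_sq_iff_eq_or_eq_neg.1 h with h | h
    · exact ⟨1, by simp, by rw [h]; rfl⟩
    · exact ⟨-1, by simp, by rw [h]; rfl⟩
  choose δ hδ1 hδ9 using hδ
  have hprod (i j k : Fin 11) : δ k * (ε i * S i k) * (δ k * (ε j * S j k)) =
      ε i * ε j * (S i k * S j k) := by
    linear_combination (ε i * ε j * (S i k * S j k)) * sq_eq_one_of_sign (hδ1 k)
  refine false_of_colSum_eq_nine (E := E) (S := fun i k => δ k * (ε i * S i k))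
    (fun i k => hsign (hδ1 k) (hsign (hε i) (hS i k))) (fun i j hij s => ?_) (fun i j hij => ?_)
    fun k => by rw [← Finset.mul_sum, hδ9]
  · rw [← hεt i j hij, ← hE i j hij s, Finset.mul_sum]
    exact Finset.sum_congr rfl fun k _ => by rw [hprod, mul_ite_zero]
  · simp only [hprod, ← Finset.mul_sum, hg i j hij]
    linear_combination 7 * hεt i j hij

/-- In a vanishing sum of fifteenth roots of unity, the residues modulo 3 of the exponents are
equidistributed modulo 5. -/
lemma card_modEq_of_sum_eq_zero {ι : Type*} (s : Finset ι) (a : ι → ZMod 15)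
    (h : ∑ k ∈ s, ZMod.stdAddChar (a k) = (0 : ℂ)) (b c : ZMod 3) :
    (Finset.card {k ∈ s | (a k).cast = b} : ZMod 5) = Finset.card {k ∈ s | (a k).cast = c} := by
  have hdvd := cyclotomic_dvd_of_sum_eq_zero s (fun _ => 1) a (by simpa using h)
  simp only [map_one, one_mul] at hdvd
  have h5 : Fact (Nat.Prime 5) := ⟨by norm_num⟩
  have h3 : (Polynomial.cyclotomic 3 (ZMod 5)) ∣ ∑ k ∈ s, Polynomial.X ^ (a k).val := by
    have h1 := Polynomial.map_dvd (Int.castRingHom (ZMod 5)) hdvd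
    have h2 := Polynomial.cyclotomic_mul_prime_eq_pow_of_not_dvd (ZMod 5) (p := 5) (n := 3)
      (by norm_num)
    rw [Polynomial.map_cyclotomic, show Polynomial.cyclotomic 15 (ZMod 5) = _ from h2] at h1
    refine (dvd_pow_self _ (by norm_num)).trans (h1.trans ?_)
    simp [Polynomial.map_sum]
  set n : ℕ → ZMod 5 := fun i => (Finset.card {k ∈ s | (a k).cast = (i : ZMod 3)} : ZMod 5) with hn
  have h4 : (Polynomial.cyclotomic 3 (ZMod 5)) ∣ Polynomial.C (n 0) +
      Polynomial.C (n 1) * Polynomial.X + Polynomial.C (n 2) * Polynomial.X ^ 2 := by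
    have hX : Polynomial.cyclotomic 3 (ZMod 5) ∣ Polynomial.X ^ 3 - 1 :=
      Polynomial.cyclotomic.dvd_X_pow_sub_one 3 _
    have h5 : ∑ k ∈ s, Polynomial.X ^ ((a k).val % 3) = Polynomial.C (n 0) +
        Polynomial.C (n 1) * Polynomial.X + Polynomial.C (n 2) * Polynomial.X ^ 2 := by
      have hterm (x : ZMod 15) : (Polynomial.X : Polynomial (ZMod 5)) ^ (x.val % 3) =
          (if (x.cast : ZMod 3) = (0 : ℕ) then 1 else 0) +
          (if (x.cast : ZMod 3) = (1 : ℕ) then 1 else 0) * Polynomial.X +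
          (if (x.cast : ZMod 3) = (2 : ℕ) then 1 else 0) * Polynomial.X ^ 2 := by
        have hx : x.val % 3 = 0 ∧ (x.cast : ZMod 3) = 0 ∨ x.val % 3 = 1 ∧ (x.cast : ZMod 3) = 1 ∨
            x.val % 3 = 2 ∧ (x.cast : ZMod 3) = 2 := by
          revert x; decide
        have e01 : (0 : ZMod 3) ≠ 1 := by decide
        have e02 : (0 : ZMod 3) ≠ 2 := by decide
        have e12 : (1 : ZMod 3) ≠ 2 := by decide
        rcases hx with ⟨h1, h2⟩ | ⟨h1, h2⟩ | ⟨h1, h2⟩ <;> rw [h1, h2] <;>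
          simp [e01, e02, e12, e01.symm, e02.symm, e12.symm]
      simp only [hterm, Finset.sum_add_distrib, ← Finset.sum_mul, Finset.sum_boole, hn,
        map_natCast]
    rw [← h5]
    refine (dvd_sub_right h3).1 ?_
    rw [← Finset.sum_sub_distrib]
    refine Finset.dvd_sum fun k _ => hX.trans ?_
    rw [← Nat.div_add_mod (a k).val 3, Nat.mul_add_mod, Nat.mod_mod, pow_add, pow_mul]
    rw [show ∀ x y : Polynomial (ZMod 5), x * y - y = (x - 1) * y from fun x y => by ring]
    refine Dvd.dvd.mul_right ?_ _
    simpa using sub_dvd_pow_sub_pow (Polynomial.X ^ 3 : Polynomial (ZMod 5)) 1 ((a k).val / 3)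
  have h6 : Polynomial.C (n 0 - n 2) + Polynomial.C (n 1 - n 2) * Polynomial.X = 0 := by
    refine Polynomial.eq_zero_of_dvd_of_natDegree_lt (p := Polynomial.cyclotomic 3 (ZMod 5)) ?_ ?_
    · convert dvd_sub h4 (Dvd.intro_left (Polynomial.C (n 2)) rfl) using 1
      rw [Polynomial.cyclotomic_three]
      simp only [map_sub]
      ring
    · rw [Polynomial.natDegree_cyclotomic, Nat.totient_prime Nat.prime_three]
      refine (Polynomial.natDegree_add_le _ _).trans_lt (max_lt (by simp) ?_)
      exact (Polynomial.natDegree_C_mul_le _ _).trans_lt (by simp)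
  have h02 : n 0 = n 2 := by
    have := congrArg (Polynomial.coeff · 0) h6
    simpa [sub_eq_zero] using this
  have h12 : n 1 = n 2 := by
    have := congrArg (Polynomial.coeff · 1) h6
    simpa [sub_eq_zero, Polynomial.coeff_C] using this
  have hall (b : ZMod 3) : (Finset.card {k ∈ s | (a k).cast = b} : ZMod 5) = n 2 := by
    obtain rfl | rfl | rfl : b = (0 : ℕ) ∨ b = (1 : ℕ) ∨ b = (2 : ℕ) := by revert b; decide
    exacts [h02, h12, rfl]
  rw [hall, hall]

lemma sum_univ_zmod_three {M : Type*} [AddCommMonoid M] (f : ZMod 3 → M) :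
    ∑ b, f b = f 0 + f 1 + f 2 := Fin.sum_univ_three f

lemma card_eq_of_sum_eq_zero {d : Fin 11 → ZMod 15} (h : ∑ k, ZMod.stdAddChar (d k) = (0 : ℂ))
    (b : ZMod 3) :
    Finset.card {k | ((d k).cast : ZMod 3) = b} =
      if b = -∑ k, ((d k).cast : ZMod 3) then 7 else 2 := by
  set N : ZMod 3 → ℕ := fun b => Finset.card {k | ((d k).cast : ZMod 3) = b} with hN
  have hmod (b c : ZMod 3) : N b % 5 = N c % 5 :=
    (ZMod.natCast_eq_natCast_iff' _ _ 5).1 (card_modEq_of_sum_eq_zero Finset.univ d h b c)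
  have hsum : N 0 + N 1 + N 2 = 11 := by
    have := Finset.card_eq_sum_card_fiberwise (s := (Finset.univ : Finset (Fin 11)))
      (t := Finset.univ) (f := fun k => ((d k).cast : ZMod 3)) fun _ _ => Finset.mem_univ _
    rw [sum_univ_zmod_three] at this
    simpa using this.symm
  have hr : ∑ k, ((d k).cast : ZMod 3) = N 1 + 2 * N 2 := by
    rw [← Finset.sum_fiberwise_of_maps_to (s := Finset.univ) (t := Finset.univ)
      (g := fun k => ((d k).cast : ZMod 3)) fun _ _ => Finset.mem_univ _]
    have (b : ZMod 3) : ∑ k with ((d k).cast : ZMod 3) = b, ((d k).cast : ZMod 3) = N b * b := by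
      rw [Finset.sum_congr rfl (g := fun _ => b) fun k hk => (Finset.mem_filter.1 hk).2,
        Finset.sum_const, nsmul_eq_mul]
    rw [Finset.sum_congr rfl fun b _ => this b]
    rw [sum_univ_zmod_three]
    ring
  change N b = _
  rw [hr]
  have h01 := hmod 0 1
  have h12 := hmod 1 2
  have hcases : N 0 = 7 ∧ N 1 = 2 ∧ N 2 = 2 ∨ N 0 = 2 ∧ N 1 = 7 ∧ N 2 = 2 ∨
      N 0 = 2 ∧ N 1 = 2 ∧ N 2 = 7 := by omega
  rcases hcases with ⟨h0, h1, h2⟩ | ⟨h0, h1, h2⟩ | ⟨h0, h1, h2⟩ <;> rw [h1, h2] <;>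
    obtain rfl | rfl | rfl : b = 0 ∨ b = 1 ∨ b = 2 := by revert b; decide
  all_goals first | rw [h0]; rfl | rw [h1]; rfl | rw [h2]; rfl

lemma sum_comp_zmod_three {M : Type*} [AddCommMonoid M] (c : Fin 11 → ZMod 3) (f : ZMod 3 → M) :
    ∑ k, f (c k) = ∑ b, Finset.card {k | c k = b} • f b := by
  rw [← Finset.sum_fiberwise_of_maps_to (s := Finset.univ) (t := Finset.univ) (g := c)
    fun _ _ => Finset.mem_univ _]
  refine Finset.sum_congr rfl fun b _ => ?_
  rw [Finset.sum_congr rfl (g := fun _ => f b) fun k hk => by rw [(Finset.mem_filter.1 hk).2],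
    Finset.sum_const]

lemma sum_stdAddChar_zmod_three : ∑ b : ZMod 3, ZMod.stdAddChar b = (0 : ℂ) :=
  AddChar.sum_eq_zero_of_ne_one ((AddChar.zmod_char_ne_one_iff 3 _).2
    ((isPrimitiveRoot_stdAddChar_one 3).ne_one (by norm_num)))

lemma sum_stdAddChar_mul_star_ne (c : Fin 11 → ZMod 3) :
    (∑ i, (ZMod.stdAddChar (c i) : ℂ)) * star (∑ i, (ZMod.stdAddChar (c i) : ℂ)) ≠ 61 := by
  have h2 : (ZMod.stdAddChar (2 : ZMod 3) : ℂ) = star (ZMod.stdAddChar (1 : ZMod 3)) := by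
    rw [show (2 : ZMod 3) = 0 - 1 by decide, ← stdAddChar_mul_star, AddChar.map_zero_eq_one,
      one_mul]
  have hs := sum_stdAddChar_zmod_three
  rw [sum_univ_zmod_three, h2, AddChar.map_zero_eq_one] at hs
  have hm := stdAddChar_mul_star (1 : ZMod 3) 1
  rw [sub_self, AddChar.map_zero_eq_one] at hm
  rw [sum_comp_zmod_three c fun b => (ZMod.stdAddChar b : ℂ), sum_univ_zmod_three, h2,
    AddChar.map_zero_eq_one]
  have hn := sum_comp_zmod_three c fun _ => 1
  rw [sum_univ_zmod_three] at hn
  simp only [Finset.sum_const, Finset.card_univ, Fintype.card_fin, smul_eq_mul, mul_one] at hn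
  generalize Finset.card {k | c k = 0} = n0 at *
  generalize Finset.card {k | c k = 1} = n1 at *
  generalize Finset.card {k | c k = 2} = n2 at *
  simp only [nsmul_eq_mul, mul_one, star_add, star_mul', star_natCast, star_star]
  generalize (ZMod.stdAddChar (1 : ZMod 3) : ℂ) = w at *
  intro h
  have h' : (n0 ^ 2 + n1 ^ 2 + n2 ^ 2 : ℂ) = 61 + n0 * n1 + n0 * n2 + n1 * n2 := by
    linear_combination h - (n0 * n1 + n0 * n2 : ℂ) * hs - (n1 ^ 2 + n2 ^ 2 - 2 * n1 * n2 : ℂ) * hm -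
      (n1 * n2 : ℂ) * (w + star w - 1) * hs
  norm_cast at h'
  obtain rfl : n0 = 11 - n1 - n2 := by omega
  have h1 : n1 ≤ 11 := by omega
  have h2 : n2 ≤ 11 := by omega
  interval_cases n1 <;> interval_cases n2 <;> omega

lemma not_isButson_fifteen (H : Matrix (Fin 11) (Fin 11) ℂ) : ¬ IsButson 15 H := by
  intro hH
  choose E hE using fun i j => exists_stdAddChar_eq (hH.1 i j)
  set R : Fin 11 → ZMod 3 := fun i => ∑ k, (E i k).cast with hR
  have hcast (x y : ZMod 15) : ((x - y).cast : ZMod 3) = x.cast - y.cast :=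
    ZMod.cast_sub (by norm_num) x y
  refine sum_stdAddChar_mul_star_ne (fun i => (E i 0).cast + R i) ?_
  rw [colSum_mul_star (M := fun i k => ZMod.stdAddChar ((E i k).cast + R i)) (α := 6) (β := 5)
    (by norm_num) (by norm_num) (by norm_num) (by norm_num) (fun i j => ?_) (fun i j => ?_) 0]
  · norm_num
  · simp only [stdAddChar_mul_star]
    split_ifs with hij
    · subst hij
      simp
    · have h := hH.sum_mul_star hij
      simp only [hE, stdAddChar_mul_star] at h
      have hr : ∑ k, ((E i k - E j k).cast : ZMod 3) = R i - R j := by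
        simp only [hcast, Finset.sum_sub_distrib, hR]
      have hd (k : Fin 11) : ((E i k).cast + R i - ((E j k).cast + R j) : ZMod 3) =
          (E i k - E j k).cast + (R i - R j) := by
        rw [hcast]; ring
      simp only [hd]
      rw [sum_comp_zmod_three (fun k => ((E i k - E j k).cast : ZMod 3))
        fun b => (ZMod.stdAddChar (b + (R i - R j)) : ℂ)]
      simp only [card_eq_of_sum_eq_zero h, hr]
      have hb (b : ZMod 3) : (if b = -(R i - R j) then 7 else 2) •
          (ZMod.stdAddChar (b + (R i - R j)) : ℂ) = 2 * ZMod.stdAddChar (b + (R i - R j)) +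
            if b = -(R i - R j) then 5 else 0 := by
        split_ifs with hb
        · rw [hb, neg_add_cancel, AddChar.map_zero_eq_one]; norm_num
        · simp
      simp only [hb, Finset.sum_add_distrib, ← Finset.mul_sum, Finset.sum_ite_eq', Finset.mem_univ,
        if_true]
      have hshift := Equiv.sum_comp (Equiv.addRight (R i - R j)) fun b => (ZMod.stdAddChar b : ℂ)
      simp only [Equiv.coe_addRight] at hshift
      rw [hshift, sum_stdAddChar_zmod_three]
      simp
  · rw [stdAddChar_mul_star, sub_self, AddChar.map_zero_eq_one]

lemma eq_zero_of_norm_form_eq_zero_zmod : ∀ a b c d : ZMod 11,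
    a * b + b * c + c * d = 0 → a ^ 2 + b ^ 2 + c ^ 2 + d ^ 2 + a * c + b * d = 0 →
    a = 0 ∧ b = 0 ∧ c = 0 ∧ d = 0 := by
  decide +kernel

lemma dvd_of_dvd_norm_form {a b c d : ℤ} (hQ : a * b + b * c + c * d = 0)
    (hP : 11 ∣ a ^ 2 + b ^ 2 + c ^ 2 + d ^ 2 + a * c + b * d) :
    11 ∣ a ∧ 11 ∣ b ∧ 11 ∣ c ∧ 11 ∣ d := by
  have hPz := (ZMod.intCast_zmod_eq_zero_iff_dvd _ 11).2 hP
  have hQz := congrArg (Int.cast : ℤ → ZMod 11) hQ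
  push_cast at hQz hPz
  simpa only [ZMod.intCast_zmod_eq_zero_iff_dvd, Nat.cast_ofNat] using
    eq_zero_of_norm_form_eq_zero_zmod _ _ _ _ hQz hPz

/-- The norm form of `ℤ[ζ₁₂]` over `ℤ[√3]` does not represent an odd power of `11`. -/
lemma norm_form_ne_odd_pow (m : ℕ) : ∀ a b c d : ℤ, a * b + b * c + c * d = 0 →
    a ^ 2 + b ^ 2 + c ^ 2 + d ^ 2 + a * c + b * d ≠ 11 ^ (2 * m + 1) := by
  induction m with
  | zero =>
    intro a b c d hQ hP
    obtain ⟨⟨a, rfl⟩, ⟨b, rfl⟩, ⟨c, rfl⟩, ⟨d, rfl⟩⟩ :=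
      dvd_of_dvd_norm_form hQ (hP ▸ dvd_pow_self 11 (Nat.succ_ne_zero _))
    have : 11 * (a ^ 2 + b ^ 2 + c ^ 2 + d ^ 2 + a * c + b * d) = 1 := by
      norm_num at hP
      linarith
    omega
  | succ m ih =>
    intro a b c d hQ hP
    obtain ⟨⟨a, rfl⟩, ⟨b, rfl⟩, ⟨c, rfl⟩, ⟨d, rfl⟩⟩ :=
      dvd_of_dvd_norm_form hQ (hP ▸ dvd_pow_self 11 (Nat.succ_ne_zero _))
    refine ih a b c d (by linarith) ?_
    have : (11 : ℤ) ^ (2 * (m + 1) + 1) = 121 * 11 ^ (2 * m + 1) := by ring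
    linarith

/-- The order `ℤ[z]` for a root `z` of `X⁴ - X² + 1`. -/
def quarticOrder (z : ℂ) (h : z ^ 4 = z ^ 2 - 1) : Subring ℂ where
  carrier := {x | ∃ a b c d : ℤ, x = a + b * z + c * z ^ 2 + d * z ^ 3}
  mul_mem' := by
    rintro _ _ ⟨a, b, c, d, rfl⟩ ⟨a', b', c', d', rfl⟩
    refine ⟨a * a' - (b * d' + c * c' + d * b') - d * d', a * b' + b * a' - (c * d' + d * c'),
      a * c' + b * b' + c * a' + (b * d' + c * c' + d * b'),
      a * d' + b * c' + c * b' + d * a' + (c * d' + d * c'), ?_⟩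
    push_cast
    linear_combination ((b * d' + c * c' + d * b' : ℂ) + (c * d' + d * c') * z +
      d * d' * (z ^ 2 + 1)) * h
  one_mem' := ⟨1, 0, 0, 0, by simp⟩
  add_mem' := by
    rintro _ _ ⟨a, b, c, d, rfl⟩ ⟨a', b', c', d', rfl⟩
    exact ⟨a + a', b + b', c + c', d + d', by push_cast; ring⟩
  zero_mem' := ⟨0, 0, 0, 0, by simp⟩
  neg_mem' := by
    rintro _ ⟨a, b, c, d, rfl⟩
    exact ⟨-a, -b, -c, -d, by push_cast; ring⟩

lemma det_mem_subring {n : Type*} [Fintype n] [DecidableEq n] (S : Subring ℂ)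
    (M : Matrix n n ℂ) (h : ∀ i j, M i j ∈ S) : M.det ∈ S := by
  rw [Matrix.det_apply]
  refine sum_mem fun σ _ => ?_
  rw [Units.smul_def]
  exact zsmul_mem (prod_mem fun i _ => h _ _) _

lemma eq_zero_of_three_mul_sq_eq_sq (x y : ℤ) (h : 3 * x ^ 2 = y ^ 2) : x = 0 := by
  by_contra hx
  have hx' : (x : ℚ) ≠ 0 := by exact_mod_cast hx
  have hsq : IsSquare ((3 : ℕ) : ℚ) := by
    refine ⟨y / x, ?_⟩
    have : (3 : ℚ) * x ^ 2 = y ^ 2 := by exact_mod_cast h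
    field_simp
    push_cast
    linarith
  rw [Rat.isSquare_natCast_iff] at hsq
  exact Nat.prime_three.prime.irreducible.not_isSquare hsq

lemma not_isButson_twelve (H : Matrix (Fin 11) (Fin 11) ℂ) : ¬ IsButson 12 H := by
  rintro ⟨hroot, hH⟩
  have hprim := isPrimitiveRoot_stdAddChar_one 12
  have hpow := fun a : ZMod 12 => stdAddChar_eq_pow a
  have hnorm :
      (ZMod.stdAddChar (1 : ZMod 12) : ℂ) * star (ZMod.stdAddChar (1 : ZMod 12) : ℂ) = 1 := by
    have := stdAddChar_mul_star (1 : ZMod 12) 1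
    simpa using this
  generalize (ZMod.stdAddChar (1 : ZMod 12) : ℂ) = z at hprim hpow hnorm
  have h4 : z ^ 4 = z ^ 2 - 1 := by
    have h6 : z ^ 6 = -1 := by
      have : (z ^ 6 - 1) * (z ^ 6 + 1) = 0 := by linear_combination hprim.pow_eq_one
      rcases mul_eq_zero.1 this with h | h
      · exact absurd (sub_eq_zero.1 h) (hprim.pow_ne_one_of_pos_of_lt (by norm_num) (by norm_num))
      · linear_combination h
    have h2 : z ^ 2 + 1 ≠ 0 := fun h =>
      hprim.pow_ne_one_of_pos_of_lt (l := 4) (by norm_num) (by norm_num)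
        (by linear_combination (z ^ 2 - 1) * h)
    refine mul_left_cancel₀ h2 ?_
    linear_combination h6
  have hstar : star z = z - z ^ 3 := by
    have hz : z ≠ 0 := hprim.ne_zero (by norm_num)
    refine mul_left_cancel₀ hz ?_
    linear_combination hnorm + h4
  have hmem : H.det ∈ quarticOrder z h4 := by
    refine det_mem_subring _ _ fun i j => ?_
    obtain ⟨a, ha⟩ := exists_stdAddChar_eq (hroot i j)
    rw [ha, hpow]
    exact pow_mem (show z ∈ quarticOrder z h4 from ⟨0, 1, 0, 0, by simp⟩) _
  obtain ⟨a, b, c, d, hdet⟩ := hmem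
  have hdd : H.det * star H.det = 11 ^ 11 := by
    have := congrArg Matrix.det hH
    simpa [Matrix.det_mul, Matrix.det_conjTranspose, Matrix.det_smul] using this
  have hstar2 : (z - z ^ 3) ^ 2 = 1 - z ^ 2 := by linear_combination (z ^ 2 - 1) * h4
  have hstar3 : (z - z ^ 3) ^ 3 = - z ^ 3 := by
    linear_combination (z - z ^ 3) * hstar2 + z * h4
  have key : ((a ^ 2 + b ^ 2 + c ^ 2 + d ^ 2 + a * c + b * d : ℤ) : ℂ) +
      ((a * b + b * c + c * d : ℤ) : ℂ) * (2 * z - z ^ 3) = 11 ^ 11 := by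
    rw [← hdd, hdet]
    simp only [star_add, star_mul', star_pow, hstar, hstar2, hstar3, Complex.star_def, map_intCast]
    push_cast
    linear_combination (b * (b + d) + c * c - d * b + (c * (b + d) + d * c) * z +
      d * (b + d) * (z ^ 2 + 1) : ℂ) * h4
  have hw : (2 * z - z ^ 3) ^ 2 = 3 := by linear_combination (z ^ 2 - 3) * h4
  generalize hP : a ^ 2 + b ^ 2 + c ^ 2 + d ^ 2 + a * c + b * d = P at key
  generalize hQ : a * b + b * c + c * d = Q at key
  have hsq : ((3 * Q ^ 2 : ℤ) : ℂ) = (((11 ^ 11 - P) ^ 2 : ℤ) : ℂ) := by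
    have : (Q : ℂ) * (2 * z - z ^ 3) = 11 ^ 11 - P := by linear_combination key
    rw [Int.cast_pow, Int.cast_sub, Int.cast_pow, Int.cast_ofNat, ← this, mul_pow, hw]
    push_cast
    ring
  obtain rfl := eq_zero_of_three_mul_sq_eq_sq Q _ (Int.cast_injective hsq)
  refine norm_form_ne_odd_pow 5 a b c d hQ (hP.trans ?_)
  rw [Int.cast_zero, zero_mul, add_zero] at key
  exact_mod_cast key

theorem no_BH_11_q (q : ℕ) (hq : q ∈ ({10, 12, 14, 15} : Set ℕ)) :
    ¬ ∃ H : Matrix (Fin 11) (Fin 11) ℂ, IsButson q H := by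
  rintro ⟨H, hH⟩
  rcases hq with rfl | rfl | rfl | rfl
  · exact not_isButson_ten H hH
  · exact not_isButson_twelve H hH
  · exact not_isButson_fourteen H hH
  · exact not_isButson_fifteen H hH
end

section
/- There exists a BH(14,10) matrix; that is, there is a 14×14 complex matrix H all of whose entries are 10th roots of unity satisfying H·H* = 14·I_14. -/
open Matrix

/-- Exponents of a `14 × 14` Butson matrix, as powers of a primitive tenth root of unity. -/
def butsonExponent : Matrix (Fin 14) (Fin 14) ℕ :=
  !![5, 0, 0, 0, 0, 0, 0, 0, 0, 0, 0, 0, 0, 0;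
     0, 5, 0, 0, 2, 4, 6, 0, 0, 2, 4, 6, 8, 8;
     0, 0, 7, 2, 0, 6, 2, 0, 4, 4, 8, 2, 6, 8;
     0, 0, 2, 9, 6, 8, 4, 0, 0, 8, 6, 4, 4, 2;
     0, 2, 0, 6, 7, 2, 0, 2, 8, 4, 6, 0, 8, 4;
     0, 4, 6, 8, 2, 9, 0, 4, 2, 8, 4, 0, 6, 0;
     0, 6, 2, 4, 0, 0, 5, 6, 8, 2, 8, 0, 4, 0;
     0, 8, 2, 4, 0, 0, 2, 8, 3, 7, 3, 7, 9, 5;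
     0, 8, 8, 4, 4, 2, 0, 3, 0, 9, 9, 5, 3, 7;
     0, 6, 8, 6, 8, 6, 6, 1, 3, 0, 1, 1, 1, 3;
     0, 4, 4, 8, 6, 0, 0, 9, 5, 3, 0, 5, 1, 9;
     0, 2, 0, 0, 2, 4, 8, 7, 5, 7, 9, 8, 3, 3;
     0, 0, 6, 0, 4, 8, 4, 5, 9, 3, 1, 9, 0, 5;
     0, 0, 4, 2, 8, 4, 8, 5, 7, 9, 3, 3, 9, 0]

/-- Coordinates of `ζ ^ n` in the basis `1, ζ, ζ², ζ³` of `ℤ[ζ]`, for `ζ` a primitive tenth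
root of unity. -/
def tenthRootCoord (n : ℕ) : Fin 4 → ℤ :=
  match n % 10 with
  | 0 => ![1, 0, 0, 0]
  | 1 => ![0, 1, 0, 0]
  | 2 => ![0, 0, 1, 0]
  | 3 => ![0, 0, 0, 1]
  | 4 => ![-1, 1, -1, 1]
  | 5 => ![-1, 0, 0, 0]
  | 6 => ![0, -1, 0, 0]
  | 7 => ![0, 0, -1, 0]
  | 8 => ![0, 0, 0, -1]
  | _ => ![1, -1, 1, -1]

theorem pow_eq_sum_tenthRootCoord {R : Type*} [CommRing R] {ζ : R}
    (h : ζ ^ 4 - ζ ^ 3 + ζ ^ 2 - ζ + 1 = 0) (n : ℕ) :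
    ζ ^ n = ∑ t : Fin 4, (tenthRootCoord n t : R) * ζ ^ (t : ℕ) := by
  have h4 : ζ ^ 4 = ζ ^ 3 - ζ ^ 2 + ζ - 1 := by linear_combination h
  have h5 : ζ ^ 5 = -1 := by linear_combination (ζ + 1) * h
  have h10 : ζ ^ 10 = 1 := by linear_combination (ζ ^ 5 - 1) * h5
  rw [pow_eq_pow_mod n h10]
  have hn : n % 10 < 10 := Nat.mod_lt _ (by norm_num)
  unfold tenthRootCoord
  generalize n % 10 = m at hn
  interval_cases m <;> simp [Fin.sum_univ_four]
  · linear_combination h4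
  · linear_combination h5
  · linear_combination ζ * h5
  · linear_combination ζ ^ 2 * h5
  · linear_combination ζ ^ 3 * h5
  · linear_combination ζ ^ 4 * h5 - h4

theorem sum_tenthRootCoord_butsonExponent (i j : Fin 14) (t : Fin 4) :
    ∑ k, tenthRootCoord (butsonExponent i k + 9 * butsonExponent j k) t =
      if i = j ∧ t = 0 then 14 else 0 := by
  revert i j t
  decide +kernel

theorem exists_BH_14_10 : ∃ H : Matrix (Fin 14) (Fin 14) ℂ, IsButson 10 H := by
  obtain ⟨ζ, hζ⟩ : ∃ ζ : ℂ, IsPrimitiveRoot ζ 10 :=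
    ⟨_, Complex.isPrimitiveRoot_exp 10 (by norm_num)⟩
  have h10 : ζ ^ 10 = 1 := hζ.pow_eq_one
  have h5 : ζ ^ 5 = -1 := by
    have h : (ζ ^ 5 - 1) * (ζ ^ 5 + 1) = 0 := by linear_combination h10
    rcases mul_eq_zero.mp h with h | h
    · exact absurd (sub_eq_zero.mp h) (hζ.pow_ne_one_of_pos_of_lt (by norm_num) (by norm_num))
    · linear_combination h
  have hmin : ζ ^ 4 - ζ ^ 3 + ζ ^ 2 - ζ + 1 = 0 := by
    have h : (ζ + 1) * (ζ ^ 4 - ζ ^ 3 + ζ ^ 2 - ζ + 1) = 0 := by linear_combination h5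
    rcases mul_eq_zero.mp h with h | h
    · refine absurd ?_ (hζ.pow_ne_one_of_pos_of_lt (l := 2) (by norm_num) (by norm_num))
      linear_combination (ζ - 1) * h
    · exact h
  have hstar : star ζ = ζ ^ 9 := by
    have hnorm : ζ * star ζ = 1 := by
      rw [Complex.star_def, Complex.mul_conj, Complex.normSq_eq_norm_sq,
        hζ.norm'_eq_one (by norm_num)]
      simp
    linear_combination ζ ^ 9 * hnorm - star ζ * h10
  refine ⟨butsonExponent.map (ζ ^ ·), fun i j => ?_, ?_⟩
  · rw [Matrix.map_apply, ← pow_mul, mul_comm, pow_mul, h10, one_pow]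
  · ext i j
    have hterm (k : Fin 14) : ζ ^ butsonExponent i k * star (ζ ^ butsonExponent j k) =
        ∑ t : Fin 4, (tenthRootCoord (butsonExponent i k + 9 * butsonExponent j k) t : ℂ) *
          ζ ^ (t : ℕ) := by
      rw [← pow_eq_sum_tenthRootCoord hmin, star_pow, hstar, ← pow_mul, ← pow_add]
    simp only [Matrix.mul_apply, Matrix.conjTranspose_apply, Matrix.map_apply, hterm]
    rw [Finset.sum_comm]
    simp only [← Finset.sum_mul, ← Int.cast_sum, sum_tenthRootCoord_butsonExponent]
    by_cases hij : i = j <;> simp [hij]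
end
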